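/- Identify ℂ with ℝ² and ℂ⁶ × ℝ with ℝ¹³, and define polynomial functions f and g on ℂ⁶ × ℝ by f(z,x) = |z₁|² + x² and g(z,x) = |z₁² + z₂² + z₃² + z₄² + z₅² + z₆³|² + x², for (z,x) = (z₁,…,z₆,x). Then there exists a semialgebraic homeomorphism h of ℂ⁶ × ℝ with h(0) = 0 such that h̃(𝒻_f) = 𝒻_g (indeed one may take h with f = g ∘ h). -/

import Mathlib

noncomputable section
open Classical Filter Topology

namespace RealMilnor

/-- Semialgebraic subsets of `ℝ^ι`: the Boolean algebra generated by the sets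
`{x | P(x) > 0}` for real polynomials `P`. -/
inductive IsRSA (ι : Type) : Set (ι → ℝ) → Prop
  | basic (P : MvPolynomial ι ℝ) : IsRSA ι {x | 0 < MvPolynomial.eval x P}
  | compl {s : Set (ι → ℝ)} : IsRSA ι s → IsRSA ι sᶜ
  | union {s t : Set (ι → ℝ)} : IsRSA ι s → IsRSA ι t → IsRSA ι (s ∪ t)

/-- The Euclidean norm on `ℝⁿ`. -/
def enorm {n : ℕ} (x : Fin n → ℝ) : ℝ := Real.sqrt (∑ i, x i ^ 2)

/-- An arc in `ℝⁿ`: (a representative of) the germ at `0⁺` of a continuous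
semialgebraic map `(0,ε) → ℝⁿ`. -/
def IsArc {n : ℕ} (γ : ℝ → (Fin n → ℝ)) : Prop :=
  ∃ ε : ℝ, 0 < ε ∧ ContinuousOn γ (Set.Ioo 0 ε) ∧
    IsRSA (Option (Fin n))
      {z | z none ∈ Set.Ioo 0 ε ∧ (fun i => z (some i)) = γ (z none)}

/-- The set `𝒻_f` of arcs `γ` with `lim_{t→0⁺} γ(t) = 0` and `f(γ(t)) = t` for all
sufficiently small `t > 0`. -/
def ArcFib {n : ℕ} (f : (Fin n → ℝ) → ℝ) : Set (ℝ → (Fin n → ℝ)) :=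
  {γ | IsArc γ ∧ Filter.Tendsto γ (nhdsWithin 0 (Set.Ioi 0)) (nhds 0) ∧
       ∀ᶠ t in nhdsWithin (0 : ℝ) (Set.Ioi 0), f (γ t) = t}

/-- The positive Milnor fibre `F_f(r,a) = {x ∈ ℝⁿ : |x| ≤ r, f(x) = a}`. -/
def Fib {n : ℕ} (f : (Fin n → ℝ) → ℝ) (r a : ℝ) : Set (Fin n → ℝ) :=
  {x | enorm x ≤ r ∧ f x = a}

/-- The graph of the restriction of `f : ℝⁿ → ℝ` to `A`. -/
def graphFunOn {n : ℕ} (f : (Fin n → ℝ) → ℝ) (A : Set (Fin n → ℝ)) :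
    Set (Option (Fin n) → ℝ) :=
  {z | (fun i => z (some i)) ∈ A ∧ z none = f (fun i => z (some i))}

/-- The graph of the restriction of `φ : ℝⁿ → ℝᵐ` to `A`. -/
def graphMapOn {n m : ℕ} (φ : (Fin n → ℝ) → (Fin m → ℝ)) (A : Set (Fin n → ℝ)) :
    Set (Fin n ⊕ Fin m → ℝ) :=
  {z | (fun i => z (Sum.inl i)) ∈ A ∧
       (fun j => z (Sum.inr j)) = φ (fun i => z (Sum.inl i))}

/-- `A` and `B` are semialgebraically homeomorphic: there is a semialgebraic
bijection between them, continuous with continuous inverse. -/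
def IsSemialgHomeo {n : ℕ} (A B : Set (Fin n → ℝ)) : Prop :=
  ∃ φ ψ : (Fin n → ℝ) → (Fin n → ℝ),
    Set.MapsTo φ A B ∧ Set.MapsTo ψ B A ∧
    (∀ x ∈ A, ψ (φ x) = x) ∧ (∀ y ∈ B, φ (ψ y) = y) ∧
    ContinuousOn φ A ∧ ContinuousOn ψ B ∧
    IsRSA (Fin n ⊕ Fin n) (graphMapOn φ A) ∧ IsRSA (Fin n ⊕ Fin n) (graphMapOn ψ B)


/-- The `j`-th complex coordinate on `ℂ⁶ × ℝ ≅ ℝ¹³` (identifying `ℂ` with `ℝ²`). -/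
def zc (x : Fin 13 → ℝ) (j : Fin 6) : ℂ :=
  (x ⟨2 * j.1, by have := j.isLt; omega⟩ : ℝ) +
    (x ⟨2 * j.1 + 1, by have := j.isLt; omega⟩ : ℝ) * Complex.I

/-- `f(z,x) = |z₁|² + x²` on `ℂ⁶ × ℝ`. -/
def fKer (x : Fin 13 → ℝ) : ℝ := Complex.normSq (zc x 0) + x 12 ^ 2

/-- `g(z,x) = |z₁² + z₂² + z₃² + z₄² + z₅² + z₆³|² + x²` on `ℂ⁶ × ℝ`. -/
def gKer (x : Fin 13 → ℝ) : ℝ :=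
  Complex.normSq ((zc x 0) ^ 2 + (zc x 1) ^ 2 + (zc x 2) ^ 2 + (zc x 3) ^ 2 +
    (zc x 4) ^ 2 + (zc x 5) ^ 3) + x 12 ^ 2


section SAsets

lemma rsa_univ {ι : Type} : IsRSA ι Set.univ := by
  have := IsRSA.basic (ι := ι) 1
  simpa using this

lemma rsa_inter {ι : Type} {s t : Set (ι → ℝ)} (hs : IsRSA ι s) (ht : IsRSA ι t) :
    IsRSA ι (s ∩ t) := by
  have := (hs.compl.union ht.compl).compl
  simpa [Set.compl_union] using this

lemma rsa_iInter {ι : Type} {α : Type} (F : Finset α) {s : α → Set (ι → ℝ)}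
    (hs : ∀ a, IsRSA ι (s a)) : IsRSA ι {x | ∀ a ∈ F, x ∈ s a} := by
  induction F using Finset.induction_on with
  | empty => simpa using rsa_univ
  | insert a F ha ih =>
    have := rsa_inter (hs a) ih
    convert this using 1
    ext x; simp

lemma rsa_preim {κ l : Type} (u : κ → MvPolynomial l ℝ) {T : Set (κ → ℝ)} (hT : IsRSA κ T) :
    IsRSA l {z | (fun k => MvPolynomial.eval z (u k)) ∈ T} := by
  induction hT with
  | basic P =>
    have := IsRSA.basic (MvPolynomial.bind₁ u P)
    convert this using 2
    ext z
    have : MvPolynomial.eval z (MvPolynomial.bind₁ u P)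
        = MvPolynomial.eval (fun k => MvPolynomial.eval z (u k)) P := by
      have := MvPolynomial.eval₂Hom_bind₁ (RingHom.id ℝ) z u P
      simpa using this
    simp [this]
  | compl _ ih => exact ih.compl
  | union _ _ ih1 ih2 => exact ih1.union ih2

lemma rsa_comp {κ l : Type} (e : κ → l) {T : Set (κ → ℝ)} (hT : IsRSA κ T) :
    IsRSA l {z | z ∘ e ∈ T} := by
  have := rsa_preim (fun k => MvPolynomial.X (e k)) hT
  simpa [Function.comp_def] using this

lemma rsa_eq0 {ι : Type} (P : MvPolynomial ι ℝ) : IsRSA ι {x | MvPolynomial.eval x P = 0} := by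
  have := rsa_inter (IsRSA.basic P).compl (IsRSA.basic (-P)).compl
  convert this using 1
  ext x
  simp only [Set.mem_ofPred_eq, Set.mem_inter_iff, Set.mem_compl_iff, map_neg, not_lt,
    Left.neg_nonpos_iff]
  constructor
  · intro h; simp [h]
  · rintro ⟨h1, h2⟩; linarith

/-- prepend a coordinate -/
def ocons {κ : Type} (t : ℝ) (z : κ → ℝ) : Option κ → ℝ := fun o => o.elim t z

@[simp] lemma ocons_none {κ : Type} (t : ℝ) (z : κ → ℝ) : ocons t z none = t := rfl
@[simp] lemma ocons_some {κ : Type} (t : ℝ) (z : κ → ℝ) (k : κ) : ocons t z (some k) = z k := rfl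

def St {ι : Type} (f : (ι → ℝ) → ℝ) : Prop :=
  ∀ (κ : Type) (e : ι → κ) (T : Set (Option κ → ℝ)), IsRSA (Option κ) T →
    IsRSA κ {z | ocons (f (z ∘ e)) z ∈ T}

lemma St.poly {ι : Type} (P : MvPolynomial ι ℝ) : St (fun x => MvPolynomial.eval x P) := by
  intro κ e T hT
  have := rsa_preim (fun o : Option κ => o.elim (MvPolynomial.rename e P) MvPolynomial.X) hT
  convert this using 2
  ext z
  have : ocons (MvPolynomial.eval (z ∘ e) P) z = fun k =>
      MvPolynomial.eval z (Option.elim k ((MvPolynomial.rename e) P) MvPolynomial.X) := by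
    ext o
    cases o <;> simp [ocons, MvPolynomial.eval_rename]
  rw [this]

lemma St.bin {ι : Type} {f g : (ι → ℝ) → ℝ} (hf : St f) (hg : St g)
    (P : MvPolynomial (Option (Option Empty)) ℝ) :
    St (fun x => MvPolynomial.eval (ocons (f x) (ocons (g x) Empty.elim)) P) := by
  intro κ e T hT
  have h1 := rsa_preim (l := Option (Option κ)) (fun o : Option κ => o.elim
    (MvPolynomial.rename (fun o => match o with
      | none => none | some none => some none | some (some e) => e.elim) P)
    (fun k => MvPolynomial.X (some (some k)))) hT
  have h2 := hf (Option κ) (fun i => some (e i)) _ h1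
  have h3 := hg κ e _ h2
  convert h3 using 2
  ext z
  simp only [Set.mem_ofPred_eq]
  apply iff_of_eq
  congr 1
  ext o
  cases o with
  | none =>
    simp only [ocons_none, Option.elim_none, MvPolynomial.eval_rename]
    congr 2
    funext o
    rcases o with _ | _ | e'
    · simp [Function.comp_def]
    · simp [Function.comp_def]
    · exact e'.elim
  | some k => simp

lemma St.add {ι : Type} {f g : (ι → ℝ) → ℝ} (hf : St f) (hg : St g) :
    St (fun x => f x + g x) := by
  have := St.bin hf hg (MvPolynomial.X none + MvPolynomial.X (some none))
  simp only [map_add, MvPolynomial.eval_X] at this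
  exact this

lemma St.mul {ι : Type} {f g : (ι → ℝ) → ℝ} (hf : St f) (hg : St g) :
    St (fun x => f x * g x) := by
  have := St.bin hf hg (MvPolynomial.X none * MvPolynomial.X (some none))
  simp only [map_mul, MvPolynomial.eval_X] at this
  exact this

def Un (φ : ℝ → ℝ) : Prop := ∀ (κ : Type) (P : MvPolynomial (Option κ) ℝ),
    IsRSA (Option κ) {w | 0 < MvPolynomial.eval (ocons (φ (w none)) (w ∘ some)) P}

lemma St.un {ι : Type} {f : (ι → ℝ) → ℝ} (hf : St f) {φ : ℝ → ℝ} (h : Un φ) :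
    St (fun x => φ (f x)) := by
  intro κ e T hT
  have key : IsRSA (Option κ) {w | ocons (φ (w none)) (w ∘ some) ∈ T} := by
    induction hT with
    | basic P => exact h κ P
    | compl _ ih => exact ih.compl
    | union _ _ ih1 ih2 => exact ih1.union ih2
  exact hf κ e _ key

lemma St.pos {ι : Type} {f : (ι → ℝ) → ℝ} (hf : St f) : IsRSA ι {x | 0 < f x} := by
  have := hf ι id _ (IsRSA.basic (MvPolynomial.X none))
  simpa using this

lemma St.ite {ι : Type} {f g k : (ι → ℝ) → ℝ} (hf : St f) (hg : St g) (hk : St k) :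
    St (fun x => if 0 < f x then g x else k x) := by
  intro κ e T hT
  have h1 := rsa_comp e hf.pos
  have := (rsa_inter h1 (hg κ e T hT)).union (rsa_inter h1.compl (hk κ e T hT))
  convert this using 1
  ext z
  by_cases h : 0 < f (z ∘ e) <;> simp [h]

lemma st_of_poly_decomp_zero {κ : Type} (P : MvPolynomial (Option κ) ℝ) :
    IsRSA (Option κ) {w | 0 < MvPolynomial.eval (ocons 0 (w ∘ some)) P} := by
  have := rsa_preim (l := Option κ) (fun o : Option κ => o.elim 0 (fun k => MvPolynomial.X (some k)))
    (IsRSA.basic P)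
  convert this using 2
  ext w
  simp only [Set.mem_ofPred_eq]
  have : ocons 0 (w ∘ some) = fun k => MvPolynomial.eval w
      (Option.elim k 0 fun k => MvPolynomial.X (some k)) := by
    ext o; cases o <;> simp
  rw [this]

lemma un_sqrt : Un Real.sqrt := by
  intro κ P
  have dec : ∃ A B : MvPolynomial (Option κ) ℝ, ∀ (w : Option κ → ℝ) (s : ℝ), s ^ 2 = w none →
      MvPolynomial.eval (ocons s (w ∘ some)) P
        = MvPolynomial.eval w A + s * MvPolynomial.eval w B := by
    induction P using MvPolynomial.induction_on with
    | C a => exact ⟨MvPolynomial.C a, 0, by simp⟩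
    | add p q hp hq =>
      obtain ⟨A, B, h⟩ := hp
      obtain ⟨A', B', h'⟩ := hq
      refine ⟨A + A', B + B', fun w s hs => ?_⟩
      simp only [map_add, h w s hs, h' w s hs]; ring
    | mul_X p i hp =>
      obtain ⟨A, B, h⟩ := hp
      cases i with
      | none =>
        refine ⟨MvPolynomial.X none * B, A, fun w s hs => ?_⟩
        simp only [map_mul, h w s hs, MvPolynomial.eval_X, ocons_none, ← hs]; ring
      | some k =>
        refine ⟨MvPolynomial.X (some k) * A, MvPolynomial.X (some k) * B, fun w s hs => ?_⟩
        simp only [map_mul, h w s hs, MvPolynomial.eval_X, ocons_some, Function.comp]; ring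
  obtain ⟨A, B, h⟩ := dec
  have hp := IsRSA.basic (MvPolynomial.X (none : Option κ) : MvPolynomial (Option κ) ℝ)
  have pA := IsRSA.basic A
  have pB := IsRSA.basic B
  have nA := IsRSA.basic (-A)
  have nB := IsRSA.basic (-B)
  have pD := IsRSA.basic (A ^ 2 - B ^ 2 * MvPolynomial.X none)
  have nD := IsRSA.basic (-(A ^ 2 - B ^ 2 * MvPolynomial.X none))
  have := (rsa_inter hp.compl (st_of_poly_decomp_zero P)).union
    (rsa_inter hp ((rsa_inter pA nB.compl).union ((rsa_inter pA pD).union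
      (rsa_inter pB (nA.compl.union nD)))))
  convert this using 1
  ext w
  simp only [Set.mem_ofPred_eq, Set.mem_union, Set.mem_inter_iff, Set.mem_compl_iff, not_lt,
    MvPolynomial.eval_X, map_neg, map_sub, map_mul, map_pow, Left.neg_nonpos_iff]
  rcases le_or_gt (w none) 0 with h0 | h0
  · rw [Real.sqrt_eq_zero_of_nonpos h0]
    simp [h0, not_lt.mpr h0]
  · rw [h w _ (Real.sq_sqrt h0.le)]
    simp only [not_le.mpr h0, h0, false_and, true_and, false_or]
    have hs := Real.sqrt_pos.mpr h0
    have hs2 := Real.sq_sqrt h0.le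
    generalize √(w none) = s at *
    rw [← hs2]
    generalize MvPolynomial.eval w A = a
    generalize MvPolynomial.eval w B = b
    have fac : a ^ 2 - b ^ 2 * s ^ 2 = (a + s * b) * (a - s * b) := by ring
    rw [fac]
    constructor
    · intro hp
      rcases le_or_gt 0 b with hb | hb
      · rcases lt_or_ge 0 a with ha | ha
        · exact Or.inl ⟨ha, hb⟩
        · right; right
          have hb' : 0 < b := by
            rcases hb.lt_or_eq with h | h
            · exact h
            · subst h; simp at hp; linarith
          refine ⟨hb', ?_⟩
          rcases ha.lt_or_eq with ha | ha
          · right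
            have : a - s * b < 0 := by nlinarith [mul_pos hs hb']
            have := mul_neg_of_pos_of_neg hp this
            linarith
          · left; exact ha.ge
      · right; left
        have : s * b < 0 := mul_neg_of_pos_of_neg hs hb
        exact ⟨by linarith, mul_pos hp (by linarith)⟩
    · rintro (⟨ha, hb⟩ | ⟨ha, hd⟩ | ⟨hb, ha | hd⟩)
      · have := mul_nonneg hs.le hb; linarith
      · by_contra hc
        push Not at hc
        have : 0 < a - s * b := by nlinarith
        nlinarith
      · have := mul_pos hs hb; linarith
      · have := mul_pos hs hb
        by_contra hc
        push Not at hc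
        have : a - s * b < 0 := by nlinarith
        nlinarith

lemma un_inv : Un (fun t => t⁻¹) := by
  intro κ P
  have dec : ∃ (N : ℕ) (A : MvPolynomial (Option κ) ℝ), ∀ (w : Option κ → ℝ), w none ≠ 0 →
      MvPolynomial.eval (ocons (w none)⁻¹ (w ∘ some)) P * (w none) ^ (2 * N)
        = MvPolynomial.eval w A := by
    induction P using MvPolynomial.induction_on with
    | C a => exact ⟨0, MvPolynomial.C a, by simp⟩
    | add p q hp hq =>
      obtain ⟨N, A, h⟩ := hp
      obtain ⟨N', A', h'⟩ := hq
      refine ⟨N + N', A * MvPolynomial.X none ^ (2 * N') + A' * MvPolynomial.X none ^ (2 * N),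
        fun w hs => ?_⟩
      simp only [map_add, map_mul, map_pow, ← h w hs, ← h' w hs, MvPolynomial.eval_X]; ring
    | mul_X p i hp =>
      obtain ⟨N, A, h⟩ := hp
      cases i with
      | none =>
        refine ⟨N + 1, A * MvPolynomial.X none, fun w hs => ?_⟩
        simp only [map_mul, ← h w hs, MvPolynomial.eval_X, ocons_none]; 
        rw [mul_add, pow_add]
        field_simp
        ring
      | some k =>
        refine ⟨N, MvPolynomial.X (some k) * A, fun w hs => ?_⟩
        simp only [map_mul, ← h w hs, MvPolynomial.eval_X, ocons_some, Function.comp]; ring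
  obtain ⟨N, A, h⟩ := dec
  have hp := rsa_eq0 (MvPolynomial.X (none : Option κ) : MvPolynomial (Option κ) ℝ)
  have := (rsa_inter hp (st_of_poly_decomp_zero P)).union
    (rsa_inter hp.compl (IsRSA.basic A))
  convert this using 1
  ext w
  simp only [Set.mem_ofPred_eq, Set.mem_union, Set.mem_inter_iff, Set.mem_compl_iff,
    MvPolynomial.eval_X]
  rcases eq_or_ne (w none) 0 with h0 | h0
  · simp [h0]
  · rw [← h w h0]
    have : 0 < (w none) ^ (2 * N) := by
      rw [pow_mul]; positivity
    simp [h0, this]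

/-- cube root of the positive part -/
def cbr (t : ℝ) : ℝ := (max t 0) ^ ((1 : ℝ) / 3)

lemma cbr_of_nonpos {t : ℝ} (h : t ≤ 0) : cbr t = 0 := by
  simp [cbr, h]

lemma cbr_pow {t : ℝ} (h : 0 ≤ t) : cbr t ^ 3 = t := by
  unfold cbr
  rw [max_eq_left h, ← Real.rpow_natCast, ← Real.rpow_mul h]; norm_num

lemma cbr_nonneg (t : ℝ) : 0 ≤ cbr t := by unfold cbr; positivity

lemma un_cbr : Un cbr := by
  intro κ P
  have dec : ∃ A B C : MvPolynomial (Option κ) ℝ, ∀ (w : Option κ → ℝ) (s : ℝ), s ^ 3 = w none →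
      MvPolynomial.eval (ocons s (w ∘ some)) P
        = MvPolynomial.eval w A + s * MvPolynomial.eval w B + s ^ 2 * MvPolynomial.eval w C := by
    induction P using MvPolynomial.induction_on with
    | C a => exact ⟨MvPolynomial.C a, 0, 0, by simp⟩
    | add p q hp hq =>
      obtain ⟨A, B, C, h⟩ := hp
      obtain ⟨A', B', C', h'⟩ := hq
      refine ⟨A + A', B + B', C + C', fun w s hs => ?_⟩
      simp only [map_add, h w s hs, h' w s hs]; ring
    | mul_X p i hp =>
      obtain ⟨A, B, C, h⟩ := hp
      cases i with
      | none =>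
        refine ⟨MvPolynomial.X none * C, A, B, fun w s hs => ?_⟩
        simp only [map_mul, h w s hs, MvPolynomial.eval_X, ocons_none, ← hs]; ring
      | some k =>
        refine ⟨MvPolynomial.X (some k) * A, MvPolynomial.X (some k) * B,
          MvPolynomial.X (some k) * C, fun w s hs => ?_⟩
        simp only [map_mul, h w s hs, MvPolynomial.eval_X, ocons_some, Function.comp]; ring
  obtain ⟨A, B, C, h⟩ := dec
  have hp := IsRSA.basic (MvPolynomial.X (none : Option κ) : MvPolynomial (Option κ) ℝ)
  have pN := IsRSA.basic (A ^ 3 + B ^ 3 * MvPolynomial.X none + C ^ 3 * MvPolynomial.X none ^ 2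
    - 3 * A * B * C * MvPolynomial.X none)
  have e1 := rsa_eq0 (A ^ 3 - B ^ 3 * MvPolynomial.X none)
  have e2 := rsa_eq0 (A ^ 3 - C ^ 3 * MvPolynomial.X none ^ 2)
  have pA := IsRSA.basic A
  have := (rsa_inter hp.compl (st_of_poly_decomp_zero P)).union
    (rsa_inter hp (pN.union (rsa_inter pA (rsa_inter e1 e2))))
  convert this using 1
  ext w
  have r3 : ∀ v : Option κ → ℝ, MvPolynomial.eval v (3 : MvPolynomial (Option κ) ℝ) = 3 := by
    intro v; exact map_ofNat _ 3
  simp only [Set.mem_ofPred_eq, Set.mem_union, Set.mem_inter_iff, Set.mem_compl_iff, not_lt,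
    MvPolynomial.eval_X, map_sub, map_add, map_mul, map_pow, r3]
  rcases le_or_gt (w none) 0 with h0 | h0
  · rw [cbr_of_nonpos h0]
    simp [h0, not_lt.mpr h0]
  · rw [h w _ (cbr_pow h0.le)]
    simp only [not_le.mpr h0, h0, false_and, true_and, false_or]
    have hs2 := cbr_pow h0.le
    have hs : 0 < cbr (w none) := by
      rcases (cbr_nonneg (w none)).lt_or_eq with h | h
      · exact h
      · rw [← h] at hs2; simp at hs2; linarith
    generalize cbr (w none) = s at *
    rw [← hs2]
    generalize MvPolynomial.eval w A = a
    generalize MvPolynomial.eval w B = b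
    generalize MvPolynomial.eval w C = c
    have inj : ∀ x y : ℝ, x ^ 3 - y ^ 3 = 0 ↔ x = y := by
      intro x y
      constructor
      · intro h
        exact (Odd.strictMono_pow (by decide : Odd 3)).injective (by simpa [sub_eq_zero] using h)
      · rintro rfl; ring
    have E1 : a ^ 3 - b ^ 3 * s ^ 3 = 0 ↔ a = s * b := by
      rw [← inj a]; ring_nf
    have E2 : a ^ 3 - c ^ 3 * (s ^ 3) ^ 2 = 0 ↔ a = s ^ 2 * c := by
      rw [← inj a]; ring_nf
    rw [E1, E2]
    have fac : a ^ 3 + b ^ 3 * s ^ 3 + c ^ 3 * (s ^ 3) ^ 2 - 3 * a * b * c * s ^ 3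
        = (a + s * b + s ^ 2 * c) * (((a - s * b) ^ 2 + (s * b - s ^ 2 * c) ^ 2
          + (a - s ^ 2 * c) ^ 2) / 2) := by ring
    rw [fac]
    generalize hx : s * b = x
    generalize hy : s ^ 2 * c = y
    have hq : 0 ≤ ((a - x) ^ 2 + (x - y) ^ 2 + (a - y) ^ 2) / 2 := by positivity
    constructor
    · intro hp
      rcases hq.lt_or_eq with hq | hq
      · left; exact mul_pos hp hq
      · right
        have h1 : a = x := by
          have : (a - x) ^ 2 = 0 := by nlinarith [sq_nonneg (a - x), sq_nonneg (x - y), sq_nonneg (a - y)]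
          have := pow_eq_zero_iff (two_ne_zero) |>.mp this
          linarith
        have h2 : a = y := by
          have : (a - y) ^ 2 = 0 := by nlinarith [sq_nonneg (a - x), sq_nonneg (x - y), sq_nonneg (a - y)]
          have := pow_eq_zero_iff (two_ne_zero) |>.mp this
          linarith
        exact ⟨by linarith, h1, h2⟩
    · rintro (h | ⟨h1, h2, h3⟩)
      · exact (pos_iff_pos_of_mul_pos h).mpr (lt_of_le_of_ne hq (by rintro h'; rw [← h'] at h; simp at h))
      · linarith

end SAsets

section SAassembly

lemma St.const {ι : Type} (a : ℝ) : St (fun _ : ι → ℝ => a) := by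
  have := St.poly (ι := ι) (MvPolynomial.C a)
  simpa only [MvPolynomial.eval_C] using this

lemma St.coord {ι : Type} (i : ι) : St (fun x : ι → ℝ => x i) := by
  have := St.poly (ι := ι) (MvPolynomial.X i)
  simpa only [MvPolynomial.eval_X] using this

lemma St.ren {ι κ : Type} {f : (ι → ℝ) → ℝ} (hf : St f) (e : ι → κ) :
    St (fun z : κ → ℝ => f (fun i => z (e i))) := by
  intro κ' e' T hT
  exact hf κ' (e' ∘ e) T hT

lemma St.pre {ι κ : Type} {u : (ι → ℝ) → (κ → ℝ)} (hu : ∀ k, St (fun x => u x k))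
    {T : Set (κ → ℝ)} (hT : IsRSA κ T) : IsRSA ι {x | u x ∈ T} := by
  induction hT with
  | basic P =>
    apply St.pos
    induction P using MvPolynomial.induction_on with
    | C a => simpa only [MvPolynomial.eval_C] using St.const a
    | add p q hp hq => simpa only [map_add] using hp.add hq
    | mul_X p i hp => simpa only [map_mul, MvPolynomial.eval_X] using hp.mul (hu i)
  | compl _ ih => exact ih.compl
  | union _ _ ih1 ih2 => exact ih1.union ih2

lemma St.neg {ι : Type} {f : (ι → ℝ) → ℝ} (hf : St f) : St (fun x => - f x) := by
  have := (St.const (-1)).mul hf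
  simpa only [neg_mul, one_mul] using this

lemma St.sub {ι : Type} {f g : (ι → ℝ) → ℝ} (hf : St f) (hg : St g) :
    St (fun x => f x - g x) := by
  simpa only [sub_eq_add_neg] using hf.add hg.neg

lemma rsa_eq {ι : Type} {f g : (ι → ℝ) → ℝ} (hf : St f) (hg : St g) :
    IsRSA ι {x | f x = g x} := by
  have := rsa_inter (hf.sub hg).pos.compl (hg.sub hf).pos.compl
  convert this using 1
  ext x
  simp only [Set.mem_ofPred_eq, Set.mem_inter_iff, Set.mem_compl_iff]
  constructor
  · intro h; simp [h]
  · rintro ⟨h1, h2⟩; linarith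

lemma rsa_graph {h : (Fin 13 → ℝ) → (Fin 13 → ℝ)} (hS : ∀ k, St (fun x => h x k)) :
    IsRSA (Fin 13 ⊕ Fin 13) (graphMapOn h Set.univ) := by
  have := rsa_iInter (ι := Fin 13 ⊕ Fin 13) (Finset.univ : Finset (Fin 13))
    (s := fun j => {z | z (Sum.inr j) = h (fun i => z (Sum.inl i)) j})
    (fun j => rsa_eq (St.coord _) ((hS j).ren Sum.inl))
  convert this using 1
  ext z
  simp [graphMapOn, funext_iff]

lemma arc_image {h h' : (Fin 13 → ℝ) → (Fin 13 → ℝ)}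
    (hl : Function.LeftInverse h' h) (hr : Function.RightInverse h' h) (hc : Continuous h)
    (hS' : ∀ k, St (fun x => h' x k)) (h0 : h 0 = 0) {f g : (Fin 13 → ℝ) → ℝ}
    (hfg : f = g ∘ h) {γ : ℝ → (Fin 13 → ℝ)} (hγ : γ ∈ ArcFib f) : h ∘ γ ∈ ArcFib g := by
  obtain ⟨⟨ε, hε, hcγ, hRγ⟩, ht, he⟩ := hγ
  refine ⟨⟨ε, hε, hc.comp_continuousOn hcγ, ?_⟩, ?_, ?_⟩
  · have := St.pre (ι := Option (Fin 13))
      (u := fun z => fun o : Option (Fin 13) => o.elim (z none) (h' (fun i => z (some i)))) ?_ hRγ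
    · convert this using 1
      ext z
      simp only [Set.mem_ofPred_eq, Option.elim]
      refine and_congr_right fun _ => ?_
      constructor
      · intro H; rw [H]; exact hl _
      · intro H; rw [Function.comp, ← H]; exact (hr _).symm
    · intro o
      cases o with
      | none => exact St.coord _
      | some k => exact (hS' k).ren some
  · have := (hc.tendsto 0).comp ht
    rwa [h0] at this
  · filter_upwards [he] with t ht
    rw [hfg] at ht
    exact ht

lemma cont_inv {E G : Type*} [NormedAddCommGroup E] [NormedAddCommGroup G] [ProperSpace E]
    {h : E → G} {h' : G → E}
    (hl : Function.LeftInverse h' h) (hr : Function.RightInverse h' h) (hc : Continuous h)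
    (hb : ∀ R : ℝ, ∃ R' : ℝ, ∀ y, ‖y‖ ≤ R → ‖h' y‖ ≤ R') : Continuous h' := by
  rw [continuous_iff_ultrafilter]
  intro y F hF
  obtain ⟨R', hR'⟩ := hb (‖y‖ + 1)
  have hev : ∀ᶠ z in (F : Filter G), ‖z‖ ≤ ‖y‖ + 1 := by
    apply hF
    have : ∀ᶠ z in 𝓝 y, ‖z‖ < ‖y‖ + 1 :=
      continuous_norm.tendsto y |>.eventually (gt_mem_nhds (by linarith))
    exact this.mono fun z hz => hz.le
  have hcpt := isCompact_closedBall (0 : E) R'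
  have := hcpt.ultrafilter_le_nhds (F.map h') (by
    rw [le_principal_iff]
    change ∀ᶠ z in (F : Filter G), h' z ∈ _
    filter_upwards [hev] with z hz
    simpa using hR' z hz)
  obtain ⟨x, -, hx⟩ := this
  have h1 : Tendsto h' (F : Filter G) (𝓝 x) := hx
  have h2 : Tendsto (h ∘ h') (F : Filter G) (𝓝 (h x)) := (hc.tendsto x).comp h1
  have h3 : h ∘ h' = id := funext hr
  rw [h3] at h2
  have h4 : h x = y := tendsto_nhds_unique h2 hF
  rw [← h4, hl x]
  exact h1

lemma assemble (h h' : (Fin 13 → ℝ) → (Fin 13 → ℝ))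
    (hl : Function.LeftInverse h' h) (hr : Function.RightInverse h' h) (hc : Continuous h)
    (hc' : Continuous h')
    (hS : ∀ k, St (fun x => h x k))
    (hS' : ∀ k, St (fun x => h' x k)) (h0 : h 0 = 0) 
    (hfg : fKer = gKer ∘ h) :
    ∃ h h' : (Fin 13 → ℝ) → (Fin 13 → ℝ),
      Function.LeftInverse h' h ∧ Function.RightInverse h' h ∧
      Continuous h ∧ Continuous h' ∧
      IsRSA (Fin 13 ⊕ Fin 13) (graphMapOn h Set.univ) ∧
      IsRSA (Fin 13 ⊕ Fin 13) (graphMapOn h' Set.univ) ∧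
      h 0 = 0 ∧
      (fun γ : ℝ → (Fin 13 → ℝ) => h ∘ γ) '' ArcFib fKer = ArcFib gKer ∧
      fKer = gKer ∘ h := by
  refine ⟨h, h', hl, hr, hc, hc', rsa_graph hS, rsa_graph hS', h0, ?_, hfg⟩
  ext γ
  constructor
  · rintro ⟨δ, hδ, rfl⟩
    exact arc_image hl hr hc hS' h0 hfg hδ
  · intro hγ
    refine ⟨h' ∘ γ, ?_, ?_⟩
    · refine arc_image (h := h') (h' := h) hr hl hc' hS ?_ (g := fKer) (f := gKer) ?_ hγ
      · rw [← h0, hl, h0]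
      · rw [hfg]; ext x; simp [hr x]
    · ext1 t; exact hr _

end SAassembly

section HopfLift

abbrev Qt := Quaternion ℝ

lemma qnorm_sq (q : Qt) : ‖q‖ ^ 2 = q.re ^ 2 + q.imI ^ 2 + q.imJ ^ 2 + q.imK ^ 2 := by
  rw [sq, ← Quaternion.normSq_eq_norm_mul_self, Quaternion.normSq_def']

/-- the two components of the Hopf map on pairs of quaternions -/
def hpT (a b : Qt) : ℝ := ‖a‖ ^ 2 - ‖b‖ ^ 2
def hpH (a b : Qt) : Qt := (2 : ℝ) • (star a * b)

def ip (h h' : Qt) : ℝ := h.re * h'.re + h.imI * h'.imI + h.imJ * h'.imJ + h.imK * h'.imK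

lemma ip_self (h : Qt) : ip h h = ‖h‖ ^ 2 := by rw [qnorm_sq]; unfold ip; ring

lemma ip_comm (h h' : Qt) : ip h h' = ip h' h := by unfold ip; ring

def nn (t : ℝ) (h : Qt) : ℝ := √(t ^ 2 + ‖h‖ ^ 2)

lemma nn_nonneg (t : ℝ) (h : Qt) : 0 ≤ nn t h := Real.sqrt_nonneg _

lemma nn_sq (t : ℝ) (h : Qt) : nn t h ^ 2 = t ^ 2 + ‖h‖ ^ 2 := Real.sq_sqrt (by positivity)

lemma nn_zero_iff {t : ℝ} {h : Qt} : nn t h = 0 ↔ t = 0 ∧ h = 0 := by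
  constructor
  · intro H
    have := nn_sq t h
    rw [H] at this
    have h1 : t ^ 2 = 0 := by nlinarith [sq_nonneg t, sq_nonneg ‖h‖]
    have h2 : ‖h‖ ^ 2 = 0 := by nlinarith [sq_nonneg t, sq_nonneg ‖h‖]
    simpa using And.intro h1 h2
  · rintro ⟨rfl, rfl⟩; simp [nn]

def dd (t : ℝ) (h : Qt) (t' : ℝ) (h' : Qt) : ℝ := nn t h * nn t' h' + t * t' + ip h h'

lemma dd_comm (t : ℝ) (h : Qt) (t' : ℝ) (h' : Qt) : dd t h t' h' = dd t' h' t h := by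
  unfold dd ip; ring

def lift (a b : Qt) (t' : ℝ) (h' : Qt) : Qt × Qt :=
  let d := (√(2 * dd (hpT a b) (hpH a b) t' h'))⁻¹
  (d • ((nn t' h' + t') • a + b * star h'), d • ((nn t' h' - t') • b + a * h'))

lemma nn_hop (a b : Qt) : nn (hpT a b) (hpH a b) = ‖a‖ ^ 2 + ‖b‖ ^ 2 := by
  unfold nn
  rw [Real.sqrt_eq_iff_mul_self_eq (by positivity) (by positivity)]
  simp only [hpT, hpH, norm_smul, norm_mul, norm_star, Real.norm_ofNat]
  ring

lemma dd_hop (a b : Qt) (t' : ℝ) (h' : Qt) : dd (hpT a b) (hpH a b) t' h' =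
    (nn t' h' + t') * ‖a‖ ^ 2 + (nn t' h' - t') * ‖b‖ ^ 2 + 2 * ip (star a * b) h' := by
  unfold dd
  rw [nn_hop]
  simp only [hpT, hpH, ip, Quaternion.re_smul, Quaternion.imI_smul, Quaternion.imJ_smul,
    Quaternion.imK_smul, smul_eq_mul]
  ring

lemma lift_aux1 (a b h' : Qt) (t' N : ℝ) (hN : N ^ 2 = t' ^ 2 + ‖h'‖ ^ 2) :
    ‖(N + t') • a + b * star h'‖ ^ 2 =
      (N + t') * ((N + t') * ‖a‖ ^ 2 + (N - t') * ‖b‖ ^ 2 + 2 * ip (star a * b) h') := by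
  simp only [qnorm_sq, ip] at *
  simp
  linear_combination (-(b.re ^ 2 + b.imI ^ 2 + b.imJ ^ 2 + b.imK ^ 2)) * hN

lemma lift_aux2 (a b h' : Qt) (t' N : ℝ) (hN : N ^ 2 = t' ^ 2 + ‖h'‖ ^ 2) :
    ‖(N - t') • b + a * h'‖ ^ 2 =
      (N - t') * ((N + t') * ‖a‖ ^ 2 + (N - t') * ‖b‖ ^ 2 + 2 * ip (star a * b) h') := by
  simp only [qnorm_sq, ip] at *
  simp
  linear_combination (-(a.re ^ 2 + a.imI ^ 2 + a.imJ ^ 2 + a.imK ^ 2)) * hN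

lemma lift_aux3 (a b h' : Qt) (t' N : ℝ) (hN : N ^ 2 = t' ^ 2 + ‖h'‖ ^ 2) :
    star ((N + t') • a + b * star h') * ((N - t') • b + a * h') =
      ((N + t') * ‖a‖ ^ 2 + (N - t') * ‖b‖ ^ 2 + 2 * ip (star a * b) h') • h' := by
  simp only [qnorm_sq, ip] at *
  ext <;> simp <;> [
    linear_combination (a.re * b.re + a.imI * b.imI + a.imJ * b.imJ + a.imK * b.imK) * hN;
    linear_combination (a.re * b.imI - a.imI * b.re + b.imJ * a.imK - b.imK * a.imJ) * hN;
    linear_combination (a.re * b.imJ - a.imJ * b.re - b.imI * a.imK + b.imK * a.imI) * hN;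
    linear_combination (a.re * b.imK - a.imK * b.re + b.imI * a.imJ - b.imJ * a.imI) * hN]

lemma lift_aux4 (a b h' : Qt) (t' N : ℝ) :
    (2 * ‖a‖ ^ 2) • ((N + t') • a + b * star h')
      + ((N - t') • b + a * h') * star ((2 : ℝ) • (star a * b)) =
      (2 * ((N + t') * ‖a‖ ^ 2 + (N - t') * ‖b‖ ^ 2 + 2 * ip (star a * b) h')) • a := by
  simp only [qnorm_sq, ip] at *
  ext <;> simp <;> ring

lemma lift_aux5 (a b h' : Qt) (t' N : ℝ) :
    (2 * ‖b‖ ^ 2) • ((N - t') • b + a * h')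
      + ((N + t') • a + b * star h') * ((2 : ℝ) • (star a * b)) =
      (2 * ((N + t') * ‖a‖ ^ 2 + (N - t') * ‖b‖ ^ 2 + 2 * ip (star a * b) h')) • b := by
  simp only [qnorm_sq, ip] at *
  ext <;> simp <;> ring

lemma lift_norm1 {a b : Qt} {t' : ℝ} {h' : Qt} (hd : 0 < dd (hpT a b) (hpH a b) t' h') :
    ‖(lift a b t' h').1‖ ^ 2 = (nn t' h' + t') / 2 := by
  simp only [lift, norm_smul, norm_inv, mul_pow, lift_aux1 a b h' t' _ (nn_sq t' h'), ← dd_hop]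
  rw [Real.norm_eq_abs, inv_pow, sq_abs, Real.sq_sqrt (by positivity)]
  field_simp

lemma lift_norm2 {a b : Qt} {t' : ℝ} {h' : Qt} (hd : 0 < dd (hpT a b) (hpH a b) t' h') :
    ‖(lift a b t' h').2‖ ^ 2 = (nn t' h' - t') / 2 := by
  simp only [lift, norm_smul, norm_inv, mul_pow, lift_aux2 a b h' t' _ (nn_sq t' h'), ← dd_hop]
  rw [Real.norm_eq_abs, inv_pow, sq_abs, Real.sq_sqrt (by positivity)]
  field_simp

lemma lift_hpT {a b : Qt} {t' : ℝ} {h' : Qt} (hd : 0 < dd (hpT a b) (hpH a b) t' h') :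
    hpT (lift a b t' h').1 (lift a b t' h').2 = t' := by
  rw [hpT, lift_norm1 hd, lift_norm2 hd]; ring

lemma lift_hpH {a b : Qt} {t' : ℝ} {h' : Qt} (hd : 0 < dd (hpT a b) (hpH a b) t' h') :
    hpH (lift a b t' h').1 (lift a b t' h').2 = h' := by
  have h2 : √(2 * dd (hpT a b) (hpH a b) t' h') ^ 2 = 2 * dd (hpT a b) (hpH a b) t' h' :=
    Real.sq_sqrt (by positivity)
  have h3 : √(2 * dd (hpT a b) (hpH a b) t' h') ≠ 0 := by positivity
  have A3 := lift_aux3 a b h' t' _ (nn_sq t' h')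
  rw [← dd_hop] at A3
  simp only [lift]
  generalize √(2 * dd (hpT a b) (hpH a b) t' h') = d at *
  rw [hpH, Quaternion.star_smul, smul_mul_assoc, mul_smul_comm, A3, smul_smul, smul_smul, smul_smul]
  have : 2 * d⁻¹ * d⁻¹ * dd (hpT a b) (hpH a b) t' h' = 1 := by
    field_simp
    rw [h2]
  rw [this, one_smul]

def Good (t : ℝ) (h : Qt) (t' : ℝ) (h' : Qt) : Prop :=
  (t = 0 ∧ h = 0 ∧ t' = 0 ∧ h' = 0) ∨ 0 < dd t h t' h'

lemma Good.symm {t : ℝ} {h : Qt} {t' : ℝ} {h' : Qt} (H : Good t h t' h') : Good t' h' t h := by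
  rcases H with ⟨h1, h2, h3, h4⟩ | H
  · exact Or.inl ⟨h3, h4, h1, h2⟩
  · right; rwa [dd_comm]

lemma hop_zero_iff {a b : Qt} : (hpT a b = 0 ∧ hpH a b = 0) ↔ a = 0 ∧ b = 0 := by
  rw [← nn_zero_iff, nn_hop]
  constructor
  · intro h
    have h1 : ‖a‖ ^ 2 = 0 := by nlinarith [sq_nonneg ‖a‖, sq_nonneg ‖b‖]
    have h2 : ‖b‖ ^ 2 = 0 := by nlinarith [sq_nonneg ‖a‖, sq_nonneg ‖b‖]
    simpa using And.intro h1 h2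
  · rintro ⟨rfl, rfl⟩; simp

lemma lift_zero (a b : Qt) : lift a b 0 0 = (0, 0) := by
  have : nn 0 0 = 0 := by simp [nn]
  simp [lift, this]

lemma hop_lift {a b : Qt} {t' : ℝ} {h' : Qt} (H : Good (hpT a b) (hpH a b) t' h') :
    hpT (lift a b t' h').1 (lift a b t' h').2 = t' ∧
    hpH (lift a b t' h').1 (lift a b t' h').2 = h' := by
  rcases H with ⟨h1, h2, rfl, rfl⟩ | H
  · rw [lift_zero]; simp [hpT, hpH]
  · exact ⟨lift_hpT H, lift_hpH H⟩

lemma lift_lift {a b : Qt} {t' : ℝ} {h' : Qt} (H : Good (hpT a b) (hpH a b) t' h') :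
    lift (lift a b t' h').1 (lift a b t' h').2 (hpT a b) (hpH a b) = (a, b) := by
  rcases H with ⟨h1, h2, rfl, rfl⟩ | H
  · obtain ⟨rfl, rfl⟩ := hop_zero_iff.mp ⟨h1, h2⟩
    rw [h1, h2, lift_zero]
  · rw [lift, lift_hpT H, lift_hpH H, dd_comm, nn_hop]
    have h2 : √(2 * dd (hpT a b) (hpH a b) t' h') ^ 2 = 2 * dd (hpT a b) (hpH a b) t' h' :=
      Real.sq_sqrt (by positivity)
    have h3 : √(2 * dd (hpT a b) (hpH a b) t' h') ≠ 0 := by positivity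
    have e1 : ‖a‖ ^ 2 + ‖b‖ ^ 2 + hpT a b = 2 * ‖a‖ ^ 2 := by unfold hpT; ring
    have e2 : ‖a‖ ^ 2 + ‖b‖ ^ 2 - hpT a b = 2 * ‖b‖ ^ 2 := by unfold hpT; ring
    have A4 := lift_aux4 a b h' t' (nn t' h')
    have A5 := lift_aux5 a b h' t' (nn t' h')
    rw [← dd_hop, ← hpH] at A4 A5
    rw [e1, e2]
    simp only [lift]
    generalize √(2 * dd (hpT a b) (hpH a b) t' h') = d at *
    rw [← h2] at A4 A5
    have key : ∀ x : Qt, d⁻¹ • d⁻¹ • d ^ 2 • x = x := by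
      intro x
      rw [smul_smul, smul_smul]
      have : d⁻¹ * d⁻¹ * d ^ 2 = 1 := by
        field_simp
      rw [this, one_smul]
    refine Prod.ext ?_ ?_
    · simp only []
      rw [smul_comm (2 * ‖a‖ ^ 2), smul_mul_assoc, ← smul_add, A4]
      exact key a
    · simp only []
      rw [smul_comm (2 * ‖b‖ ^ 2), smul_mul_assoc, ← smul_add, A5]
      exact key b

lemma good_of {t : ℝ} {h : Qt} {t' : ℝ} {h' : Qt}
    (h0 : (t' = 0 ∧ h' = 0) ↔ (t = 0 ∧ h = 0))
    (H : ∀ l : ℝ, 0 < l → t' = -(l * t) → h' = -(l • h) → t = 0 ∧ h = 0) :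
    Good t h t' h' := by
  by_cases hz : t = 0 ∧ h = 0
  · exact Or.inl ⟨hz.1, hz.2, (h0.mpr hz).1, (h0.mpr hz).2⟩
  right
  have hN : 0 < nn t h := lt_of_le_of_ne (nn_nonneg _ _) (fun e => hz (nn_zero_iff.mp e.symm))
  have hN' : 0 < nn t' h' := lt_of_le_of_ne (nn_nonneg _ _)
    (fun e => hz (h0.mp (nn_zero_iff.mp e.symm)))
  by_contra hc
  push Not at hc
  have s1 := nn_sq t h
  have s2 := nn_sq t' h'
  have key : (nn t' h' * t + nn t h * t') ^ 2 + ‖nn t' h' • h + nn t h • h'‖ ^ 2 =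
      2 * (nn t h * nn t' h') * dd t h t' h' := by
    rw [qnorm_sq] at *
    unfold dd
    generalize nn t h = N at *
    generalize nn t' h' = N' at *
    simp [ip]
    linear_combination (-N' ^ 2) * s1 - N ^ 2 * s2
  have hle : (nn t' h' * t + nn t h * t') ^ 2 + ‖nn t' h' • h + nn t h • h'‖ ^ 2 ≤ 0 := by
    rw [key]; exact mul_nonpos_of_nonneg_of_nonpos (by positivity) hc
  have z1 : (nn t' h' * t + nn t h * t') ^ 2 = 0 :=
    le_antisymm (by nlinarith [sq_nonneg ‖nn t' h' • h + nn t h • h'‖]) (sq_nonneg _)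
  have z2 : ‖nn t' h' • h + nn t h • h'‖ ^ 2 = 0 :=
    le_antisymm (by nlinarith [sq_nonneg (nn t' h' * t + nn t h * t')]) (sq_nonneg _)
  have z1' : nn t' h' * t + nn t h * t' = 0 := by simpa using z1
  have z2' : nn t' h' • h + nn t h • h' = 0 := by simpa using z2
  apply hz
  apply H (nn t' h' / nn t h) (by positivity)
  · field_simp; linarith
  · have : nn t h • h' = -(nn t' h' • h) := (neg_eq_of_add_eq_zero_right z2').symm
    calc h' = (nn t h)⁻¹ • (nn t h • h') := by rw [smul_smul, inv_mul_cancel₀ hN.ne', one_smul]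
      _ = _ := by rw [this, smul_neg, smul_smul, div_eq_inv_mul]

lemma lift_bound1 (a b : Qt) (t' : ℝ) (h' : Qt) : ‖(lift a b t' h').1‖ ^ 2 ≤ nn t' h' := by
  rcases lt_or_ge 0 (dd (hpT a b) (hpH a b) t' h') with hd | hd
  · rw [lift_norm1 hd]
    have := nn_sq t' h'
    have : t' ≤ nn t' h' := by
      apply le_of_sq_le_sq _ (nn_nonneg _ _)
      nlinarith [sq_nonneg ‖h'‖]
    linarith
  · have : √(2 * dd (hpT a b) (hpH a b) t' h') = 0 := Real.sqrt_eq_zero_of_nonpos (by linarith)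
    simp [lift, this, nn_nonneg]

lemma lift_bound2 (a b : Qt) (t' : ℝ) (h' : Qt) : ‖(lift a b t' h').2‖ ^ 2 ≤ nn t' h' := by
  rcases lt_or_ge 0 (dd (hpT a b) (hpH a b) t' h') with hd | hd
  · rw [lift_norm2 hd]
    have := nn_sq t' h'
    have : -t' ≤ nn t' h' := by
      apply le_of_sq_le_sq _ (nn_nonneg _ _)
      nlinarith [sq_nonneg ‖h'‖]
    linarith
  · have : √(2 * dd (hpT a b) (hpH a b) t' h') = 0 := Real.sqrt_eq_zero_of_nonpos (by linarith)
    simp [lift, this, nn_nonneg]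

lemma tendsto_zero_of_sq {X : Type*} {l : Filter X} {f : X → Qt} {g : X → ℝ}
    (hg : Tendsto g l (𝓝 0)) (h : ∀ x, ‖f x‖ ^ 2 ≤ g x) : Tendsto f l (𝓝 0) := by
  rw [tendsto_zero_iff_norm_tendsto_zero]
  have h1 : Tendsto (fun x => √(g x)) l (𝓝 0) := by
    have := (Real.continuous_sqrt.tendsto 0).comp hg
    rwa [Real.sqrt_zero] at this
  refine squeeze_zero (fun _ => norm_nonneg _) (fun x => ?_) h1
  exact Real.le_sqrt_of_sq_le (h x)

lemma tendsto_nn {X : Type*} {l : Filter X} {h : X → Qt} {t : X → ℝ} {h0 : Qt} {t0 : ℝ}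
    (ht : Tendsto t l (𝓝 t0)) (hh : Tendsto h l (𝓝 h0)) :
    Tendsto (fun x => nn (t x) (h x)) l (𝓝 (nn t0 h0)) := by
  unfold nn
  exact ((ht.pow 2).add (hh.norm.pow 2)).sqrt

lemma tendsto_re {X : Type*} {l : Filter X} {h : X → Qt} {h0 : Qt} (hh : Tendsto h l (𝓝 h0)) :
    Tendsto (fun x => (h x).re) l (𝓝 h0.re) := (Quaternion.continuous_re.tendsto h0).comp hh

lemma tendsto_imI {X : Type*} {l : Filter X} {h : X → Qt} {h0 : Qt} (hh : Tendsto h l (𝓝 h0)) :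
    Tendsto (fun x => (h x).imI) l (𝓝 h0.imI) := (Quaternion.continuous_imI.tendsto h0).comp hh

lemma tendsto_imJ {X : Type*} {l : Filter X} {h : X → Qt} {h0 : Qt} (hh : Tendsto h l (𝓝 h0)) :
    Tendsto (fun x => (h x).imJ) l (𝓝 h0.imJ) := (Quaternion.continuous_imJ.tendsto h0).comp hh

lemma tendsto_imK {X : Type*} {l : Filter X} {h : X → Qt} {h0 : Qt} (hh : Tendsto h l (𝓝 h0)) :
    Tendsto (fun x => (h x).imK) l (𝓝 h0.imK) := (Quaternion.continuous_imK.tendsto h0).comp hh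

lemma tendsto_ip {X : Type*} {l : Filter X} {h k : X → Qt} {h0 k0 : Qt}
    (hh : Tendsto h l (𝓝 h0)) (hk : Tendsto k l (𝓝 k0)) :
    Tendsto (fun x => ip (h x) (k x)) l (𝓝 (ip h0 k0)) :=
  ((((tendsto_re hh).mul (tendsto_re hk)).add ((tendsto_imI hh).mul (tendsto_imI hk))).add
    ((tendsto_imJ hh).mul (tendsto_imJ hk))).add ((tendsto_imK hh).mul (tendsto_imK hk))

lemma tendsto_hpT {X : Type*} {l : Filter X} {a b : X → Qt} {a0 b0 : Qt}
    (ha : Tendsto a l (𝓝 a0)) (hb : Tendsto b l (𝓝 b0)) :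
    Tendsto (fun x => hpT (a x) (b x)) l (𝓝 (hpT a0 b0)) := (ha.norm.pow 2).sub (hb.norm.pow 2)

lemma tendsto_hpH {X : Type*} {l : Filter X} {a b : X → Qt} {a0 b0 : Qt}
    (ha : Tendsto a l (𝓝 a0)) (hb : Tendsto b l (𝓝 b0)) :
    Tendsto (fun x => hpH (a x) (b x)) l (𝓝 (hpH a0 b0)) := (ha.star.mul hb).const_smul (2 : ℝ)

lemma lift_tendsto {X : Type*} {l : Filter X} {a b h : X → Qt} {t : X → ℝ} {a0 b0 h0 : Qt} {t0 : ℝ}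
    (ha : Tendsto a l (𝓝 a0)) (hb : Tendsto b l (𝓝 b0)) (ht : Tendsto t l (𝓝 t0))
    (hh : Tendsto h l (𝓝 h0)) (H : Good (hpT a0 b0) (hpH a0 b0) t0 h0) :
    Tendsto (fun x => lift (a x) (b x) (t x) (h x)) l (𝓝 (lift a0 b0 t0 h0)) := by
  have hn : Tendsto (fun x => nn (t x) (h x)) l (𝓝 (nn t0 h0)) :=
    tendsto_nn ht hh
  rcases H with ⟨h1, h2, rfl, rfl⟩ | H
  · rw [lift_zero]
    have : nn 0 0 = 0 := by simp [nn]
    rw [this] at hn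
    have e1 := tendsto_zero_of_sq hn (fun x => lift_bound1 (a x) (b x) (t x) (h x))
    have e2 := tendsto_zero_of_sq hn (fun x => lift_bound2 (a x) (b x) (t x) (h x))
    exact e1.prodMk_nhds e2
  · have e1 : Tendsto (fun x => hpT (a x) (b x)) l (𝓝 (hpT a0 b0)) :=
      (ha.norm.pow 2).sub (hb.norm.pow 2)
    have e2 : Tendsto (fun x => hpH (a x) (b x)) l (𝓝 (hpH a0 b0)) :=
      (ha.star.mul hb).const_smul (2 : ℝ)
    have e3 : Tendsto (fun x => nn (hpT (a x) (b x)) (hpH (a x) (b x))) l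
        (𝓝 (nn (hpT a0 b0) (hpH a0 b0))) :=
      tendsto_nn e1 e2
    have e4 : Tendsto (fun x => ip (hpH (a x) (b x)) (h x)) l (𝓝 (ip (hpH a0 b0) h0)) :=
      tendsto_ip e2 hh
    have e5 : Tendsto (fun x => dd (hpT (a x) (b x)) (hpH (a x) (b x)) (t x) (h x)) l
        (𝓝 (dd (hpT a0 b0) (hpH a0 b0) t0 h0)) :=
      ((e3.mul hn).add (e1.mul ht)).add e4
    have e6 := ((e5.const_mul 2).sqrt).inv₀ (Real.sqrt_pos.mpr (by positivity)).ne'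
    exact (e6.smul (((hn.add ht).smul ha).add (hb.mul hh.star))).prodMk_nhds
      (e6.smul (((hn.sub ht).smul hb).add (ha.mul hh)))

lemma hpT_mul {s : Qt} (hs : ‖s‖ = 1) (a b : Qt) : hpT (a * s) (b * s) = hpT a b := by
  simp [hpT, hs]

lemma hpH_mul (s a b : Qt) : hpH (a * s) (b * s) = star s * hpH a b * s := by
  simp [hpH, mul_assoc]

end HopfLift

section Twist

def sqc (z : ℂ) : ℂ := z ^ 2 / (‖z‖ : ℂ)
def kap (c : ℂ) : ℂ := c ^ 3 / (‖c‖ : ℂ) ^ 2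
def qmk (x y z w : ℝ) : Qt := ⟨x, y, z, w⟩
def vec (V : ℂ × ℝ) : Qt := qmk 0 V.2 V.1.im (-V.1.re)
@[simp] lemma qmk_re (x y z w : ℝ) : (qmk x y z w).re = x := rfl
@[simp] lemma qmk_imI (x y z w : ℝ) : (qmk x y z w).imI = y := rfl
@[simp] lemma qmk_imJ (x y z w : ℝ) : (qmk x y z w).imJ = z := rfl
@[simp] lemma qmk_imK (x y z w : ℝ) : (qmk x y z w).imK = w := rfl
def h12 (h : Qt) : ℂ := ⟨-h.imK, h.imJ⟩
def unv (X : Qt) : ℂ × ℝ := (h12 X, X.imI)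

@[simp] lemma sqc_zero : sqc 0 = 0 := by simp [sqc]
@[simp] lemma kap_zero : kap 0 = 0 := by simp [kap]

@[simp] lemma norm_sqc (z : ℂ) : ‖sqc z‖ = ‖z‖ := by
  rcases eq_or_ne z 0 with rfl | h
  · simp
  · have : ‖z‖ ≠ 0 := by simpa using h
    simp [sqc]; field_simp

@[simp] lemma norm_kap (z : ℂ) : ‖kap z‖ = ‖z‖ := by
  rcases eq_or_ne z 0 with rfl | h
  · simp
  · have : ‖z‖ ≠ 0 := by simpa using h
    simp [kap]; field_simp

lemma sqc_mul (z w : ℂ) : sqc (z * w) = sqc z * sqc w := by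
  simp only [sqc, norm_mul, Complex.ofReal_mul]; ring

lemma sqc_neg (z : ℂ) : sqc (-z) = sqc z := by simp [sqc]

lemma sqc_conj (z : ℂ) : sqc (star z) = star (sqc z) := by simp [sqc]

lemma sqc_ofReal {r : ℝ} (h : 0 ≤ r) : sqc (r : ℂ) = r := by
  rcases h.eq_or_lt with rfl | h
  · simp
  · have : (r : ℂ) ≠ 0 := by exact_mod_cast h.ne'
    simp [sqc, abs_of_pos h]; field_simp

lemma continuous_sqc : Continuous sqc := by
  rw [continuous_iff_continuousAt]
  intro z
  rcases eq_or_ne z 0 with rfl | h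
  · rw [ContinuousAt, sqc_zero, tendsto_zero_iff_norm_tendsto_zero]
    simp only [norm_sqc]
    simpa using (continuous_norm (E := ℂ)).tendsto 0
  · have : (‖z‖ : ℂ) ≠ 0 := by simpa using h
    unfold sqc
    exact ContinuousAt.div (by fun_prop) (by fun_prop) this

lemma continuous_kap : Continuous kap := by
  rw [continuous_iff_continuousAt]
  intro z
  rcases eq_or_ne z 0 with rfl | h
  · rw [ContinuousAt, kap_zero, tendsto_zero_iff_norm_tendsto_zero]
    simp only [norm_kap]
    simpa using (continuous_norm (E := ℂ)).tendsto 0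
  · have : (‖z‖ : ℂ) ^ 2 ≠ 0 := by simpa using h
    unfold kap
    exact ContinuousAt.div (by fun_prop) (by fun_prop) this

lemma qmk_continuous {X : Type*} [TopologicalSpace X] {f g h k : X → ℝ} (hf : Continuous f)
    (hg : Continuous g) (hh : Continuous h) (hk : Continuous k) :
    Continuous (fun x => qmk (f x) (g x) (h x) (k x)) := by
  have e : (fun x => qmk (f x) (g x) (h x) (k x)) = fun x => f x • qmk 1 0 0 0 + g x • qmk 0 1 0 0
      + h x • qmk 0 0 1 0 + k x • qmk 0 0 0 1 := by
    ext x <;> simp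
  rw [e]
  exact (((hf.smul continuous_const).add (hg.smul continuous_const)).add
    (hh.smul continuous_const)).add (hk.smul continuous_const)

lemma cmk_continuous {X : Type*} [TopologicalSpace X] {f g : X → ℝ} (hf : Continuous f)
    (hg : Continuous g) : Continuous (fun x => (⟨f x, g x⟩ : ℂ)) := by
  have e : (fun x => (⟨f x, g x⟩ : ℂ)) = fun x => (f x : ℂ) + g x * Complex.I := by
    ext x; exact Complex.mk_eq_add_mul_I _ _
  rw [e]
  fun_prop

lemma continuous_vec : Continuous vec :=
  qmk_continuous continuous_const continuous_snd (Complex.continuous_im.comp continuous_fst)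
    (Complex.continuous_re.comp continuous_fst).neg

lemma continuous_h12 : Continuous h12 :=
  cmk_continuous Quaternion.continuous_imK.neg Quaternion.continuous_imJ

lemma continuous_unv : Continuous unv := continuous_h12.prodMk Quaternion.continuous_imI

@[simp] lemma vec_re (V : ℂ × ℝ) : (vec V).re = 0 := rfl
@[simp] lemma vec_imI (V : ℂ × ℝ) : (vec V).imI = V.2 := rfl
@[simp] lemma vec_imJ (V : ℂ × ℝ) : (vec V).imJ = V.1.im := rfl
@[simp] lemma vec_imK (V : ℂ × ℝ) : (vec V).imK = -V.1.re := rfl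

@[simp] lemma unv_vec (V : ℂ × ℝ) : unv (vec V) = V := by
  ext <;> simp [unv, h12]

lemma vec_unv {X : Qt} (h : X.re = 0) : vec (unv X) = X := by
  ext <;> simp [unv, h12, h]

@[simp] lemma vec_add (V W : ℂ × ℝ) : vec (V + W) = vec V + vec W := by
  ext <;> simp [add_comm]

@[simp] lemma vec_neg (V : ℂ × ℝ) : vec (-V) = -vec V := by
  ext <;> simp

@[simp] lemma vec_sub (V W : ℂ × ℝ) : vec (V - W) = vec V - vec W := by
  rw [sub_eq_add_neg, vec_add, vec_neg, sub_eq_add_neg]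

@[simp] lemma vec_zero : vec 0 = 0 := by
  ext <;> simp <;> rfl

lemma norm_vec_sq (V : ℂ × ℝ) : ‖vec V‖ ^ 2 = ‖V.1‖ ^ 2 + V.2 ^ 2 := by
  rw [qnorm_sq, ← Complex.normSq_eq_norm_sq, Complex.normSq_apply]; simp; ring

lemma vec_inj {V W : ℂ × ℝ} (h : vec V = vec W) : V = W := by
  rw [← unv_vec V, h, unv_vec]

@[simp] lemma vec_eq_zero {V : ℂ × ℝ} : vec V = 0 ↔ V = 0 :=
  ⟨fun h => vec_inj (by rw [h, vec_zero]), fun h => by rw [h, vec_zero]⟩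

abbrev TS := ℂ × ℝ × Qt × Qt

/-- the shear -/
def TT (e : ℝ) (p : TS) : TS :=
  let a := p.2.2.1
  let b := p.2.2.2
  let m : ℂ := p.1 + e * ⟨hpT a b, (hpH a b).re⟩
  (m, p.2.1 - e * (hpH a b).imI,
    lift a b (hpT a b) (hpH a b + vec (sqc p.1 - sqc m, 0)))

lemma TT_good (e : ℝ) (z : ℂ) (t : ℝ) (h : Qt) :
    Good t h t (h + vec (sqc z - sqc (z + e * ⟨t, h.re⟩), 0)) := by
  have key : t = 0 → h.re = 0 → h + vec (sqc z - sqc (z + e * ⟨t, h.re⟩), 0) = h := by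
    intro h1 h2
    have : (⟨t, h.re⟩ : ℂ) = 0 := by rw [h1, h2]; rfl
    rw [this]
    simp only [mul_zero, add_zero, sub_self]
    have : ((0 : ℂ), (0 : ℝ)) = 0 := rfl
    rw [this, vec_zero, add_zero]
  have hre : (h + vec (sqc z - sqc (z + e * ⟨t, h.re⟩), 0)).re = h.re := by simp
  apply good_of
  · constructor
    · rintro ⟨h1, h2⟩
      rw [h2] at hre
      rw [key h1 hre.symm] at h2
      exact ⟨h1, h2⟩
    · rintro ⟨rfl, rfl⟩
      exact ⟨rfl, key rfl rfl⟩
  · intro l hl h1 h2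
    have h1' : t = 0 := by nlinarith
    have h3 : h.re = 0 := by
      rw [h2] at hre
      simp at hre
      nlinarith
    rw [key h1' h3] at h2
    refine ⟨h1', ?_⟩
    have : (1 + l) • h = 0 := by
      rw [add_smul, one_smul]; nth_rewrite 1 [h2]; simp
    exact (smul_eq_zero.mp this).resolve_left (by linarith)

lemma TT_hop (e : ℝ) (p : TS) :
    hpT (TT e p).2.2.1 (TT e p).2.2.2 = hpT p.2.2.1 p.2.2.2 ∧
    hpH (TT e p).2.2.1 (TT e p).2.2.2 = hpH p.2.2.1 p.2.2.2 + vec (sqc p.1 - sqc (TT e p).1, 0) :=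
  hop_lift (TT_good e p.1 _ _)

lemma TT_inv (e : ℝ) (p : TS) : TT (-e) (TT e p) = p := by
  obtain ⟨h1, h2⟩ := TT_hop e p
  have hL := lift_lift (TT_good e p.1 (hpT p.2.2.1 p.2.2.2) (hpH p.2.2.1 p.2.2.2))
  have hm : (TT e p).1 + ((-e : ℝ) : ℂ) * ⟨hpT p.2.2.1 p.2.2.2, (hpH p.2.2.1 p.2.2.2).re⟩ = p.1 := by
    simp [TT]
  rw [TT, h1, h2]
  simp only [Quaternion.re_add, vec_re, add_zero, Quaternion.imI_add, vec_imI]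
  rw [hm]
  refine Prod.ext rfl (Prod.ext ?_ ?_)
  · simp [TT]
  · have : hpH p.2.2.1 p.2.2.2 + vec (sqc p.1 - sqc (TT e p).1, 0) + vec (sqc (TT e p).1 - sqc p.1, 0)
      = hpH p.2.2.1 p.2.2.2 := by
      rw [add_assoc, ← vec_add]; simp
    simp only []
    rw [this]
    exact hL

lemma TT_level (e : ℝ) (p : TS) : sqc (TT e p).1 + h12 (hpH (TT e p).2.2.1 (TT e p).2.2.2) =
    sqc p.1 + h12 (hpH p.2.2.1 p.2.2.2) := by
  rw [(TT_hop e p).2]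
  apply Complex.ext <;> simp [h12] <;> ring

lemma TT_imI (e : ℝ) (p : TS) : (hpH (TT e p).2.2.1 (TT e p).2.2.2).imI =
    (hpH p.2.2.1 p.2.2.2).imI := by
  rw [(TT_hop e p).2]; simp

lemma TT_snd (e : ℝ) (p : TS) : (TT e p).2.1 = p.2.1 - e * (hpH p.2.2.1 p.2.2.2).imI := rfl

lemma continuous_hpH' : Continuous (fun p : TS => hpH p.2.2.1 p.2.2.2) := by
  unfold hpH; fun_prop
lemma continuous_hpT' : Continuous (fun p : TS => hpT p.2.2.1 p.2.2.2) := by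
  unfold hpT; fun_prop

lemma TT_continuous (e : ℝ) : Continuous (TT e) := by
  have hH := continuous_hpH'
  have hT := continuous_hpT'
  have hr := Quaternion.continuous_re.comp hH
  have hm : Continuous (fun p : TS => (p.1 + e * ⟨hpT p.2.2.1 p.2.2.2, (hpH p.2.2.1 p.2.2.2).re⟩ : ℂ)) :=
    continuous_fst.add (continuous_const.mul (cmk_continuous hT hr))
  have hs : Continuous (fun p : TS => p.2.1 - e * (hpH p.2.2.1 p.2.2.2).imI) :=
    (continuous_fst.comp continuous_snd).sub
      (continuous_const.mul (Quaternion.continuous_imI.comp hH))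
  refine hm.prodMk (hs.prodMk ?_)
  have hd : Continuous (fun p : TS => hpH p.2.2.1 p.2.2.2 +
      vec (sqc p.1 - sqc (p.1 + e * ⟨hpT p.2.2.1 p.2.2.2, (hpH p.2.2.1 p.2.2.2).re⟩), 0)) :=
    hH.add (continuous_vec.comp (((continuous_sqc.comp continuous_fst).sub
      (continuous_sqc.comp hm)).prodMk continuous_const))
  rw [continuous_iff_continuousAt]
  intro p
  exact lift_tendsto ((continuous_fst.comp (continuous_snd.comp continuous_snd)).tendsto p)
    ((continuous_snd.comp (continuous_snd.comp continuous_snd)).tendsto p)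
    (hT.tendsto p) (hd.tendsto p) (TT_good e p.1 _ _)

end Twist

section Kmap

def b0 (V : ℂ × ℝ) (k : ℂ) : ℂ × ℝ := (sqc V.1 + k, V.2)
def rot (g : Qt) (V : ℂ × ℝ) : ℂ × ℝ := unv (g * vec V * star g)

lemma sqn_eq {x y : ℝ} (hx : 0 ≤ x) (hy : 0 ≤ y) (h : x ^ 2 = y ^ 2) : x = y :=
  (sq_eq_sq₀ hx hy).mp h

lemma qsm (g : Qt) (hg : ‖g‖ = 1) : star g * g = 1 := by
  rw [Quaternion.star_mul_self, Quaternion.normSq_eq_norm_mul_self, hg]; norm_num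
lemma qms (g : Qt) (hg : ‖g‖ = 1) : g * star g = 1 := by
  rw [Quaternion.self_mul_star, Quaternion.normSq_eq_norm_mul_self, hg]; norm_num

lemma conj_re (g X : Qt) (hX : X.re = 0) : (g * X * star g).re = 0 := by
  simp [hX]; ring

lemma vec_rot (g : Qt) (V : ℂ × ℝ) : vec (rot g V) = g * vec V * star g :=
  vec_unv (conj_re _ _ (vec_re V))

lemma norm_conj (g X : Qt) (hg : ‖g‖ = 1) : ‖g * X * star g‖ = ‖X‖ := by
  simp [hg]

lemma norm_vec_rot (g : Qt) (hg : ‖g‖ = 1) (V : ℂ × ℝ) : ‖vec (rot g V)‖ = ‖vec V‖ := by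
  rw [vec_rot, norm_conj _ _ hg]

lemma rot_rot (g : Qt) (hg : ‖g‖ = 1) (V : ℂ × ℝ) : rot (star g) (rot g V) = V := by
  apply vec_inj
  rw [vec_rot, vec_rot, star_star]
  calc star g * (g * vec V * star g) * g = (star g * g) * vec V * (star g * g) := by
        simp only [mul_assoc]
    _ = vec V := by rw [qsm g hg]; simp

lemma vec_smul (r : ℝ) (V : ℂ × ℝ) : vec (r • V) = r • vec V := by
  ext <;> simp

lemma rot_zero (g : Qt) : rot g 0 = 0 := by
  apply vec_inj
  rw [vec_rot]; simp

lemma rot_smul (g : Qt) (r : ℝ) (V : ℂ × ℝ) : rot g (r • V) = r • rot g V := by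
  apply vec_inj
  rw [vec_rot, vec_smul, vec_smul, vec_rot]; simp

lemma sqc_smul {r : ℝ} (hr : 0 ≤ r) (z : ℂ) : sqc (r • z) = r • sqc z := by
  rw [Complex.real_smul, sqc_mul, sqc_ofReal hr, Complex.real_smul]

lemma b0_smul {r : ℝ} (hr : 0 ≤ r) (V : ℂ × ℝ) : b0 (r • V) 0 = r • b0 V 0 := by
  refine Prod.ext ?_ rfl
  simp only [b0, Prod.smul_fst, sqc_smul hr, add_zero]

lemma norm_vec_b0 (V : ℂ × ℝ) : ‖vec (b0 V 0)‖ = ‖vec V‖ := by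
  apply sqn_eq (norm_nonneg _) (norm_nonneg _)
  rw [norm_vec_sq, norm_vec_sq]; simp [b0]

lemma vec_b0 (V : ℂ × ℝ) (k : ℂ) : vec (b0 V k) = vec (b0 V 0) + vec (k, 0) := by
  rw [← vec_add]; simp [b0]

lemma norm_vec_k (k : ℂ) : ‖vec (k, 0)‖ = ‖k‖ := by
  apply sqn_eq (norm_nonneg _) (norm_nonneg _)
  rw [norm_vec_sq]; simp

lemma b0_le (V : ℂ × ℝ) (k : ℂ) : ‖vec (b0 V k)‖ ≤ ‖vec V‖ + ‖k‖ := by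
  rw [vec_b0]
  calc _ ≤ _ := norm_add_le _ _
    _ = _ := by rw [norm_vec_b0, norm_vec_k]

lemma b0_ge (V : ℂ × ℝ) (k : ℂ) : ‖vec V‖ ≤ ‖vec (b0 V k)‖ + ‖k‖ := by
  have h : vec (b0 V 0) = vec (b0 V k) - vec (k, 0) := by rw [vec_b0 V k]; simp
  rw [← norm_vec_b0, h]
  calc _ ≤ _ := norm_sub_le _ _
    _ = _ := by rw [norm_vec_k]

def eps (k : ℂ) (Y : ℂ × ℝ) : ℝ := (k.re * (sqc Y.1).re + k.im * (sqc Y.1).im) * ‖vec Y‖⁻¹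

lemma b0_sq (V : ℂ × ℝ) (k : ℂ) (hV : ‖vec V‖ ≠ 0) :
    ‖vec (b0 V k)‖ ^ 2 = ‖vec V‖ ^ 2 + 2 * ‖vec V‖ * eps k V + ‖k‖ ^ 2 := by
  have h1 : ‖vec V‖ * eps k V = k.re * (sqc V.1).re + k.im * (sqc V.1).im := by
    unfold eps; field_simp
  rw [mul_assoc, h1, norm_vec_sq, norm_vec_sq]
  have h2 := norm_sqc V.1
  rw [← h2, ← Complex.normSq_eq_norm_sq, ← Complex.normSq_eq_norm_sq, ← Complex.normSq_eq_norm_sq]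
  simp only [Complex.normSq_apply, b0, Complex.add_re, Complex.add_im]
  ring

lemma eps_smul {r : ℝ} (hr : 0 < r) (k : ℂ) (Y : ℂ × ℝ) : eps k (r • Y) = eps k Y := by
  have h1 : (sqc (r • Y).1) = r • sqc Y.1 := sqc_smul hr.le _
  unfold eps
  rw [h1, vec_smul, norm_smul, Real.norm_eq_abs, abs_of_pos hr, mul_inv, Complex.smul_re,
    Complex.smul_im, smul_eq_mul, smul_eq_mul]
  field_simp

def rho (n r e : ℝ) : ℝ := -e + √(e ^ 2 + n ^ 2 - r ^ 2)

lemma rho_pos {n r e : ℝ} (hr : 0 ≤ r) (h : r < n) : 0 < rho n r e := by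
  unfold rho
  have h1 : |e| < √(e ^ 2 + n ^ 2 - r ^ 2) := by
    rw [← Real.sqrt_sq_eq_abs]
    apply Real.sqrt_lt_sqrt (sq_nonneg _); nlinarith
  linarith [le_abs_self e]

lemma rho_eq {n r e : ℝ} (hr : 0 ≤ r) (h : r < n) :
    rho n r e ^ 2 + 2 * rho n r e * e + r ^ 2 = n ^ 2 := by
  have h1 : √(e ^ 2 + n ^ 2 - r ^ 2) ^ 2 = e ^ 2 + n ^ 2 - r ^ 2 :=
    Real.sq_sqrt (by nlinarith [sq_nonneg e])
  unfold rho; nlinarith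

lemma rho_uniq {n r e L : ℝ} (hr : 0 ≤ r) (h : r < n) (hL : 0 ≤ L)
    (h1 : L ^ 2 + 2 * L * e + r ^ 2 = n ^ 2) : rho n r e = L := by
  have h2 := rho_eq (e := e) hr h
  have h3 := rho_pos (e := e) hr h
  set ρ := rho n r e
  have h5 : (ρ - L) * (ρ + L + 2 * e) = 0 := by nlinarith
  rcases mul_eq_zero.mp h5 with h6 | h6
  · linarith
  · exfalso
    have : ρ * L = r ^ 2 - n ^ 2 := by
      have : 2 * e = -ρ - L := by linarith
      nlinarith
    nlinarith [mul_nonneg h3.le hL]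

def KK (g : Qt) (n r : ℝ) (k : ℂ) (V : ℂ × ℝ) : ℂ × ℝ :=
  if 0 < 3 * r - n then rot g V
  else (rho n r (eps k (rot g V)) * ‖vec (rot g V)‖⁻¹) • rot g V

structure KH (g : Qt) (n : ℝ) (k k' : ℂ) : Prop where
  hg : ‖g‖ = 1
  hk : ‖k'‖ = ‖k‖
  ho : n ≤ 3 * ‖k‖ → 0 < n + ‖k‖ → ∀ V, ‖vec (b0 (rot g V) k')‖ = ‖vec (b0 V k)‖

lemma KH.symm {g : Qt} {n : ℝ} {k k' : ℂ} (H : KH g n k k') : KH (star g) n k' k := by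
  refine ⟨by rw [norm_star, H.hg], H.hk.symm, fun h h' V => ?_⟩
  rw [H.hk] at h h'
  rw [← H.ho h h']
  have := rot_rot (star g) (by rw [norm_star, H.hg]) V
  rw [star_star] at this
  rw [this]

lemma KK_inner {n : ℝ} {k : ℂ} {V : ℂ × ℝ}
    (hn : n = ‖vec (b0 V k)‖) (h : ¬ 0 < 3 * ‖k‖ - n) :
    (V = 0 ∧ n = 0 ∧ k = 0) ∨ (‖k‖ < n ∧ 0 < ‖vec V‖) := by
  have h1 := b0_ge V k
  have h2 := b0_le V k
  rw [← hn] at h1 h2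
  have h0 := norm_nonneg k
  have h4 := norm_nonneg (vec V)
  by_cases hz : n = 0
  · left
    have : ‖k‖ = 0 := by linarith
    have h5 : ‖vec V‖ = 0 := by linarith
    exact ⟨by simpa using h5, hz, by simpa using this⟩
  · right
    have hn0 : 0 < n := lt_of_le_of_ne (by rw [hn]; positivity) (Ne.symm hz)
    constructor <;> linarith

lemma KK_level {g : Qt} {n : ℝ} {k k' : ℂ} (H : KH g n k k') {V : ℂ × ℝ}
    (hn : n = ‖vec (b0 V k)‖) : ‖vec (b0 (KK g n ‖k‖ k' V) k')‖ = n := by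
  have hn0 : 0 ≤ n := by rw [hn]; positivity
  unfold KK
  split_ifs with h
  · rw [H.ho (by linarith) (by linarith), hn]
  · rcases KK_inner hn h with ⟨rfl, h2, h3⟩ | ⟨h1, h2⟩
    · have : k' = 0 := by have := H.hk; rw [h3] at this; simpa using this
      rw [this, norm_vec_b0, vec_smul, norm_smul, norm_vec_rot _ H.hg, vec_zero, h2]; simp
    · set Y := rot g V with hY
      have hL : 0 < ‖vec Y‖ := by rw [hY, norm_vec_rot _ H.hg]; exact h2
      have hρ := rho_pos (e := eps k' Y) (norm_nonneg k) h1
      have hr : 0 < rho n ‖k‖ (eps k' Y) * ‖vec Y‖⁻¹ := by positivity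
      have hN : ‖vec ((rho n ‖k‖ (eps k' Y) * ‖vec Y‖⁻¹) • Y)‖ = rho n ‖k‖ (eps k' Y) := by
        rw [vec_smul, norm_smul, Real.norm_eq_abs, abs_of_pos hr]; field_simp
      apply sqn_eq (norm_nonneg _) hn0
      rw [b0_sq _ _ (by rw [hN]; exact hρ.ne'), hN, eps_smul hr, H.hk]
      exact rho_eq (norm_nonneg k) h1

lemma KK_inv {g : Qt} {n : ℝ} {k k' : ℂ} (H : KH g n k k') {V : ℂ × ℝ}
    (hn : n = ‖vec (b0 V k)‖) : KK (star g) n ‖k‖ k (KK g n ‖k‖ k' V) = V := by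
  by_cases h : 0 < 3 * ‖k‖ - n
  · simp only [KK, h, if_true]
    exact rot_rot g H.hg V
  · rcases KK_inner hn h with ⟨rfl, h2, h3⟩ | ⟨h1, h2⟩
    · simp only [KK, h, if_false, rot_zero, smul_zero]
    · have hL : ‖vec (rot g V)‖ = ‖vec V‖ := norm_vec_rot _ H.hg V
      have hρ := rho_pos (e := eps k' (rot g V)) (norm_nonneg k) h1
      simp only [KK, h, if_false, rot_smul, rot_rot g H.hg V, hL]
      have hr : 0 < rho n ‖k‖ (eps k' (rot g V)) * ‖vec V‖⁻¹ := by positivity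
      rw [eps_smul hr, vec_smul, norm_smul, Real.norm_eq_abs, abs_of_pos hr]
      rw [rho_uniq (L := ‖vec V‖) (norm_nonneg k) h1 (norm_nonneg _)
        (by rw [hn, ← b0_sq _ _ h2.ne'])]
      rw [smul_smul]
      generalize rho n ‖k‖ (eps k' (rot g V)) = ρ at *
      have : ‖vec V‖ * (ρ * ‖vec V‖⁻¹ * ‖vec V‖)⁻¹ * (ρ * ‖vec V‖⁻¹) = 1 := by field_simp
      rw [this, one_smul]

lemma KK_bound {g : Qt} {n : ℝ} {k k' : ℂ} (H : KH g n k k') {V : ℂ × ℝ}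
    (hn : n = ‖vec (b0 V k)‖) : ‖vec (KK g n ‖k‖ k' V)‖ ≤ n + ‖k‖ := by
  have := b0_ge (KK g n ‖k‖ k' V) k'
  rwa [KK_level H hn, H.hk] at this

/-- the comparison at the interface -/
lemma KK_glue {g : Qt} {n : ℝ} {k k' : ℂ} (H : KH g n k k') {V : ℂ × ℝ}
    (hn : n = ‖vec (b0 V k)‖) (h : n = 3 * ‖k‖) (h0 : 0 < n) :
    (rho n ‖k‖ (eps k' (rot g V)) * ‖vec (rot g V)‖⁻¹) • rot g V = rot g V := by
  have hk : ‖k‖ < n := by linarith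
  have h1 := b0_ge V k
  rw [← hn] at h1
  have hL : 0 < ‖vec (rot g V)‖ := by
    rw [norm_vec_rot _ H.hg]
    rcases (norm_nonneg (vec V)).eq_or_lt with h2 | h2
    · have := b0_le V k
      rw [← hn, ← h2] at this; linarith
    · exact h2
  rw [rho_uniq (L := ‖vec (rot g V)‖) (norm_nonneg k) hk hL.le, mul_inv_cancel₀ hL.ne', one_smul]
  rw [hn, ← H.ho h.le (by linarith [norm_nonneg k]) V, b0_sq _ _ hL.ne', H.hk]

end Kmap

section Wmap

def qp (p q : ℂ) : Qt := qmk p.re p.im q.re q.im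
def aa (c : ℂ) (n : ℝ) : ℂ := (max ‖c‖ (n / 3))⁻¹ • c
def bb (c : ℂ) (n : ℝ) : ℝ := √(1 - ‖aa c n‖ ^ 2)
def gg (c : ℂ) (n : ℝ) : Qt := qp (aa c n) (bb c n)

@[simp] lemma qp_re (p q : ℂ) : (qp p q).re = p.re := rfl
@[simp] lemma qp_imI (p q : ℂ) : (qp p q).imI = p.im := rfl
@[simp] lemma qp_imJ (p q : ℂ) : (qp p q).imJ = q.re := rfl
@[simp] lemma qp_imK (p q : ℂ) : (qp p q).imK = q.im := rfl

lemma cn_sq (z : ℂ) : ‖z‖ ^ 2 = z.re ^ 2 + z.im ^ 2 := by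
  rw [← Complex.normSq_eq_norm_sq, Complex.normSq_apply]; ring

lemma qp_norm (p q : ℂ) : ‖qp p q‖ ^ 2 = ‖p‖ ^ 2 + ‖q‖ ^ 2 := by
  rw [qnorm_sq, cn_sq, cn_sq]; simp; ring

lemma aa_le (c : ℂ) (n : ℝ) : ‖aa c n‖ ≤ 1 := by
  unfold aa
  have h : 0 ≤ max ‖c‖ (n / 3) := le_max_of_le_left (norm_nonneg c)
  rw [norm_smul, norm_inv, Real.norm_eq_abs, abs_of_nonneg h]
  exact inv_mul_le_one_of_le₀ (le_max_left _ _) h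

lemma bb_sq (c : ℂ) (n : ℝ) : ‖aa c n‖ ^ 2 + bb c n ^ 2 = 1 := by
  unfold bb
  rw [Real.sq_sqrt]
  · ring
  · have := aa_le c n
    have := norm_nonneg (aa c n)
    nlinarith

lemma gg_norm (c : ℂ) (n : ℝ) : ‖gg c n‖ = 1 := by
  apply sqn_eq (norm_nonneg _) (by norm_num)
  rw [gg, qp_norm]
  have := bb_sq c n
  simp
  linarith

lemma aa_outer {c : ℂ} {n : ℝ} (h : n ≤ 3 * ‖c‖) : c = ‖c‖ • aa c n := by
  unfold aa
  rcases eq_or_ne c 0 with rfl | hc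
  · simp
  · have hc' : ‖c‖ ≠ 0 := by simpa using hc
    rw [max_eq_left (by linarith), smul_smul, mul_inv_cancel₀ hc', one_smul]

lemma aa_outer_norm {c : ℂ} {n : ℝ} (h : n ≤ 3 * ‖c‖) (hc : 0 < ‖c‖) : ‖aa c n‖ = 1 := by
  have h1 := congrArg norm (aa_outer h)
  rw [norm_smul, norm_norm] at h1
  have : ‖c‖ * (‖aa c n‖ - 1) = 0 := by linarith
  rcases mul_eq_zero.mp this with h | h <;> linarith

lemma bb_outer {c : ℂ} {n : ℝ} (h : n ≤ 3 * ‖c‖) (hc : 0 < ‖c‖) : bb c n = 0 := by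
  rw [bb, aa_outer_norm h hc]; simp

lemma star_of_norm_one {a : ℂ} (ha : ‖a‖ = 1) : a * star a = 1 := by
  have := Complex.mul_conj a
  rw [Complex.normSq_eq_norm_sq, ha] at this
  simpa using this

lemma sqc_unit {a : ℂ} (ha : ‖a‖ = 1) : sqc a = a ^ 2 := by simp [sqc, ha]

lemma rot_qp (a : ℂ) (ha : ‖a‖ = 1) (V : ℂ × ℝ) : rot (qp a 0) V = (a ^ 2 * V.1, V.2) := by
  have h := cn_sq a
  rw [ha] at h
  refine Prod.ext (Complex.ext ?_ ?_) ?_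
  · simp [rot, unv, h12, sq]; ring
  · simp [rot, unv, h12, sq]; ring
  · simp [rot, unv]; linear_combination (-V.2) * h

lemma kap_outer {a c : ℂ} (ha : ‖a‖ = 1) (hc : c = ‖c‖ • a) : kap c = a ^ 4 * star c := by
  rcases eq_or_ne c 0 with rfl | h
  · simp
  have hc' : (‖c‖ : ℂ) ≠ 0 := by simpa using h
  have h1 := star_of_norm_one ha
  unfold kap
  generalize ‖c‖ = r at *
  subst hc
  simp only [Complex.real_smul, star_mul', Complex.star_def, Complex.conj_ofReal] at h1 ⊢
  field_simp
  linear_combination (-a ^ 3) * h1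

lemma b0_outer {a c : ℂ} (ha : ‖a‖ = 1) (hc : c = ‖c‖ • a) (V : ℂ × ℝ) :
    b0 (rot (qp a 0) V) (kap c) = rot (qp (a ^ 2) 0) (b0 V (star c)) := by
  rw [rot_qp a ha, rot_qp (a ^ 2) (by simp [ha]), kap_outer ha hc]
  simp only [b0, sqc_mul, sqc_unit (a := a ^ 2) (by simp [ha])]
  ring_nf

lemma gg_KH (c : ℂ) (n : ℝ) : KH (gg c n) n (star c) (kap c) := by
  refine ⟨gg_norm c n, by simp, fun h h0 V => ?_⟩
  rw [norm_star] at h h0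
  have hc : 0 < ‖c‖ := by
    by_contra h1
    linarith [norm_nonneg c]
  have ha := aa_outer_norm h hc
  rw [gg, bb_outer h hc, Complex.ofReal_zero, b0_outer ha (aa_outer h), norm_vec_rot]
  apply sqn_eq (norm_nonneg _) (by norm_num)
  rw [qp_norm]; simp [ha]

def nF (V : ℂ × ℝ) (c : ℂ) : ℝ := ‖vec (b0 V (star c))‖
def Kf (V : ℂ × ℝ) (c : ℂ) : ℂ × ℝ := KK (gg c (nF V c)) (nF V c) ‖c‖ (kap c) V

lemma Kf_level (V : ℂ × ℝ) (c : ℂ) : ‖vec (b0 (Kf V c) (kap c))‖ = nF V c := by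
  have := KK_level (gg_KH c (nF V c)) (V := V) rfl
  rwa [norm_star] at this

lemma nF_le (V : ℂ × ℝ) (c : ℂ) : nF V c ≤ ‖vec V‖ + ‖c‖ := by
  have := b0_le V (star c)
  rwa [norm_star] at this

lemma nF_ge (V : ℂ × ℝ) (c : ℂ) : ‖vec V‖ ≤ nF V c + ‖c‖ := by
  have := b0_ge V (star c)
  rwa [norm_star] at this

lemma nF_nonneg (V : ℂ × ℝ) (c : ℂ) : 0 ≤ nF V c := norm_nonneg _

def Sp (a : ℂ) (b R : ℝ) (V : ℂ × ℝ) : Qt :=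
  qp (sqc (a * ((R + V.2 : ℝ) : ℂ) - b * star V.1) + sqc (a * ((R - V.2 : ℝ) : ℂ) + b * star V.1))
    (sqc (a * V.1 + b * ((R + V.2 : ℝ) : ℂ)) - sqc (a * V.1 - b * ((R - V.2 : ℝ) : ℂ)))

lemma exists_pq (V : ℂ × ℝ) : ∃ p q : ℂ, p * star p = ((‖vec V‖ + V.2) / 2 : ℝ) ∧
    q * star q = ((‖vec V‖ - V.2) / 2 : ℝ) ∧ 2 * (p * q) = V.1 := by
  have hR := norm_vec_sq V
  have hR0 := norm_nonneg (vec V)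
  generalize ‖vec V‖ = R at *
  have h1 : 0 ≤ R + V.2 := by
    by_contra h
    nlinarith [sq_nonneg ‖V.1‖]
  rcases h1.eq_or_lt with h | h
  · have : ‖V.1‖ = 0 := by
      have : ‖V.1‖ ^ 2 = 0 := by nlinarith
      simpa using this
    refine ⟨0, (√R : ℝ), by rw [← h]; simp, ?_, by simpa using (norm_eq_zero.mp this).symm⟩
    rw [Complex.star_def, Complex.conj_ofReal, ← Complex.ofReal_mul, Real.mul_self_sqrt hR0]
    congr 1; linarith
  · have hp : 0 < √((R + V.2) / 2) := by positivity
    have hp2 : √((R + V.2) / 2) * √((R + V.2) / 2) = (R + V.2) / 2 :=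
      Real.mul_self_sqrt (by positivity)
    generalize √((R + V.2) / 2) = P at *
    have hP : (P : ℂ) ≠ 0 := by exact_mod_cast hp.ne'
    refine ⟨P, V.1 / (2 * P), ?_, ?_, by field_simp⟩
    · rw [Complex.star_def, Complex.conj_ofReal, ← Complex.ofReal_mul, hp2]
    · rw [Complex.star_def, Complex.mul_conj, Complex.normSq_eq_norm_sq]
      congr 1
      rw [norm_div, norm_mul, Complex.norm_ofNat, Complex.norm_real, Real.norm_eq_abs,
        abs_of_pos hp, div_pow]
      rw [div_eq_iff (by positivity)]
      nlinarith

lemma hopfI (p q : ℂ) : qp p q * qp Complex.I 0 * star (qp p q) =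
    vec (2 * (p * q), ‖p‖ ^ 2 - ‖q‖ ^ 2) := by
  rw [cn_sq, cn_sq]
  ext <;> simp <;> ring

lemma hopfI' (p q : ℂ) : vec (b0 (2 * (p * q), ‖p‖ ^ 2 - ‖q‖ ^ 2) 0) =
    qp (sqc p) (sqc q) * qp Complex.I 0 * star (qp (sqc p) (sqc q)) := by
  rw [hopfI]
  congr 1
  simp only [b0, norm_sqc, add_zero, sqc_mul]
  congr 2
  have := sqc_ofReal (r := 2) (by norm_num)
  simpa using this

lemma Sp_eq {a p q : ℂ} {b R : ℝ} {V : ℂ × ℝ} (h1 : p * star p = ((R + V.2) / 2 : ℝ))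
    (h2 : q * star q = ((R - V.2) / 2 : ℝ)) (h3 : 2 * (p * q) = V.1) :
    Sp a b R V = (2 : ℝ) • (qp (sqc (a * p - b * star q)) (sqc (a * q + b * star p)) *
      star (qp (sqc p) (sqc q))) := by
  have h1' : ((R + V.2 : ℝ) : ℂ) = 2 * (p * star p) := by rw [h1]; push_cast; ring
  have h2' : ((R - V.2 : ℝ) : ℂ) = 2 * (q * star q) := by rw [h2]; push_cast; ring
  have s2 : sqc 2 = 2 := by simpa using sqc_ofReal (r := 2) (by norm_num)
  have e1 : sqc (a * ((R + V.2 : ℝ) : ℂ) - b * star V.1) =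
      2 * (star (sqc p) * sqc (a * p - b * star q)) := by
    rw [h1', ← h3, ← sqc_conj, ← sqc_mul]; nth_rw 3 [← s2]; rw [← sqc_mul]
    congr 1; simp; ring
  have e2 : sqc (a * ((R - V.2 : ℝ) : ℂ) + b * star V.1) =
      2 * (star (sqc q) * sqc (a * q + b * star p)) := by
    rw [h2', ← h3, ← sqc_conj, ← sqc_mul]; nth_rw 3 [← s2]; rw [← sqc_mul]
    congr 1; simp; ring
  have e3 : sqc (a * V.1 + b * ((R + V.2 : ℝ) : ℂ)) =
      2 * (sqc p * sqc (a * q + b * star p)) := by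
    rw [h1', ← h3, ← sqc_mul]; nth_rw 3 [← s2]; rw [← sqc_mul]
    congr 1; ring
  have e4 : sqc (a * V.1 - b * ((R - V.2 : ℝ) : ℂ)) =
      2 * (sqc q * sqc (a * p - b * star q)) := by
    rw [h2', ← h3, ← sqc_mul]; nth_rw 3 [← s2]; rw [← sqc_mul]
    congr 1; ring
  rw [Sp, e1, e2, e3, e4]
  generalize sqc (a * p - b * star q) = P
  generalize sqc (a * q + b * star p) = Q
  generalize sqc p = u
  generalize sqc q = v
  ext <;> simp <;> ring

lemma gZ (a p q : ℂ) (b : ℝ) : qp (a * p - b * star q) (a * q + b * star p) = qp a b * qp p q := by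
  ext <;> simp <;> ring

lemma qp_sqc_norm (p q : ℂ) : ‖qp (sqc p) (sqc q)‖ = ‖qp p q‖ := by
  apply sqn_eq (norm_nonneg _) (norm_nonneg _)
  rw [qp_norm, qp_norm, norm_sqc, norm_sqc]

lemma Sp_rel (a : ℂ) (b : ℝ) (V : ℂ × ℝ) (hab : ‖qp a b‖ = 1) :
    Sp a b ‖vec V‖ V * vec (b0 V 0) = vec (b0 (rot (qp a b) V) 0) * Sp a b ‖vec V‖ V ∧
    ‖Sp a b ‖vec V‖ V‖ = 2 * ‖vec V‖ := by
  obtain ⟨p, q, h1, h2, h3⟩ := exists_pq V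
  rw [Sp_eq h1 h2 h3]
  have e1 : ‖p‖ ^ 2 = (‖vec V‖ + V.2) / 2 := by
    have := Complex.mul_conj p
    rw [← Complex.star_def, h1, Complex.normSq_eq_norm_sq] at this
    exact_mod_cast this.symm
  have e2 : ‖q‖ ^ 2 = (‖vec V‖ - V.2) / 2 := by
    have := Complex.mul_conj q
    rw [← Complex.star_def, h2, Complex.normSq_eq_norm_sq] at this
    exact_mod_cast this.symm
  have hV : V = (2 * (p * q), ‖p‖ ^ 2 - ‖q‖ ^ 2) := by
    refine Prod.ext h3.symm ?_
    rw [e1, e2]; ring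
  have hZ : ‖qp p q‖ ^ 2 = ‖vec V‖ := by rw [qp_norm, e1, e2]; ring
  have hrV : rot (qp a b) V = (2 * ((a * p - b * star q) * (a * q + b * star p)),
      ‖a * p - b * star q‖ ^ 2 - ‖a * q + b * star p‖ ^ 2) := by
    apply vec_inj
    rw [vec_rot, ← hopfI, gZ]
    conv_lhs => rw [hV, ← hopfI]
    rw [star_mul]; simp only [mul_assoc]
  have hZ' : ‖qp (a * p - b * star q) (a * q + b * star p)‖ = ‖qp p q‖ := by
    rw [gZ, norm_mul, hab, one_mul]
  have hb : vec (b0 V 0) = qp (sqc p) (sqc q) * qp Complex.I 0 * star (qp (sqc p) (sqc q)) := by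
    rw [← hopfI', ← hV]
  rw [hb, hrV, hopfI']
  have n1 : star (qp (sqc p) (sqc q)) * qp (sqc p) (sqc q) = ((‖vec V‖ : ℝ) : Qt) := by
    rw [Quaternion.star_mul_self, Quaternion.normSq_eq_norm_mul_self, qp_sqc_norm, ← sq, hZ]
  have n2 : star (qp (sqc (a * p - b * star q)) (sqc (a * q + b * star p))) *
      qp (sqc (a * p - b * star q)) (sqc (a * q + b * star p)) = ((‖vec V‖ : ℝ) : Qt) := by
    rw [Quaternion.star_mul_self, Quaternion.normSq_eq_norm_mul_self, qp_sqc_norm, ← sq, hZ', hZ]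
  have n3 : ‖(2 : ℝ) • (qp (sqc (a * p - b * star q)) (sqc (a * q + b * star p)) *
      star (qp (sqc p) (sqc q)))‖ = 2 * ‖vec V‖ := by
    rw [norm_smul, norm_mul, norm_star, qp_sqc_norm, qp_sqc_norm, hZ', ← hZ]; simp [sq]
  refine ⟨?_, n3⟩
  generalize qp (sqc p) (sqc q) = z at *
  generalize qp (sqc (a * p - b * star q)) (sqc (a * q + b * star p)) = z' at *
  generalize ‖vec V‖ = R at *
  calc (2 : ℝ) • (z' * star z) * (z * qp Complex.I 0 * star z)
      = (2 : ℝ) • (z' * (star z * z) * qp Complex.I 0 * star z) := by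
        simp only [smul_mul_assoc, mul_assoc]
    _ = (2 : ℝ) • (z' * qp Complex.I 0 * (star z' * z') * star z) := by
        rw [n1, n2]; congr 1
        simp only [mul_assoc]
        rw [← mul_assoc (R : Qt), Quaternion.coe_commutes R (qp Complex.I 0),
          mul_assoc]
    _ = _ := by simp only [mul_smul_comm, mul_assoc]

lemma Sp_outer {a : ℂ} (ha : ‖a‖ = 1) {R : ℝ} {V : ℂ × ℝ} (hR : ‖vec V‖ ≤ R) :
    Sp a 0 R V = (2 * R) • qp (a ^ 2) 0 := by
  have hs : |V.2| ≤ R := by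
    refine le_trans ?_ hR
    apply abs_le_of_sq_le_sq _ (norm_nonneg _)
    rw [norm_vec_sq]; nlinarith [sq_nonneg ‖V.1‖]
  rw [abs_le] at hs
  unfold Sp
  simp only [Complex.ofReal_zero, zero_mul, sub_zero, add_zero, sub_self, sqc_mul,
    sqc_ofReal (show 0 ≤ R + V.2 by linarith), sqc_ofReal (show 0 ≤ R - V.2 by linarith),
    sqc_unit ha]
  generalize a ^ 2 = A
  ext <;> simp <;> ring

end Wmap

section Wmap2

def Fm (V : ℂ × ℝ) (c : ℂ) : Qt := vec (b0 V (star c))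
def Fp (V : ℂ × ℝ) (c : ℂ) : Qt := vec (b0 (Kf V c) (kap c))
def kq : Qt := qmk 0 0 0 1
def nu (x : Qt) : Qt := if 0 < ‖x‖ then ‖x‖⁻¹ • x else kq

lemma kq_norm : ‖kq‖ = 1 := by
  apply sqn_eq (norm_nonneg _) (by norm_num)
  rw [qnorm_sq]; simp [kq]

lemma nu_norm (x : Qt) : ‖nu x‖ = 1 := by
  unfold nu
  split_ifs with h
  · rw [norm_smul, norm_inv, norm_norm, inv_mul_cancel₀ h.ne']
  · exact kq_norm

lemma nu_smul (x : Qt) : x ≠ 0 → x = ‖x‖ • nu x := by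
  intro h
  have h' : 0 < ‖x‖ := norm_pos_iff.mpr h
  rw [nu, if_pos h', smul_smul, mul_inv_cancel₀ h'.ne', one_smul]

lemma nu_of {x u : Qt} {r : ℝ} (hr : 0 < r) (hu : ‖u‖ = 1) (h : x = r • u) : nu x = u := by
  have : ‖x‖ = r := by rw [h, norm_smul, hu, Real.norm_eq_abs, abs_of_pos hr, mul_one]
  rw [nu, this, if_pos hr, h, smul_smul, inv_mul_cancel₀ hr.ne', one_smul]

lemma Fm_norm (V : ℂ × ℝ) (c : ℂ) : ‖Fm V c‖ = nF V c := rfl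
lemma Fp_norm (V : ℂ × ℝ) (c : ℂ) : ‖Fp V c‖ = nF V c := Kf_level V c

lemma pure_sq {X : Qt} (h : X.re = 0) : X * X = (-(‖X‖ ^ 2)) • (1 : Qt) := by
  have h1 : star X = -X := by ext <;> simp [h]
  have h2 := Quaternion.self_mul_star X
  rw [h1, Quaternion.normSq_eq_norm_mul_self] at h2
  rw [neg_smul, ← Quaternion.coe_mul_eq_smul, mul_one, sq, ← h2]; simp

def Ss (V : ℂ × ℝ) (c : ℂ) : Qt :=
  Sp (aa c (nF V c)) (bb c (nF V c)) (max ‖vec V‖ ‖c‖) V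

def Wp (V : ℂ × ℝ) (c : ℂ) : Qt :=
  (nF V c ^ 2 + max (3 * ‖c‖ - nF V c) 0) • Ss V c - Fp V c * Ss V c * Fm V c

lemma outer_W {V : ℂ × ℝ} {c : ℂ} (h : nF V c < 3 * ‖c‖) :
    ∃ a : ℂ, ‖qp a 0‖ = 1 ∧ Fp V c = qp a 0 * Fm V c * star (qp a 0) ∧
      ∃ r : ℝ, 0 < r ∧ Wp V c = r • qp a 0 := by
  have hn := nF_nonneg V c
  have hc : 0 < ‖c‖ := by linarith
  have ha := aa_outer_norm h.le hc
  have hb := bb_outer h.le hc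
  have hg : gg c (nF V c) = qp (aa c (nF V c)) 0 := by rw [gg, hb]; simp
  have hK : Kf V c = rot (qp (aa c (nF V c)) 0) V := by
    rw [Kf, KK, if_pos (by linarith), hg]
  have hF : Fp V c = qp (aa c (nF V c) ^ 2) 0 * Fm V c * star (qp (aa c (nF V c) ^ 2) 0) := by
    rw [Fp, hK, b0_outer ha (aa_outer h.le), vec_rot]; rfl
  have hu : ‖qp (aa c (nF V c) ^ 2) 0‖ = 1 := by
    apply sqn_eq (norm_nonneg _) (by norm_num)
    rw [qp_norm]; simp [ha]
  refine ⟨aa c (nF V c) ^ 2, hu, hF, ?_⟩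
  have hS : Ss V c = (2 * max ‖vec V‖ ‖c‖) • qp (aa c (nF V c) ^ 2) 0 := by
    rw [Ss, hb, Sp_outer ha (le_max_left _ _)]
  have hR : 0 < max ‖vec V‖ ‖c‖ := lt_of_lt_of_le hc (le_max_right _ _)
  have hsq := pure_sq (X := Fm V c) (vec_re _)
  rw [Fm_norm] at hsq
  have hmx : max (3 * ‖c‖ - nF V c) 0 = 3 * ‖c‖ - nF V c := max_eq_left (by linarith)
  have hsm := qsm _ hu
  refine ⟨(nF V c ^ 2 + (3 * ‖c‖ - nF V c) + nF V c ^ 2) * (2 * max ‖vec V‖ ‖c‖), ?_, ?_⟩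
  · have : 0 < 3 * ‖c‖ - nF V c := by linarith
    positivity
  · rw [Wp, hS, hF, hmx]
    generalize qp (aa c (nF V c) ^ 2) 0 = u at *
    generalize Fm V c = F at *
    have : u * F * star u * ((2 * max ‖vec V‖ ‖c‖) • u) * F =
        (2 * max ‖vec V‖ ‖c‖ * (-(nF V c ^ 2))) • u := by
      calc _ = (2 * max ‖vec V‖ ‖c‖) • (u * F * (star u * u) * F) := by
            simp only [mul_smul_comm, smul_mul_assoc, mul_assoc]
        _ = _ := by rw [hsm, mul_one, mul_assoc, hsq, mul_smul_comm, mul_one, smul_smul]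
    rw [this, smul_smul, ← sub_smul]; congr 1; ring

lemma inner_W {V : ℂ × ℝ} {c : ℂ} (h : 3 * ‖c‖ ≤ nF V c) :
    Wp V c = nF V c ^ 2 • Ss V c - Fp V c * Ss V c * Fm V c := by
  rw [Wp, max_eq_right (by linarith), add_zero]

lemma W_inter (V : ℂ × ℝ) (c : ℂ) : Wp V c * Fm V c = Fp V c * Wp V c := by
  rcases lt_or_ge (nF V c) (3 * ‖c‖) with h | h
  · obtain ⟨a, hu, hF, r, hr, hW⟩ := outer_W h
    rw [hF, hW, smul_mul_assoc, mul_smul_comm]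
    congr 1
    rw [mul_assoc, qsm _ hu, mul_one]
  · rw [inner_W h]
    have h1 := pure_sq (X := Fm V c) (vec_re _)
    have h2 := pure_sq (X := Fp V c) (vec_re _)
    rw [Fm_norm] at h1
    rw [Fp_norm] at h2
    generalize Fm V c = F at *
    generalize Fp V c = G at *
    rw [sub_mul, mul_sub, mul_assoc (G * Ss V c), h1, ← mul_assoc, ← mul_assoc, h2]
    simp only [mul_smul_comm, smul_mul_assoc, mul_one, one_mul, neg_smul, mul_neg, neg_mul, sub_neg_eq_add]
    rw [add_comm]

lemma W_ne {V : ℂ × ℝ} {c : ℂ} (h0 : 0 < nF V c + ‖c‖) : Wp V c ≠ 0 := by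
  rcases lt_or_ge (nF V c) (3 * ‖c‖) with h | h
  · obtain ⟨a, hu, hF, r, hr, hW⟩ := outer_W h
    rw [hW]
    intro h1
    have := congrArg norm h1
    rw [norm_smul, hu, norm_zero, mul_one, norm_eq_zero] at this
    exact hr.ne' this
  · rw [inner_W h]
    have hn : 0 < nF V c := by
      rcases (nF_nonneg V c).eq_or_lt with h1 | h1
      · rw [← h1] at h h0; linarith
      · exact h1
    have h1 := pure_sq (X := Fm V c) (vec_re _)
    rw [Fm_norm] at h1
    have hL := nF_ge V c
    have hL' := nF_le V c
    have hc0 := norm_nonneg c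
    have hL0 : 0 < ‖vec V‖ := by linarith
    have hR : max ‖vec V‖ ‖c‖ = ‖vec V‖ := max_eq_left (by linarith)
    have hgn := gg_norm c (nF V c)
    obtain ⟨hS, hSn⟩ := Sp_rel (aa c (nF V c)) (bb c (nF V c)) V hgn
    change _ = vec (b0 (rot (gg c (nF V c)) V) 0) * _ at hS
    rw [← hR] at hS hSn
    change Ss V c * _ = _ * Ss V c at hS
    change ‖Ss V c‖ = _ at hSn
    rw [hR] at hSn
    have hin := KK_inner (n := nF V c) (k := star c) (V := V) rfl (by rw [norm_star]; linarith)
    have hρ := rho_pos (n := nF V c) (r := ‖c‖) (e := eps (kap c) (rot (gg c (nF V c)) V))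
      (norm_nonneg _) (by linarith)
    have hF : Fp V c = (rho (nF V c) ‖c‖ (eps (kap c) (rot (gg c (nF V c)) V)) *
        ‖vec (rot (gg c (nF V c)) V)‖⁻¹) • vec (b0 (rot (gg c (nF V c)) V) 0) + vec (kap c, 0) := by
      rw [Fp, Kf, KK, if_neg (by linarith), vec_b0, b0_smul, vec_smul]
      positivity
    have hYn := norm_vec_b0 (rot (gg c (nF V c)) V)
    rw [norm_vec_rot _ hgn] at hYn hF
    have hτ : 0 < rho (nF V c) ‖c‖ (eps (kap c) (rot (gg c (nF V c)) V)) * ‖vec V‖⁻¹ := by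
      positivity
    have hFm : Fm V c = vec (b0 V 0) + vec (star c, 0) := vec_b0 _ _
    generalize rho (nF V c) ‖c‖ (eps (kap c) (rot (gg c (nF V c)) V)) * ‖vec V‖⁻¹ = τ at *
    generalize vec (b0 (rot (gg c (nF V c)) V) 0) = E' at *
    intro hW
    have h3 : Ss V c * Fm V c = -(Fp V c * Ss V c) := by
      have h4 : nF V c ^ 2 • Ss V c = Fp V c * Ss V c * Fm V c := sub_eq_zero.mp hW
      have h5 : nF V c ^ 2 • (Ss V c * Fm V c) = nF V c ^ 2 • -(Fp V c * Ss V c) := by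
        rw [← smul_mul_assoc, h4, mul_assoc, h1]
        simp
      exact smul_right_injective Qt (by positivity : nF V c ^ 2 ≠ 0) h5
    have h6 : (1 + τ) • (E' * Ss V c) = -(Ss V c * vec (star c, 0) + vec (kap c, 0) * Ss V c) := by
      rw [hFm, mul_add, hS, hF, add_mul, smul_mul_assoc] at h3
      rw [add_smul, one_smul, eq_neg_iff_add_eq_zero]
      rw [eq_neg_iff_add_eq_zero] at h3
      rw [← h3]; abel
    have h7 := congrArg norm h6
    have h8 : ‖Ss V c * vec (star c, 0) + vec (kap c, 0) * Ss V c‖ ≤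
        ‖Ss V c‖ * ‖c‖ + ‖c‖ * ‖Ss V c‖ := by
      refine (norm_add_le _ _).trans (le_of_eq ?_)
      rw [norm_mul, norm_mul, norm_vec_k, norm_vec_k, norm_star, norm_kap]
    rw [norm_neg, norm_smul, norm_mul, Real.norm_eq_abs, abs_of_pos (by linarith), hYn] at h7
    rw [← h7, hSn] at h8
    have h9 : 0 < τ * (‖vec V‖ * (2 * ‖vec V‖)) := by positivity
    nlinarith

lemma Ss_k {V : ℂ × ℝ} (c : ℂ) (h : V.1 = 0) : (Ss V c).imK = 0 := by
  have hr : ∀ x : ℝ, (sqc (x : ℂ)).im = 0 := by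
    intro x; simp [sqc, ← Complex.ofReal_pow]
  have e : ∀ x y : ℝ, sqc (-((x : ℂ) * (y : ℂ))) = sqc ((x * y : ℝ) : ℂ) := by
    intro x y; rw [sqc_neg]; push_cast; rfl
  have e2 : ∀ x y : ℝ, sqc ((x : ℂ) * (y : ℂ)) = sqc ((x * y : ℝ) : ℂ) := by
    intro x y; push_cast; rfl
  unfold Ss Sp
  rw [h, qp_imK, mul_zero, zero_add, zero_sub, e, e2, Complex.sub_im, hr, hr, sub_zero]

lemma W_k {V : ℂ × ℝ} {c : ℂ} (h : V.1 = 0) {l : ℝ} (hl : Wp V c = -(l • kq)) : l = 0 := by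
  have hS := Ss_k c h
  have hn := nF_nonneg V c
  have hd : 0 ≤ max (3 * ‖c‖ - nF V c) 0 := le_max_right _ _
  have h1 : ‖Fp V c * Ss V c * Fm V c‖ = nF V c ^ 2 * ‖Ss V c‖ := by
    rw [norm_mul, norm_mul, Fm_norm, Fp_norm]; ring
  rw [Wp] at hl
  generalize max (3 * ‖c‖ - nF V c) 0 = d at *
  have h2 : Fp V c * Ss V c * Fm V c = (nF V c ^ 2 + d) • Ss V c + l • kq := by
    rw [sub_eq_iff_eq_add] at hl
    rw [hl]; abel
  rw [h2] at h1
  have h3 : ‖(nF V c ^ 2 + d) • Ss V c + l • kq‖ ^ 2 = (nF V c ^ 2 + d) ^ 2 * ‖Ss V c‖ ^ 2 + l ^ 2 := by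
    rw [qnorm_sq, qnorm_sq]; simp [kq, hS]; ring
  rw [h1] at h3
  have h4 : 0 ≤ nF V c ^ 2 * d * ‖Ss V c‖ ^ 2 := by positivity
  have h5 : 0 ≤ d ^ 2 * ‖Ss V c‖ ^ 2 := by positivity
  have : l ^ 2 = 0 := by nlinarith [sq_nonneg l]
  simpa using this

end Wmap2

section Cont
variable {X : Type*} {l : Filter X}

lemma tendsto_qmk {f g h k : X → ℝ} {f0 g0 h0 k0 : ℝ} (hf : Tendsto f l (𝓝 f0))
    (hg : Tendsto g l (𝓝 g0)) (hh : Tendsto h l (𝓝 h0)) (hk : Tendsto k l (𝓝 k0)) :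
    Tendsto (fun x => qmk (f x) (g x) (h x) (k x)) l (𝓝 (qmk f0 g0 h0 k0)) := by
  have hc : Continuous (fun p : ℝ × ℝ × ℝ × ℝ => qmk p.1 p.2.1 p.2.2.1 p.2.2.2) :=
    qmk_continuous (by fun_prop) (by fun_prop) (by fun_prop) (by fun_prop)
  exact (hc.tendsto (f0, g0, h0, k0)).comp
    (hf.prodMk_nhds (hg.prodMk_nhds (hh.prodMk_nhds hk)))

lemma tendsto_cre {z : X → ℂ} {z0 : ℂ} (hz : Tendsto z l (𝓝 z0)) :
    Tendsto (fun x => (z x).re) l (𝓝 z0.re) := (Complex.continuous_re.tendsto z0).comp hz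
lemma tendsto_cim {z : X → ℂ} {z0 : ℂ} (hz : Tendsto z l (𝓝 z0)) :
    Tendsto (fun x => (z x).im) l (𝓝 z0.im) := (Complex.continuous_im.tendsto z0).comp hz
lemma tendsto_of {z : X → ℝ} {z0 : ℝ} (hz : Tendsto z l (𝓝 z0)) :
    Tendsto (fun x => (z x : ℂ)) l (𝓝 (z0 : ℂ)) := (Complex.continuous_ofReal.tendsto z0).comp hz
lemma tendsto_sqc {z : X → ℂ} {z0 : ℂ} (hz : Tendsto z l (𝓝 z0)) :
    Tendsto (fun x => sqc (z x)) l (𝓝 (sqc z0)) := (continuous_sqc.tendsto z0).comp hz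
lemma tendsto_kap {z : X → ℂ} {z0 : ℂ} (hz : Tendsto z l (𝓝 z0)) :
    Tendsto (fun x => kap (z x)) l (𝓝 (kap z0)) := (continuous_kap.tendsto z0).comp hz
lemma tendsto_p1 {V : X → ℂ × ℝ} {V0 : ℂ × ℝ} (hV : Tendsto V l (𝓝 V0)) :
    Tendsto (fun x => (V x).1) l (𝓝 V0.1) := (continuous_fst.tendsto V0).comp hV
lemma tendsto_p2 {V : X → ℂ × ℝ} {V0 : ℂ × ℝ} (hV : Tendsto V l (𝓝 V0)) :
    Tendsto (fun x => (V x).2) l (𝓝 V0.2) := (continuous_snd.tendsto V0).comp hV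
lemma tendsto_vec {V : X → ℂ × ℝ} {V0 : ℂ × ℝ} (hV : Tendsto V l (𝓝 V0)) :
    Tendsto (fun x => vec (V x)) l (𝓝 (vec V0)) := (continuous_vec.tendsto V0).comp hV
lemma tendsto_unv {V : X → Qt} {V0 : Qt} (hV : Tendsto V l (𝓝 V0)) :
    Tendsto (fun x => unv (V x)) l (𝓝 (unv V0)) := (continuous_unv.tendsto V0).comp hV

lemma tendsto_qp {p q : X → ℂ} {p0 q0 : ℂ} (hp : Tendsto p l (𝓝 p0)) (hq : Tendsto q l (𝓝 q0)) :
    Tendsto (fun x => qp (p x) (q x)) l (𝓝 (qp p0 q0)) :=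
  tendsto_qmk (tendsto_cre hp) (tendsto_cim hp) (tendsto_cre hq) (tendsto_cim hq)

lemma tendsto_b0 {V : X → ℂ × ℝ} {V0 : ℂ × ℝ} {k : X → ℂ} {k0 : ℂ} (hV : Tendsto V l (𝓝 V0))
    (hk : Tendsto k l (𝓝 k0)) : Tendsto (fun x => b0 (V x) (k x)) l (𝓝 (b0 V0 k0)) :=
  ((tendsto_sqc (tendsto_p1 hV)).add hk).prodMk_nhds (tendsto_p2 hV)

lemma tendsto_rot {V : X → ℂ × ℝ} {V0 : ℂ × ℝ} {g : X → Qt} {g0 : Qt} (hV : Tendsto V l (𝓝 V0))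
    (hg : Tendsto g l (𝓝 g0)) : Tendsto (fun x => rot (g x) (V x)) l (𝓝 (rot g0 V0)) :=
  tendsto_unv ((hg.mul (tendsto_vec hV)).mul hg.star)

variable {V : X → ℂ × ℝ} {V0 : ℂ × ℝ} {c : X → ℂ} {c0 : ℂ}

lemma tendsto_Fm (hV : Tendsto V l (𝓝 V0)) (hc : Tendsto c l (𝓝 c0)) :
    Tendsto (fun x => Fm (V x) (c x)) l (𝓝 (Fm V0 c0)) :=
  tendsto_vec (tendsto_b0 hV hc.star)

lemma tendsto_nF (hV : Tendsto V l (𝓝 V0)) (hc : Tendsto c l (𝓝 c0)) :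
    Tendsto (fun x => nF (V x) (c x)) l (𝓝 (nF V0 c0)) := (tendsto_Fm hV hc).norm

lemma tendsto_aa (hV : Tendsto V l (𝓝 V0)) (hc : Tendsto c l (𝓝 c0))
    (h0 : 0 < nF V0 c0 + ‖c0‖) :
    Tendsto (fun x => aa (c x) (nF (V x) (c x))) l (𝓝 (aa c0 (nF V0 c0))) := by
  have h1 := (hc.norm.max ((tendsto_nF hV hc).div_const 3)).inv₀ (by
    have h2 := nF_nonneg V0 c0
    rcases (norm_nonneg c0).eq_or_lt with h | h
    · exact (lt_of_lt_of_le (show 0 < nF V0 c0 / 3 by linarith) (le_max_right _ _)).ne'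
    · exact (lt_of_lt_of_le h (le_max_left _ _)).ne')
  exact h1.smul hc

lemma tendsto_bb (hV : Tendsto V l (𝓝 V0)) (hc : Tendsto c l (𝓝 c0))
    (h0 : 0 < nF V0 c0 + ‖c0‖) :
    Tendsto (fun x => bb (c x) (nF (V x) (c x))) l (𝓝 (bb c0 (nF V0 c0))) :=
  (tendsto_const_nhds.sub ((tendsto_aa hV hc h0).norm.pow 2)).sqrt

lemma tendsto_gg (hV : Tendsto V l (𝓝 V0)) (hc : Tendsto c l (𝓝 c0))
    (h0 : 0 < nF V0 c0 + ‖c0‖) :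
    Tendsto (fun x => gg (c x) (nF (V x) (c x))) l (𝓝 (gg c0 (nF V0 c0))) :=
  tendsto_qp (tendsto_aa hV hc h0) (tendsto_of (tendsto_bb hV hc h0))

lemma Kf_zero : Kf 0 0 = 0 := by
  simp [Kf, KK, rot_zero]

lemma Kf_bound (V : ℂ × ℝ) (c : ℂ) : ‖vec (Kf V c)‖ ≤ ‖vec V‖ + 2 * ‖c‖ := by
  have h := KK_bound (gg_KH c (nF V c)) (V := V) rfl
  rw [norm_star] at h
  have := nF_le V c
  unfold Kf
  linarith

lemma tendsto_Kf (hV : Tendsto V l (𝓝 V0)) (hc : Tendsto c l (𝓝 c0)) :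
    Tendsto (fun x => Kf (V x) (c x)) l (𝓝 (Kf V0 c0)) := by
  by_cases h0 : 0 < nF V0 c0 + ‖c0‖
  · have hn := tendsto_nF hV hc
    have hY := tendsto_rot hV (tendsto_gg hV hc h0)
    have hn0 := nF_nonneg V0 c0
    have hcond : Tendsto (fun x => 3 * ‖c x‖ - nF (V x) (c x)) l (𝓝 (3 * ‖c0‖ - nF V0 c0)) :=
      (hc.norm.const_mul 3).sub hn
    rcases lt_or_ge (nF V0 c0) (3 * ‖c0‖) with h | h
    · have e : Kf V0 c0 = rot (gg c0 (nF V0 c0)) V0 := by rw [Kf, KK, if_pos (by linarith)]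
      rw [e]
      refine hY.congr' ?_
      filter_upwards [hcond.eventually_const_lt (by linarith : 0 < 3 * ‖c0‖ - nF V0 c0)] with x hx
      rw [Kf, KK, if_pos hx]
    · have hL := nF_le V0 c0
      have hn1 : 0 < nF V0 c0 := by
        rcases hn0.eq_or_lt with h1 | h1
        · rw [← h1] at h h0; linarith
        · exact h1
      have hL1 := nF_ge V0 c0
      have hc0 := norm_nonneg c0
      have hL0 : ‖vec (rot (gg c0 (nF V0 c0)) V0)‖ ≠ 0 := by
        rw [norm_vec_rot _ (gg_norm _ _)]; linarith
      have hYi := (tendsto_vec hY).norm.inv₀ hL0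
      have hsq := tendsto_sqc (tendsto_p1 hY)
      have hk := tendsto_kap hc
      have he : Tendsto (fun x => eps (kap (c x)) (rot (gg (c x) (nF (V x) (c x))) (V x))) l
          (𝓝 (eps (kap c0) (rot (gg c0 (nF V0 c0)) V0))) :=
        (((tendsto_cre hk).mul (tendsto_cre hsq)).add ((tendsto_cim hk).mul (tendsto_cim hsq))).mul
          hYi
      have hρ : Tendsto (fun x => rho (nF (V x) (c x)) ‖c x‖
          (eps (kap (c x)) (rot (gg (c x) (nF (V x) (c x))) (V x)))) l
          (𝓝 (rho (nF V0 c0) ‖c0‖ (eps (kap c0) (rot (gg c0 (nF V0 c0)) V0)))) :=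
        he.neg.add (((he.pow 2).add (hn.pow 2)).sub (hc.norm.pow 2)).sqrt
      have hI := (hρ.mul hYi).smul hY
      have e : Kf V0 c0 = (rho (nF V0 c0) ‖c0‖ (eps (kap c0) (rot (gg c0 (nF V0 c0)) V0)) *
          ‖vec (rot (gg c0 (nF V0 c0)) V0)‖⁻¹) • rot (gg c0 (nF V0 c0)) V0 := by
        rw [Kf, KK, if_neg (by linarith)]
      rw [e]
      rcases h.eq_or_lt with h2 | h2
      · have hgl := KK_glue (gg_KH c0 (nF V0 c0)) (V := V0) rfl (by rw [norm_star]; exact h2.symm) hn1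
        rw [norm_star] at hgl
        unfold Kf KK
        refine Filter.Tendsto.if' ?_ hI
        rw [hgl]; exact hY
      · refine hI.congr' ?_
        filter_upwards [hcond.eventually_lt_const (by linarith : 3 * ‖c0‖ - nF V0 c0 < 0)] with x hx
        rw [Kf, KK, if_neg (by linarith)]
  · have hn0 := nF_nonneg V0 c0
    have h1 : ‖c0‖ = 0 := by linarith [norm_nonneg c0]
    have h2 : ‖vec V0‖ = 0 := by linarith [norm_nonneg (vec V0), nF_ge V0 c0, norm_nonneg c0]
    have h3 : V0 = 0 := by simpa using h2
    have h4 : c0 = 0 := by simpa using h1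
    subst h3 h4
    rw [Kf_zero]
    have hb : Tendsto (fun x => ‖vec (V x)‖ + 2 * ‖c x‖) l (𝓝 0) := by
      simpa using (tendsto_vec hV).norm.add (hc.norm.const_mul 2)
    have h5 : Tendsto (fun x => vec (Kf (V x) (c x))) l (𝓝 0) :=
      squeeze_zero_norm (fun x => Kf_bound (V x) (c x)) hb
    have := tendsto_unv h5
    simp only [unv_vec] at this
    rwa [← vec_zero, unv_vec] at this

lemma tendsto_Fp (hV : Tendsto V l (𝓝 V0)) (hc : Tendsto c l (𝓝 c0)) :
    Tendsto (fun x => Fp (V x) (c x)) l (𝓝 (Fp V0 c0)) :=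
  tendsto_vec (tendsto_b0 (tendsto_Kf hV hc) (tendsto_kap hc))

lemma tendsto_Ss (hV : Tendsto V l (𝓝 V0)) (hc : Tendsto c l (𝓝 c0))
    (h0 : 0 < nF V0 c0 + ‖c0‖) : Tendsto (fun x => Ss (V x) (c x)) l (𝓝 (Ss V0 c0)) := by
  have ha := tendsto_aa hV hc h0
  have hb := tendsto_of (tendsto_bb hV hc h0)
  have hm := tendsto_p1 hV
  have hs := tendsto_p2 hV
  have hR := (tendsto_vec hV).norm.max hc.norm
  have hp := tendsto_of (hR.add hs)
  have hq := tendsto_of (hR.sub hs)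
  exact tendsto_qp ((tendsto_sqc ((ha.mul hp).sub (hb.mul hm.star))).add
    (tendsto_sqc ((ha.mul hq).add (hb.mul hm.star))))
    ((tendsto_sqc ((ha.mul hm).add (hb.mul hp))).sub (tendsto_sqc ((ha.mul hm).sub (hb.mul hq))))

lemma tendsto_Wp (hV : Tendsto V l (𝓝 V0)) (hc : Tendsto c l (𝓝 c0))
    (h0 : 0 < nF V0 c0 + ‖c0‖) : Tendsto (fun x => Wp (V x) (c x)) l (𝓝 (Wp V0 c0)) := by
  have hS := tendsto_Ss hV hc h0
  have hn := tendsto_nF hV hc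
  have h1 : Tendsto (fun x => nF (V x) (c x) ^ 2 + max (3 * ‖c x‖ - nF (V x) (c x)) 0) l
      (𝓝 (nF V0 c0 ^ 2 + max (3 * ‖c0‖ - nF V0 c0) 0)) :=
    (hn.pow 2).add (((hc.norm.const_mul 3).sub hn).max tendsto_const_nhds)
  exact (h1.smul hS).sub (((tendsto_Fp hV hc).mul hS).mul (tendsto_Fm hV hc))

lemma tendsto_nu {f : X → Qt} {f0 : Qt} (hf : Tendsto f l (𝓝 f0)) (h0 : f0 ≠ 0) :
    Tendsto (fun x => nu (f x)) l (𝓝 (nu f0)) := by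
  have h1 : 0 < ‖f0‖ := norm_pos_iff.mpr h0
  have h2 := (hf.norm.inv₀ h1.ne').smul hf
  rw [nu, if_pos h1]
  refine h2.congr' ?_
  filter_upwards [hf.norm.eventually_const_lt h1] with x hx
  rw [nu, if_pos hx]

/-- the parameter -/
def phi (M n : ℝ) : ℝ := max (2 - M * n⁻¹) 0
def V2 (f : ℝ) (V : ℂ × ℝ) : ℂ × ℝ := (f • V.1, V.2)
def c2 (f : ℝ) (V : ℂ × ℝ) (c : ℂ) : ℂ := c + (1 - f) • star (sqc V.1)

lemma b0_V2 {f : ℝ} (hf : 0 ≤ f) (V : ℂ × ℝ) (c : ℂ) :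
    b0 (V2 f V) (star (c2 f V c)) = b0 V (star c) := by
  refine Prod.ext ?_ rfl
  simp only [b0, V2, c2, sqc_smul hf]
  simp; ring

lemma nF_V2 {f : ℝ} (hf : 0 ≤ f) (V : ℂ × ℝ) (c : ℂ) : nF (V2 f V) (c2 f V c) = nF V c := by
  rw [nF, b0_V2 hf]; rfl

def Sg0 (V : ℂ × ℝ) (c : ℂ) (r : ℝ) : Qt :=
  min (2 * nF V c) (max r (nF V c)) • nu (Wp (V2 (phi (max r (nF V c)) (nF V c)) V)
    (c2 (phi (max r (nF V c)) (nF V c)) V c)) +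
  (max r (nF V c) - min (2 * nF V c) (max r (nF V c))) • kq

def Sig (V : ℂ × ℝ) (c : ℂ) (r : ℝ) : Qt := nu (Sg0 V c r)

lemma Sig_norm (V : ℂ × ℝ) (c : ℂ) (r : ℝ) : ‖Sig V c r‖ = 1 := nu_norm _

lemma Sg0_ne {V : ℂ × ℝ} {c : ℂ} {r : ℝ} (h : 0 < max r (nF V c)) : Sg0 V c r ≠ 0 := by
  have hn := nF_nonneg V c
  unfold Sg0
  intro h0
  set M := max r (nF V c) with hM
  set n := nF V c with hnn
  have hMn : n ≤ M := le_max_right _ _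
  have hφ : 0 ≤ phi M n := le_max_right _ _
  set w := Wp (V2 (phi M n) V) (c2 (phi M n) V c) with hw
  have hA : 0 ≤ min (2 * n) M := le_min (by linarith) (by linarith)
  have hAM : min (2 * n) M ≤ M := min_le_right _ _
  have h1 : min (2 * n) M • nu w = -((M - min (2 * n) M) • kq) := eq_neg_of_add_eq_zero_left h0
  have h2 := congrArg norm h1
  rw [norm_neg, norm_smul, norm_smul, nu_norm, kq_norm, Real.norm_eq_abs, Real.norm_eq_abs,
    abs_of_nonneg hA, abs_of_nonneg (by linarith), mul_one, mul_one] at h2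
  have h3 : 2 * n < M := by
    by_contra h4
    rw [min_eq_right (by linarith)] at h2; linarith
  rw [min_eq_left h3.le] at h1 h2
  have hn0 : 0 < n := by linarith
  have hφ0 : phi M n = 0 := by
    unfold phi
    apply max_eq_right
    have : 2 ≤ M * n⁻¹ := by
      rw [← div_eq_mul_inv, le_div_iff₀ hn0]; linarith
    linarith
  have h5 : nu w = -kq := by
    have : (2 * n) • nu w = (2 * n) • (-kq) := by rw [h1, ← h2, smul_neg]
    exact smul_right_injective Qt (by linarith : (2 * n) ≠ 0) this
  have hwne : w ≠ 0 := by
    apply W_ne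
    rw [nF_V2 hφ]
    have := norm_nonneg (c2 (phi M n) V c)
    linarith
  have h6 := nu_smul w hwne
  rw [h5, smul_neg] at h6
  have := W_k (by rw [hφ0]; simp [V2]) h6
  exact hwne (norm_eq_zero.mp this)

lemma Sig_inter {V : ℂ × ℝ} {c : ℂ} {r : ℝ} (h : r ≤ nF V c) :
    Sig V c r * Fm V c = Fp V c * Sig V c r := by
  rcases (nF_nonneg V c).eq_or_lt with hn | hn
  · have h1 : Fm V c = 0 := by rw [← norm_eq_zero, Fm_norm, hn]
    have h2 : Fp V c = 0 := by rw [← norm_eq_zero, Fp_norm, hn]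
    rw [h1, h2, mul_zero, zero_mul]
  · have hφ : phi (nF V c) (nF V c) = 1 := by
      rw [phi, mul_inv_cancel₀ hn.ne']; norm_num
    have hV : V2 1 V = V := by simp [V2]
    have hc : c2 1 V c = c := by simp [c2]
    have hS : Sig V c r = nu (Wp V c) := by
      apply nu_of hn (nu_norm _)
      rw [Sg0, max_eq_right h, hφ, hV, hc, min_eq_right (by linarith)]
      simp
    have hne : Wp V c ≠ 0 := W_ne (by linarith [norm_nonneg c])
    have h1 := W_inter V c
    rw [nu_smul _ hne, smul_mul_assoc, mul_smul_comm] at h1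
    rw [hS]
    exact smul_right_injective Qt (norm_ne_zero_iff.mpr hne) h1

lemma tendsto_Sig {r : X → ℝ} {r0 : ℝ} (hV : Tendsto V l (𝓝 V0)) (hc : Tendsto c l (𝓝 c0))
    (hr : Tendsto r l (𝓝 r0)) (h0 : 0 < max r0 (nF V0 c0)) :
    Tendsto (fun x => Sig (V x) (c x) (r x)) l (𝓝 (Sig V0 c0 r0)) := by
  refine tendsto_nu ?_ (Sg0_ne h0)
  have hn := tendsto_nF hV hc
  have hM := hr.max hn
  have hA := (hn.const_mul 2).min hM
  refine Tendsto.add ?_ ((hM.sub hA).smul tendsto_const_nhds)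
  rcases (nF_nonneg V0 c0).eq_or_lt with h | h
  · rw [← h, mul_zero, min_eq_left (le_max_right _ _), zero_smul]
    rw [← h, mul_zero, min_eq_left (le_max_right _ _)] at hA
    refine squeeze_zero_norm (fun x => le_of_eq ?_) (by simpa using hA.norm)
    rw [norm_smul, nu_norm, mul_one, Real.norm_eq_abs]
  · have hφ : Tendsto (fun x => phi (max (r x) (nF (V x) (c x))) (nF (V x) (c x))) l
        (𝓝 (phi (max r0 (nF V0 c0)) (nF V0 c0))) :=
      (tendsto_const_nhds.sub (hM.mul (hn.inv₀ h.ne'))).max tendsto_const_nhds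
    have hφ0 : 0 ≤ phi (max r0 (nF V0 c0)) (nF V0 c0) := le_max_right _ _
    have hpos : 0 < nF (V2 (phi (max r0 (nF V0 c0)) (nF V0 c0)) V0)
        (c2 (phi (max r0 (nF V0 c0)) (nF V0 c0)) V0 c0) +
        ‖c2 (phi (max r0 (nF V0 c0)) (nF V0 c0)) V0 c0‖ := by
      rw [nF_V2 hφ0]
      linarith [norm_nonneg (c2 (phi (max r0 (nF V0 c0)) (nF V0 c0)) V0 c0)]
    refine hA.smul (tendsto_nu (tendsto_Wp ?_ ?_ hpos) (W_ne hpos))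
    · exact (hφ.smul (tendsto_p1 hV)).prodMk_nhds (tendsto_p2 hV)
    · exact hc.add ((tendsto_const_nhds.sub hφ).smul (tendsto_sqc (tendsto_p1 hV)).star)

end Cont

section Omega

def imq (h : Qt) : Qt := qmk 0 h.imI h.imJ h.imK
def req (h : Qt) : Qt := qmk h.re 0 0 0
def qq (t : ℝ) (h : Qt) : ℝ := √(t ^ 2 + h.re ^ 2)
def Ph (V : ℂ × ℝ) (c : ℂ) (h : Qt) : Qt := Fm V c + imq h
def Sg1 (V : ℂ × ℝ) (c : ℂ) (h : Qt) : Qt := Sig V c ‖Ph V c h‖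
def Sg2 (V : ℂ × ℝ) (c : ℂ) (t : ℝ) (h : Qt) : Qt := Sig V c (‖Ph V c h‖ + qq t h)
def hN (V : ℂ × ℝ) (c : ℂ) (h : Qt) : Qt :=
  req h + (Sg1 V c h * Ph V c h * star (Sg1 V c h) - Fp V c)

lemma req_imq (h : Qt) : req h + imq h = h := by ext <;> simp [req, imq]
lemma Ph_re (V : ℂ × ℝ) (c : ℂ) (h : Qt) : (Ph V c h).re = 0 := by simp [Ph, Fm, imq]
lemma Fp_re (V : ℂ × ℝ) (c : ℂ) : (Fp V c).re = 0 := vec_re _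
lemma Fm_re (V : ℂ × ℝ) (c : ℂ) : (Fm V c).re = 0 := vec_re _

lemma hN_re (V : ℂ × ℝ) (c : ℂ) (h : Qt) : (hN V c h).re = h.re := by
  have := conj_re (Sg1 V c h) _ (Ph_re V c h)
  rw [hN, Quaternion.re_add, Quaternion.re_sub, this, Fp_re]
  simp [req]

lemma imq_of {h x : Qt} (hx : x.re = 0) : imq (req h + x) = x := by
  ext <;> simp [imq, req, hx]

lemma hN_im (V : ℂ × ℝ) (c : ℂ) (h : Qt) :
    Fp V c + imq (hN V c h) = Sg1 V c h * Ph V c h * star (Sg1 V c h) := by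
  rw [hN, imq_of]
  · abel
  · rw [Quaternion.re_sub, conj_re _ _ (Ph_re V c h), Fp_re, sub_zero]

lemma qq_nonneg (t : ℝ) (h : Qt) : 0 ≤ qq t h := Real.sqrt_nonneg _

lemma qq_zero {h : Qt} (hr : h.re = 0) : qq 0 h = 0 := by simp [qq, hr]

lemma Sg1_norm (V : ℂ × ℝ) (c : ℂ) (h : Qt) : ‖Sg1 V c h‖ = 1 := Sig_norm _ _ _
lemma Sg2_norm (V : ℂ × ℝ) (c : ℂ) (t : ℝ) (h : Qt) : ‖Sg2 V c t h‖ = 1 := Sig_norm _ _ _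

lemma conj_unit_eq_zero {s h : Qt} (hs : ‖s‖ = 1) : s * h * star s = 0 ↔ h = 0 := by
  rw [← norm_eq_zero, norm_conj _ _ hs, norm_eq_zero]

lemma conj_inter {V : ℂ × ℝ} {c : ℂ} {r : ℝ} (h : r ≤ nF V c) :
    Sig V c r * Fm V c * star (Sig V c r) = Fp V c := by
  rw [Sig_inter h, mul_assoc, qms _ (Sig_norm _ _ _), mul_one]

lemma hN_inner {V : ℂ × ℝ} {c : ℂ} {h : Qt} (hr : h.re = 0) (hn : ‖Ph V c h‖ ≤ nF V c) :
    hN V c h = Sg1 V c h * h * star (Sg1 V c h) := by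
  have h1 : Sg1 V c h * Fm V c * star (Sg1 V c h) = Fp V c := conj_inter hn
  have h2 : req h = 0 := by ext <;> simp [req, hr] <;> rfl
  have h3 : h = Ph V c h - Fm V c := by
    rw [Ph]; conv_lhs => rw [← req_imq h, h2]
    abel
  rw [hN, h2, zero_add, ← h1, ← sub_mul, ← mul_sub, ← h3]

lemma OO_good (V : ℂ × ℝ) (c : ℂ) (t : ℝ) (h : Qt) :
    Good t (Sg2 V c t h * h * star (Sg2 V c t h)) t (hN V c h) := by
  have hs2 := Sg2_norm V c t h
  have hs1 := Sg1_norm V c h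
  have hre2 : (Sg2 V c t h * h * star (Sg2 V c t h)).re = h.re := by
    have := qnorm_sq (Sg2 V c t h)
    rw [hs2] at this
    simp; linear_combination (-h.re) * this
  apply good_of
  · rw [conj_unit_eq_zero hs2]
    constructor
    · rintro ⟨h1, h2⟩
      refine ⟨h1, ?_⟩
      have h3 : h.re = 0 := by rw [← hN_re V c h, h2]; rfl
      have h4 := hN_im V c h
      have h5 : imq (0 : Qt) = 0 := by ext <;> simp [imq] <;> rfl
      rw [h2, h5, add_zero] at h4
      have h6 : ‖Ph V c h‖ = nF V c := by
        rw [← Fp_norm, h4, norm_conj _ _ hs1]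
      rw [hN_inner h3 h6.le, conj_unit_eq_zero hs1] at h2
      exact h2
    · rintro ⟨h1, rfl⟩
      refine ⟨h1, ?_⟩
      have h5 : imq (0 : Qt) = 0 := by ext <;> simp [imq] <;> rfl
      rw [hN_inner rfl (by rw [Ph, h5, add_zero]; exact le_rfl)]
      simp
  · intro l hl h1 h2
    have h1' : t = 0 := by nlinarith
    have h3 : h.re = 0 := by
      have := congrArg (fun x : Qt => x.re) h2
      simp only [hN_re, Quaternion.re_neg, Quaternion.re_smul, hre2, smul_eq_mul] at this
      nlinarith
    refine ⟨h1', ?_⟩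
    subst h1'
    have hS : Sg2 V c 0 h = Sg1 V c h := by rw [Sg2, qq_zero h3, add_zero, Sg1]
    rw [hS] at h2 ⊢
    rcases le_or_gt ‖Ph V c h‖ (nF V c) with hn | hn
    · rw [hN_inner h3 hn] at h2
      have : (1 + l) • (Sg1 V c h * h * star (Sg1 V c h)) = 0 := by
        rw [add_smul, one_smul]; nth_rewrite 1 [h2]; simp
      exact (smul_eq_zero.mp this).resolve_left (by linarith)
    · exfalso
      have h4 : req h = 0 := by ext <;> simp [req, h3] <;> rfl
      have h5 : h = Ph V c h - Fm V c := by
        rw [Ph]; conv_lhs => rw [← req_imq h, h4]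
        abel
      have h6 : Sg1 V c h * h * star (Sg1 V c h) = Sg1 V c h * Ph V c h * star (Sg1 V c h) -
          Sg1 V c h * Fm V c * star (Sg1 V c h) := by
        rw [← sub_mul, ← mul_sub, ← h5]
      rw [h6, hN, h4, zero_add] at h2
      have n1 := norm_conj (Sg1 V c h) (Ph V c h) hs1
      have n2 := norm_conj (Sg1 V c h) (Fm V c) hs1
      have n3 := Fp_norm V c
      rw [Fm_norm] at n2
      generalize Sg1 V c h * Ph V c h * star (Sg1 V c h) = P at *
      generalize Sg1 V c h * Fm V c * star (Sg1 V c h) = Q at *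
      have h7 : (1 + l) • P = Fp V c + l • Q := by
        rw [add_smul, one_smul]
        rw [smul_sub, neg_sub, sub_eq_iff_eq_add] at h2
        nth_rewrite 1 [h2]; abel
      have h8 := congrArg norm h7
      have h9 := norm_add_le (Fp V c) (l • Q)
      rw [← h8, norm_smul, norm_smul, n1, n2, n3, Real.norm_eq_abs, Real.norm_eq_abs,
        abs_of_pos hl, abs_of_pos (by linarith)] at h9
      nlinarith

abbrev OS := (ℂ × ℝ) × ℂ × Qt × Qt

def OO (p : OS) : OS :=
  let V := p.1
  let c := p.2.1
  let t := hpT p.2.2.1 p.2.2.2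
  let h := hpH p.2.2.1 p.2.2.2
  let s := star (Sg2 V c t h)
  (Kf V c, c, lift (p.2.2.1 * s) (p.2.2.2 * s) t (hN V c h))

def Ki (W : ℂ × ℝ) (c : ℂ) : ℂ × ℝ :=
  KK (star (gg c ‖vec (b0 W (kap c))‖)) ‖vec (b0 W (kap c))‖ ‖c‖ (star c) W

def hI (V W : ℂ × ℝ) (c : ℂ) (h : Qt) : Qt :=
  let P := vec (b0 W (kap c)) + imq h
  let s := Sig V c ‖P‖
  req h + (star s * P * s - Fm V c)

def sI (V W : ℂ × ℝ) (c : ℂ) (t : ℝ) (h : Qt) : Qt :=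
  Sig V c (‖vec (b0 W (kap c)) + imq h‖ + qq t h)

def OI (p : OS) : OS :=
  let W := p.1
  let c := p.2.1
  let t := hpT p.2.2.1 p.2.2.2
  let h := hpH p.2.2.1 p.2.2.2
  let V := Ki W c
  let s := sI V W c t h
  let ab := lift p.2.2.1 p.2.2.2 t (s * hI V W c h * star s)
  (V, c, ab.1 * s, ab.2 * s)

lemma Ki_level (W : ℂ × ℝ) (c : ℂ) : nF (Ki W c) c = ‖vec (b0 W (kap c))‖ := by
  have := KK_level (gg_KH c ‖vec (b0 W (kap c))‖).symm (V := W) rfl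
  rwa [norm_kap] at this

lemma Ki_Kf (V : ℂ × ℝ) (c : ℂ) : Ki (Kf V c) c = V := by
  have := KK_inv (gg_KH c (nF V c)) (V := V) rfl
  rw [norm_star] at this
  rw [Ki, Kf_level]
  exact this

lemma Kf_Ki (W : ℂ × ℝ) (c : ℂ) : Kf (Ki W c) c = W := by
  have := KK_inv (gg_KH c ‖vec (b0 W (kap c))‖).symm (V := W) rfl
  rw [norm_kap, star_star] at this
  rw [Kf, Ki_level]
  exact this

lemma Ki_bound (W : ℂ × ℝ) (c : ℂ) : ‖vec (Ki W c)‖ ≤ ‖vec W‖ + 2 * ‖c‖ := by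
  have h := KK_bound (gg_KH c ‖vec (b0 W (kap c))‖).symm (V := W) rfl
  rw [norm_kap] at h
  have := b0_le W (kap c)
  rw [norm_kap] at this
  unfold Ki
  linarith

lemma cancel1 {s x : Qt} (hs : ‖s‖ = 1) : star s * (s * x * star s) * s = x := by
  calc _ = (star s * s) * x * (star s * s) := by simp only [mul_assoc]
    _ = x := by rw [qsm _ hs, one_mul, mul_one]

lemma cancel2 {s x : Qt} (hs : ‖s‖ = 1) : s * (star s * x * s) * star s = x := by
  calc _ = (s * star s) * x * (s * star s) := by simp only [mul_assoc]
    _ = x := by rw [qms _ hs, one_mul, mul_one]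

lemma hI_hN (V : ℂ × ℝ) (c : ℂ) (h : Qt) : hI V (Kf V c) c (hN V c h) = h := by
  have h1 : vec (b0 (Kf V c) (kap c)) + imq (hN V c h) = _ := hN_im V c h
  have h2 : req (hN V c h) = req h := by rw [req, hN_re, req]
  have hs := Sg1_norm V c h
  rw [hI, h1, norm_conj _ _ hs, h2]
  change req h + (star (Sg1 V c h) * _ * Sg1 V c h - _) = _
  rw [cancel1 hs, Ph]
  conv_rhs => rw [← req_imq h]
  abel

lemma hI_norm (V W : ℂ × ℝ) (c : ℂ) (h : Qt) :
    Ph V c (hI V W c h) = star (Sig V c ‖vec (b0 W (kap c)) + imq h‖) *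
      (vec (b0 W (kap c)) + imq h) * Sig V c ‖vec (b0 W (kap c)) + imq h‖ := by
  rw [Ph, hI, imq_of]
  · abel
  · rw [Quaternion.re_sub, Fm_re, sub_zero]
    have := conj_re (star (Sig V c ‖vec (b0 W (kap c)) + imq h‖)) (vec (b0 W (kap c)) + imq h)
      (by simp [imq])
    rwa [star_star] at this

lemma hI_re (V W : ℂ × ℝ) (c : ℂ) (h : Qt) : (hI V W c h).re = h.re := by
  have h1 := Ph_re V c (hI V W c h)
  rw [hI_norm] at h1
  rw [hI, Quaternion.re_add, Quaternion.re_sub, Fm_re, h1]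
  simp [req]

lemma hN_hI (V : ℂ × ℝ) (c : ℂ) (h : Qt) : hN V c (hI V (Kf V c) c h) = h := by
  have h1 := hI_norm V (Kf V c) c h
  have hs := Sig_norm V c ‖vec (b0 (Kf V c) (kap c)) + imq h‖
  have hn : ‖Ph V c (hI V (Kf V c) c h)‖ = ‖vec (b0 (Kf V c) (kap c)) + imq h‖ := by
    rw [h1, norm_mul, norm_mul, norm_star, hs]; simp
  have hS : Sg1 V c (hI V (Kf V c) c h) = Sig V c ‖vec (b0 (Kf V c) (kap c)) + imq h‖ := by
    rw [Sg1, hn]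
  have h2 : req (hI V (Kf V c) c h) = req h := by rw [req, hI_re, req]
  rw [hN, hS, h1, cancel2 hs, h2]
  conv_rhs => rw [← req_imq h]
  rw [Fp]; abel

lemma sI_eq (V : ℂ × ℝ) (c : ℂ) (t : ℝ) (h : Qt) : sI V (Kf V c) c t (hN V c h) = Sg2 V c t h := by
  have h1 : vec (b0 (Kf V c) (kap c)) + imq (hN V c h) = _ := hN_im V c h
  rw [sI, h1, norm_conj _ _ (Sg1_norm V c h), qq, hN_re, Sg2, qq]

lemma hpTS {s : Qt} (hs : ‖s‖ = 1) (a b : Qt) : hpT (a * star s) (b * star s) = hpT a b :=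
  hpT_mul (by rw [norm_star, hs]) a b

lemma hpHS (s a b : Qt) : hpH (a * star s) (b * star s) = s * hpH a b * star s := by
  rw [hpH_mul, star_star]

lemma OO_hop (p : OS) : hpT (OO p).2.2.1 (OO p).2.2.2 = hpT p.2.2.1 p.2.2.2 ∧
    hpH (OO p).2.2.1 (OO p).2.2.2 = hN p.1 p.2.1 (hpH p.2.2.1 p.2.2.2) := by
  have hs := Sg2_norm p.1 p.2.1 (hpT p.2.2.1 p.2.2.2) (hpH p.2.2.1 p.2.2.2)
  apply hop_lift
  rw [hpTS hs, hpHS]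
  exact OO_good _ _ _ _

lemma OI_OO (p : OS) : OI (OO p) = p := by
  have hs := Sg2_norm p.1 p.2.1 (hpT p.2.2.1 p.2.2.2) (hpH p.2.2.1 p.2.2.2)
  obtain ⟨h1, h2⟩ := OO_hop p
  have hL := lift_lift (a := p.2.2.1 * star (Sg2 p.1 p.2.1 (hpT p.2.2.1 p.2.2.2) (hpH p.2.2.1 p.2.2.2)))
    (b := p.2.2.2 * star (Sg2 p.1 p.2.1 (hpT p.2.2.1 p.2.2.2) (hpH p.2.2.1 p.2.2.2)))
    (t' := hpT p.2.2.1 p.2.2.2) (h' := hN p.1 p.2.1 (hpH p.2.2.1 p.2.2.2))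
    (by rw [hpTS hs, hpHS]; exact OO_good _ _ _ _)
  rw [hpTS hs, hpHS] at hL
  have e1 : (OO p).1 = Kf p.1 p.2.1 := rfl
  have e2 : (OO p).2.1 = p.2.1 := rfl
  unfold OI
  simp only [h1, h2, e1, e2, Ki_Kf, sI_eq, hI_hN]
  have e3 : lift (OO p).2.2.1 (OO p).2.2.2 = lift (lift (p.2.2.1 * star (Sg2 p.1 p.2.1 (hpT p.2.2.1 p.2.2.2) (hpH p.2.2.1 p.2.2.2)))
    (p.2.2.2 * star (Sg2 p.1 p.2.1 (hpT p.2.2.1 p.2.2.2) (hpH p.2.2.1 p.2.2.2))) (hpT p.2.2.1 p.2.2.2) (hN p.1 p.2.1 (hpH p.2.2.1 p.2.2.2))).1 (lift (p.2.2.1 * star (Sg2 p.1 p.2.1 (hpT p.2.2.1 p.2.2.2) (hpH p.2.2.1 p.2.2.2)))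
    (p.2.2.2 * star (Sg2 p.1 p.2.1 (hpT p.2.2.1 p.2.2.2) (hpH p.2.2.1 p.2.2.2))) (hpT p.2.2.1 p.2.2.2) (hN p.1 p.2.1 (hpH p.2.2.1 p.2.2.2))).2 := rfl
  rw [e3, hL]
  simp only [mul_assoc, qsm _ hs, mul_one]

lemma OO_OI (p : OS) : OO (OI p) = p := by
  obtain ⟨W, c, a, b⟩ := p
  obtain ⟨V, rfl⟩ : ∃ V, W = Kf V c := ⟨Ki W c, (Kf_Ki W c).symm⟩
  obtain ⟨h, hh⟩ : ∃ h, hpH a b = hN V c h := ⟨hI V (Kf V c) c (hpH a b), (hN_hI V c _).symm⟩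
  have hs := Sg2_norm V c (hpT a b) h
  have hG := (OO_good V c (hpT a b) h).symm
  rw [← hh] at hG
  have hL := lift_lift hG
  obtain ⟨g1, g2⟩ := hop_lift hG
  have e : OI (Kf V c, c, a, b) = (V, c,
      (lift a b (hpT a b) (Sg2 V c (hpT a b) h * h * star (Sg2 V c (hpT a b) h))).1 * Sg2 V c (hpT a b) h,
      (lift a b (hpT a b) (Sg2 V c (hpT a b) h * h * star (Sg2 V c (hpT a b) h))).2 * Sg2 V c (hpT a b) h) := by
    simp only [OI, hh, Ki_Kf, sI_eq, hI_hN]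
  rw [e]
  generalize lift a b (hpT a b) (Sg2 V c (hpT a b) h * h * star (Sg2 V c (hpT a b) h)) = ab at *
  have k1 : hpT (ab.1 * Sg2 V c (hpT a b) h) (ab.2 * Sg2 V c (hpT a b) h) = hpT a b := by
    rw [hpT_mul hs, g1]
  have k2 : hpH (ab.1 * Sg2 V c (hpT a b) h) (ab.2 * Sg2 V c (hpT a b) h) = h := by
    rw [hpH_mul, g2, cancel1 hs]
  simp only [OO, k1, k2]
  simp only [mul_assoc, qms _ hs, mul_one]
  rw [← hh, hL]

lemma OO_level (p : OS) :
    ‖vec (b0 (OO p).1 (kap (OO p).2.1)) + imq (hpH (OO p).2.2.1 (OO p).2.2.2)‖ =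
    ‖vec (b0 p.1 (star p.2.1)) + imq (hpH p.2.2.1 p.2.2.2)‖ := by
  rw [(OO_hop p).2]
  have := hN_im p.1 p.2.1 (hpH p.2.2.1 p.2.2.2)
  change ‖Fp p.1 p.2.1 + _‖ = ‖Ph p.1 p.2.1 _‖
  rw [this, norm_conj _ _ (Sg1_norm _ _ _)]

end Omega

lemma qq_le (t : ℝ) (h : Qt) (hq : qq t h = 0) : t = 0 ∧ h.re = 0 := by
  unfold qq at hq
  rw [Real.sqrt_eq_zero (by positivity)] at hq
  constructor <;> nlinarith [sq_nonneg t, sq_nonneg h.re]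

section
variable {X : Type*} {l : Filter X}
variable {V : X → ℂ × ℝ} {V0 : ℂ × ℝ} {c : X → ℂ} {c0 : ℂ} {h : X → Qt} {h0 : Qt}

lemma tendsto_imq (hh : Tendsto h l (𝓝 h0)) : Tendsto (fun x => imq (h x)) l (𝓝 (imq h0)) :=
  tendsto_qmk tendsto_const_nhds (tendsto_imI hh) (tendsto_imJ hh) (tendsto_imK hh)

lemma tendsto_req (hh : Tendsto h l (𝓝 h0)) : Tendsto (fun x => req (h x)) l (𝓝 (req h0)) :=
  tendsto_qmk (tendsto_re hh) tendsto_const_nhds tendsto_const_nhds tendsto_const_nhds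

lemma tendsto_qq {t : X → ℝ} {t0 : ℝ} (ht : Tendsto t l (𝓝 t0)) (hh : Tendsto h l (𝓝 h0)) :
    Tendsto (fun x => qq (t x) (h x)) l (𝓝 (qq t0 h0)) :=
  ((ht.pow 2).add ((tendsto_re hh).pow 2)).sqrt

lemma tendsto_Ph (hV : Tendsto V l (𝓝 V0)) (hc : Tendsto c l (𝓝 c0)) (hh : Tendsto h l (𝓝 h0)) :
    Tendsto (fun x => Ph (V x) (c x) (h x)) l (𝓝 (Ph V0 c0 h0)) :=
  (tendsto_Fm hV hc).add (tendsto_imq hh)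

lemma tendsto_hN (hV : Tendsto V l (𝓝 V0)) (hc : Tendsto c l (𝓝 c0)) (hh : Tendsto h l (𝓝 h0)) :
    Tendsto (fun x => hN (V x) (c x) (h x)) l (𝓝 (hN V0 c0 h0)) := by
  have hP := tendsto_Ph hV hc hh
  refine (tendsto_req hh).add (Tendsto.sub ?_ (tendsto_Fp hV hc))
  rcases eq_or_ne (Ph V0 c0 h0) 0 with h1 | h1
  · have e : Sg1 V0 c0 h0 * Ph V0 c0 h0 * star (Sg1 V0 c0 h0) = 0 := by rw [h1]; simp
    rw [e, tendsto_zero_iff_norm_tendsto_zero]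
    simp only [norm_conj _ _ (Sg1_norm _ _ _)]
    rw [h1] at hP
    exact tendsto_zero_iff_norm_tendsto_zero.mp hP
  · have hS := tendsto_Sig hV hc hP.norm (lt_max_of_lt_left (norm_pos_iff.mpr h1))
    exact (hS.mul hP).mul hS.star

lemma tendsto_mulS {s a : X → Qt} {s0 : Qt} (hs : ∀ x, ‖s x‖ = 1) (ha : Tendsto a l (𝓝 0)) :
    Tendsto (fun x => a x * star (s x)) l (𝓝 (0 * star s0)) := by
  rw [zero_mul, tendsto_zero_iff_norm_tendsto_zero]
  simp only [norm_mul, norm_star, hs, mul_one]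
  exact tendsto_zero_iff_norm_tendsto_zero.mp ha

end

lemma OO_continuous : Continuous OO := by
  rw [continuous_iff_continuousAt]
  intro p0
  have hV : Tendsto (fun p : OS => p.1) (𝓝 p0) (𝓝 p0.1) := continuous_fst.tendsto p0
  have hc : Tendsto (fun p : OS => p.2.1) (𝓝 p0) (𝓝 p0.2.1) :=
    (continuous_fst.comp continuous_snd).tendsto p0
  have ha : Tendsto (fun p : OS => p.2.2.1) (𝓝 p0) (𝓝 p0.2.2.1) :=
    (continuous_fst.comp (continuous_snd.comp continuous_snd)).tendsto p0
  have hb : Tendsto (fun p : OS => p.2.2.2) (𝓝 p0) (𝓝 p0.2.2.2) :=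
    (continuous_snd.comp (continuous_snd.comp continuous_snd)).tendsto p0
  have ht := tendsto_hpT ha hb
  have hh := tendsto_hpH ha hb
  have hP := tendsto_Ph hV hc hh
  have hq := tendsto_qq ht hh
  refine (tendsto_Kf hV hc).prodMk_nhds (hc.prodMk_nhds ?_)
  have hs := Sg2_norm p0.1 p0.2.1 (hpT p0.2.2.1 p0.2.2.2) (hpH p0.2.2.1 p0.2.2.2)
  have key : Tendsto (fun p : OS => p.2.2.1 * star (Sg2 p.1 p.2.1 (hpT p.2.2.1 p.2.2.2) (hpH p.2.2.1 p.2.2.2))) (𝓝 p0)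
      (𝓝 (p0.2.2.1 * star (Sg2 p0.1 p0.2.1 (hpT p0.2.2.1 p0.2.2.2) (hpH p0.2.2.1 p0.2.2.2)))) ∧
      Tendsto (fun p : OS => p.2.2.2 * star (Sg2 p.1 p.2.1 (hpT p.2.2.1 p.2.2.2) (hpH p.2.2.1 p.2.2.2))) (𝓝 p0)
      (𝓝 (p0.2.2.2 * star (Sg2 p0.1 p0.2.1 (hpT p0.2.2.1 p0.2.2.2) (hpH p0.2.2.1 p0.2.2.2)))) := by
    rcases lt_or_ge 0 (max (‖Ph p0.1 p0.2.1 (hpH p0.2.2.1 p0.2.2.2)‖ + qq (hpT p0.2.2.1 p0.2.2.2) (hpH p0.2.2.1 p0.2.2.2))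
      (nF p0.1 p0.2.1)) with h1 | h1
    · have hS := tendsto_Sig hV hc (hP.norm.add hq) h1
      exact ⟨ha.mul hS.star, hb.mul hS.star⟩
    · have h2 := (le_max_left _ _).trans h1
      have h3 := (le_max_right _ _).trans h1
      have h4 := qq_nonneg (hpT p0.2.2.1 p0.2.2.2) (hpH p0.2.2.1 p0.2.2.2)
      have h5 := norm_nonneg (Ph p0.1 p0.2.1 (hpH p0.2.2.1 p0.2.2.2))
      obtain ⟨h6, h7⟩ := qq_le _ _ (le_antisymm (by linarith) h4)
      have h8 : Ph p0.1 p0.2.1 (hpH p0.2.2.1 p0.2.2.2) = 0 := norm_le_zero_iff.mp (by linarith)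
      have h9 : Fm p0.1 p0.2.1 = 0 := by rw [← norm_le_zero_iff, Fm_norm]; exact h3
      rw [Ph, h9, zero_add] at h8
      have h10 : hpH p0.2.2.1 p0.2.2.2 = 0 := by
        rw [← req_imq (hpH p0.2.2.1 p0.2.2.2), h8, add_zero]
        ext <;> simp [req, h7] <;> rfl
      obtain ⟨e1, e2⟩ := hop_zero_iff.mp ⟨h6, h10⟩
      constructor
      · have := tendsto_mulS (s0 := (Sg2 p0.1 p0.2.1 (hpT p0.2.2.1 p0.2.2.2) (hpH p0.2.2.1 p0.2.2.2)))
          (fun p : OS => Sg2_norm p.1 p.2.1 (hpT p.2.2.1 p.2.2.2) (hpH p.2.2.1 p.2.2.2)) (e1 ▸ ha)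
        nth_rewrite 1 [e1]; exact this
      · have := tendsto_mulS (s0 := (Sg2 p0.1 p0.2.1 (hpT p0.2.2.1 p0.2.2.2) (hpH p0.2.2.1 p0.2.2.2)))
          (fun p : OS => Sg2_norm p.1 p.2.1 (hpT p.2.2.1 p.2.2.2) (hpH p.2.2.1 p.2.2.2)) (e2 ▸ hb)
        nth_rewrite 1 [e2]; exact this
  refine lift_tendsto key.1 key.2 ht (tendsto_hN hV hc hh) ?_
  rw [hpTS hs, hpHS]
  exact OO_good _ _ _ _

lemma norm_le_vec (V : ℂ × ℝ) : ‖V‖ ≤ ‖vec V‖ := by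
  have h := norm_vec_sq V
  have h0 := norm_nonneg (vec V)
  rw [Prod.norm_def, max_le_iff, Real.norm_eq_abs]
  constructor
  · exact abs_le_of_sq_le_sq' (by nlinarith [sq_nonneg V.2]) h0 |>.2
  · exact abs_le_of_sq_le_sq (by nlinarith [sq_nonneg ‖V.1‖]) h0

lemma vec_le_norm (V : ℂ × ℝ) : ‖vec V‖ ≤ 2 * ‖V‖ := by
  have h := norm_vec_sq V
  have h1 : ‖V.1‖ ≤ ‖V‖ := norm_fst_le V
  have h2 : |V.2| ≤ ‖V‖ := norm_snd_le V
  have h3 : V.2 ^ 2 ≤ ‖V‖ ^ 2 := sq_le_sq' (by linarith [neg_abs_le V.2]) (by linarith [le_abs_self V.2])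
  exact abs_le_of_sq_le_sq' (by nlinarith [norm_nonneg V.1]) (by positivity) |>.2

lemma norm_imq (h : Qt) : ‖imq h‖ ≤ ‖h‖ := by
  refine abs_le_of_sq_le_sq' ?_ (norm_nonneg _) |>.2
  rw [qnorm_sq, qnorm_sq]; simp [imq]; positivity

lemma norm_req (h : Qt) : ‖req h‖ ≤ ‖h‖ := by
  refine abs_le_of_sq_le_sq' ?_ (norm_nonneg _) |>.2
  rw [qnorm_sq, qnorm_sq]; simp [req]; nlinarith [sq_nonneg h.imI, sq_nonneg h.imJ, sq_nonneg h.imK]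

lemma hI_le (V W : ℂ × ℝ) (c : ℂ) (h : Qt) :
    ‖hI V W c h‖ ≤ 2 * ‖h‖ + ‖vec (b0 W (kap c))‖ + nF V c := by
  have h1 := norm_req h
  have h2 := norm_imq h
  have hs := Sig_norm V c ‖vec (b0 W (kap c)) + imq h‖
  rw [hI]
  refine (norm_add_le _ _).trans ?_
  have h3 := norm_sub_le (star (Sig V c ‖vec (b0 W (kap c)) + imq h‖) * (vec (b0 W (kap c)) + imq h) *
    Sig V c ‖vec (b0 W (kap c)) + imq h‖) (Fm V c)
  rw [Fm_norm, norm_mul, norm_mul, norm_star, hs, one_mul, mul_one] at h3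
  have h4 := norm_add_le (vec (b0 W (kap c))) (imq h)
  linarith

lemma nn_le (t : ℝ) (h : Qt) : nn t h ≤ |t| + ‖h‖ := by
  refine abs_le_of_sq_le_sq' ?_ (by positivity) |>.2
  rw [nn_sq]
  nlinarith [sq_abs t, abs_nonneg t, norm_nonneg h]

lemma OI_continuous : Continuous OI := by
  refine cont_inv (h := OO) OI_OO OO_OI OO_continuous ?_
  intro R
  refine ⟨4 * R + (5 * R ^ 2 + 6 * R) + 1, ?_⟩
  rintro ⟨W, c, a, b⟩ hy
  have hW : ‖W‖ ≤ R := (norm_fst_le _).trans hy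
  have hy2 : ‖(c, a, b)‖ ≤ R := (norm_snd_le (W, c, a, b)).trans hy
  have hc : ‖c‖ ≤ R := (norm_fst_le _).trans hy2
  have hy3 : ‖(a, b)‖ ≤ R := (norm_snd_le (c, a, b)).trans hy2
  have ha : ‖a‖ ≤ R := (norm_fst_le _).trans hy3
  have hb : ‖b‖ ≤ R := (norm_snd_le (a, b)).trans hy3
  have hR : 0 ≤ R := (norm_nonneg _).trans ha
  have na := norm_nonneg a
  have nb := norm_nonneg b
  have hvW := vec_le_norm W
  have hn : ‖vec (b0 W (kap c))‖ ≤ 3 * R := by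
    have := b0_le W (kap c)
    rw [norm_kap] at this
    linarith
  have hV : ‖Ki W c‖ ≤ 4 * R := by
    have := Ki_bound W c
    have := norm_le_vec (Ki W c)
    linarith
  have ht : |hpT a b| ≤ R ^ 2 := by
    rw [hpT, abs_le]
    constructor <;> nlinarith
  have hh : ‖hpH a b‖ ≤ 2 * R ^ 2 := by
    rw [hpH, norm_smul, norm_mul, norm_star, Real.norm_ofNat]
    nlinarith
  have hhI := hI_le (Ki W c) W c (hpH a b)
  rw [Ki_level] at hhI
  have hs : ‖sI (Ki W c) W c (hpT a b) (hpH a b)‖ = 1 := Sig_norm _ _ _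
  set s := sI (Ki W c) W c (hpT a b) (hpH a b) with hsd
  have hB := nn_le (hpT a b) (s * hI (Ki W c) W c (hpH a b) * star s)
  rw [norm_conj _ _ hs] at hB
  have h1 := lift_bound1 a b (hpT a b) (s * hI (Ki W c) W c (hpH a b) * star s)
  have h2 := lift_bound2 a b (hpT a b) (s * hI (Ki W c) W c (hpH a b) * star s)
  have e : OI (W, c, a, b) = (Ki W c, c, (lift a b (hpT a b) (s * hI (Ki W c) W c (hpH a b) * star s)).1 * s,
    (lift a b (hpT a b) (s * hI (Ki W c) W c (hpH a b) * star s)).2 * s) := rfl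
  rw [e]
  generalize lift a b (hpT a b) (s * hI (Ki W c) W c (hpH a b) * star s) = L at *
  have q : 0 ≤ R ^ 2 := by positivity
  refine norm_prod_le_iff.mpr ⟨by change ‖Ki W c‖ ≤ _; linarith, norm_prod_le_iff.mpr ⟨by change ‖c‖ ≤ _; linarith, norm_prod_le_iff.mpr ⟨?_, ?_⟩⟩⟩
  · change ‖L.1 * s‖ ≤ _
    rw [norm_mul, hs, mul_one]
    nlinarith [norm_nonneg L.1]
  · change ‖L.2 * s‖ ≤ _
    rw [norm_mul, hs, mul_one]
    nlinarith [norm_nonneg L.2]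

section SAlg
variable {ι : Type}

lemma St.inv {f : (ι → ℝ) → ℝ} (hf : St f) : St (fun x => (f x)⁻¹) := hf.un un_inv
lemma St.div {f g : (ι → ℝ) → ℝ} (hf : St f) (hg : St g) : St (fun x => f x / g x) := by
  simpa only [div_eq_mul_inv] using hf.mul hg.inv
lemma St.sqrt {f : (ι → ℝ) → ℝ} (hf : St f) : St (fun x => √(f x)) := hf.un un_sqrt
lemma St.pow2 {f : (ι → ℝ) → ℝ} (hf : St f) : St (fun x => f x ^ 2) := by
  simpa only [sq] using hf.mul hf
lemma St.maxx {f g : (ι → ℝ) → ℝ} (hf : St f) (hg : St g) : St (fun x => max (f x) (g x)) := by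
  have := (hf.sub hg).ite hf hg
  convert this using 2 with x
  split_ifs with h
  · exact max_eq_left (by linarith)
  · exact max_eq_right (by linarith)
lemma St.minn {f g : (ι → ℝ) → ℝ} (hf : St f) (hg : St g) : St (fun x => min (f x) (g x)) := by
  have := (hf.sub hg).ite hg hf
  convert this using 2 with x
  split_ifs with h
  · exact min_eq_right (by linarith)
  · exact min_eq_left (by linarith)

/-- semialgebraic complex valued functions -/
structure SC (f : (ι → ℝ) → ℂ) : Prop where
  re : St (fun x => (f x).re)
  im : St (fun x => (f x).im)

/-- semialgebraic quaternion valued functions -/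
structure SQ (f : (ι → ℝ) → Qt) : Prop where
  re : St (fun x => (f x).re)
  imI : St (fun x => (f x).imI)
  imJ : St (fun x => (f x).imJ)
  imK : St (fun x => (f x).imK)

structure SV (f : (ι → ℝ) → ℂ × ℝ) : Prop where
  p1 : SC (fun x => (f x).1)
  p2 : St (fun x => (f x).2)

variable {f g : (ι → ℝ) → ℂ} {r s t : (ι → ℝ) → ℝ} {a b h k : (ι → ℝ) → Qt} {V W : (ι → ℝ) → ℂ × ℝ}

lemma SC.add (hf : SC f) (hg : SC g) : SC (fun x => f x + g x) := ⟨hf.re.add hg.re, hf.im.add hg.im⟩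
lemma SC.sub (hf : SC f) (hg : SC g) : SC (fun x => f x - g x) := ⟨hf.re.sub hg.re, hf.im.sub hg.im⟩
lemma SC.mul (hf : SC f) (hg : SC g) : SC (fun x => f x * g x) := by
  constructor
  · simpa only [Complex.mul_re] using (hf.re.mul hg.re).sub (hf.im.mul hg.im)
  · simpa only [Complex.mul_im] using (hf.re.mul hg.im).add (hf.im.mul hg.re)
lemma SC.star (hf : SC f) : SC (fun x => star (f x)) := ⟨hf.re, hf.im.neg⟩
lemma SC.of (hr : St r) : SC (fun x => (r x : ℂ)) := ⟨hr, St.const 0⟩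
lemma SC.mk2 (hr : St r) (hs : St s) : SC (fun x => (⟨r x, s x⟩ : ℂ)) := ⟨hr, hs⟩
lemma SC.const (c : ℂ) : SC (fun _ : ι → ℝ => c) := ⟨St.const _, St.const _⟩
lemma SC.rsmul (hr : St r) (hf : SC f) : SC (fun x => r x • f x) := by
  constructor
  · simpa only [Complex.smul_re, smul_eq_mul] using hr.mul hf.re
  · simpa only [Complex.smul_im, smul_eq_mul] using hr.mul hf.im
lemma SC.nrm (hf : SC f) : St (fun x => ‖f x‖) := by
  have := (hf.re.pow2.add hf.im.pow2).sqrt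
  simpa only [← cn_sq, Real.sqrt_sq (norm_nonneg _)] using this
lemma SC.pow2 (hf : SC f) : SC (fun x => f x ^ 2) := by simpa only [sq] using hf.mul hf
lemma SC.pow3 (hf : SC f) : SC (fun x => f x ^ 3) := by
  simpa only [pow_succ, pow_zero, one_mul] using (hf.mul hf).mul hf
lemma SC.sqc (hf : SC f) : SC (fun x => sqc (f x)) := by
  have := hf.pow2.mul (SC.of hf.nrm.inv)
  simpa only [RealMilnor.sqc, div_eq_mul_inv, Complex.ofReal_inv] using this
lemma SC.kap (hf : SC f) : SC (fun x => kap (f x)) := by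
  have := hf.pow3.mul (SC.of hf.nrm.pow2.inv)
  simpa only [RealMilnor.kap, div_eq_mul_inv, Complex.ofReal_inv, Complex.ofReal_pow] using this

lemma SQ.mk4 {u v w z : (ι → ℝ) → ℝ} (hu : St u) (hv : St v) (hw : St w) (hz : St z) :
    SQ (fun x => qmk (u x) (v x) (w x) (z x)) := ⟨hu, hv, hw, hz⟩
lemma SQ.add (ha : SQ a) (hb : SQ b) : SQ (fun x => a x + b x) :=
  ⟨ha.re.add hb.re, ha.imI.add hb.imI, ha.imJ.add hb.imJ, ha.imK.add hb.imK⟩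
lemma SQ.sub (ha : SQ a) (hb : SQ b) : SQ (fun x => a x - b x) :=
  ⟨ha.re.sub hb.re, ha.imI.sub hb.imI, ha.imJ.sub hb.imJ, ha.imK.sub hb.imK⟩
lemma SQ.star (ha : SQ a) : SQ (fun x => star (a x)) := by
  constructor
  · simpa only [Quaternion.re_star] using ha.re
  · simpa only [Quaternion.imI_star] using ha.imI.neg
  · simpa only [Quaternion.imJ_star] using ha.imJ.neg
  · simpa only [Quaternion.imK_star] using ha.imK.neg
lemma SQ.mul (ha : SQ a) (hb : SQ b) : SQ (fun x => a x * b x) := by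
  constructor
  · simpa only [Quaternion.re_mul] using
      (((ha.re.mul hb.re).sub (ha.imI.mul hb.imI)).sub (ha.imJ.mul hb.imJ)).sub (ha.imK.mul hb.imK)
  · simpa only [Quaternion.imI_mul] using
      (((ha.re.mul hb.imI).add (ha.imI.mul hb.re)).add (ha.imJ.mul hb.imK)).sub (ha.imK.mul hb.imJ)
  · simpa only [Quaternion.imJ_mul] using
      (((ha.re.mul hb.imJ).sub (ha.imI.mul hb.imK)).add (ha.imJ.mul hb.re)).add (ha.imK.mul hb.imI)
  · simpa only [Quaternion.imK_mul] using
      (((ha.re.mul hb.imK).add (ha.imI.mul hb.imJ)).sub (ha.imJ.mul hb.imI)).add (ha.imK.mul hb.re)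
lemma SQ.rsmul (hr : St r) (ha : SQ a) : SQ (fun x => r x • a x) := by
  constructor
  · simpa only [Quaternion.re_smul, smul_eq_mul] using hr.mul ha.re
  · simpa only [Quaternion.imI_smul, smul_eq_mul] using hr.mul ha.imI
  · simpa only [Quaternion.imJ_smul, smul_eq_mul] using hr.mul ha.imJ
  · simpa only [Quaternion.imK_smul, smul_eq_mul] using hr.mul ha.imK
lemma SQ.nrm (ha : SQ a) : St (fun x => ‖a x‖) := by
  have := (((ha.re.pow2.add ha.imI.pow2).add ha.imJ.pow2).add ha.imK.pow2).sqrt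
  simpa only [← qnorm_sq, Real.sqrt_sq (norm_nonneg _)] using this
lemma SQ.ite (hr : St r) (ha : SQ a) (hb : SQ b) : SQ (fun x => if 0 < r x then a x else b x) := by
  have e : (fun x => if 0 < r x then a x else b x) = fun x => qmk
    (if 0 < r x then (a x).re else (b x).re) (if 0 < r x then (a x).imI else (b x).imI)
    (if 0 < r x then (a x).imJ else (b x).imJ) (if 0 < r x then (a x).imK else (b x).imK) := by
    funext x; split_ifs <;> rfl
  rw [e]
  exact SQ.mk4 (hr.ite ha.re hb.re) (hr.ite ha.imI hb.imI) (hr.ite ha.imJ hb.imJ)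
    (hr.ite ha.imK hb.imK)

lemma SV.mk2 (hf : SC f) (hr : St r) : SV (fun x => (f x, r x)) := ⟨hf, hr⟩
lemma SV.vec (hV : SV V) : SQ (fun x => vec (V x)) := SQ.mk4 (St.const 0) hV.p2 hV.p1.im hV.p1.re.neg
lemma SQ.h12 (ha : SQ a) : SC (fun x => h12 (a x)) := SC.mk2 ha.imK.neg ha.imJ
lemma SQ.unv (ha : SQ a) : SV (fun x => unv (a x)) := ⟨ha.h12, ha.imI⟩
lemma SV.rsmul (hr : St r) (hV : SV V) : SV (fun x => r x • V x) :=
  ⟨SC.rsmul hr hV.p1, hr.mul hV.p2⟩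
lemma SV.ite (hr : St r) (hV : SV V) (hW : SV W) : SV (fun x => if 0 < r x then V x else W x) := by
  have e : (fun x => if 0 < r x then V x else W x) = fun x => (((⟨
    if 0 < r x then (V x).1.re else (W x).1.re, if 0 < r x then (V x).1.im else (W x).1.im⟩ : ℂ),
    if 0 < r x then (V x).2 else (W x).2) : ℂ × ℝ) := by
    funext x; split_ifs <;> rfl
  rw [e]
  exact SV.mk2 (SC.mk2 (hr.ite hV.p1.re hW.p1.re) (hr.ite hV.p1.im hW.p1.im)) (hr.ite hV.p2 hW.p2)

lemma SQ.hpT (ha : SQ a) (hb : SQ b) : St (fun x => hpT (a x) (b x)) := ha.nrm.pow2.sub hb.nrm.pow2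
lemma SQ.hpH (ha : SQ a) (hb : SQ b) : SQ (fun x => hpH (a x) (b x)) :=
  SQ.rsmul (St.const 2) (ha.star.mul hb)
lemma SQ.ip (ha : SQ a) (hb : SQ b) : St (fun x => ip (a x) (b x)) :=
  (((ha.re.mul hb.re).add (ha.imI.mul hb.imI)).add (ha.imJ.mul hb.imJ)).add (ha.imK.mul hb.imK)
lemma SQ.nn (hr : St r) (ha : SQ a) : St (fun x => nn (r x) (a x)) := (hr.pow2.add ha.nrm.pow2).sqrt
lemma SQ.dd (hr : St r) (ha : SQ a) (hs : St s) (hb : SQ b) : St (fun x => dd (r x) (a x) (s x) (b x)) :=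
  (((SQ.nn hr ha).mul (SQ.nn hs hb)).add (hr.mul hs)).add (ha.ip hb)

structure S2 (f : (ι → ℝ) → Qt × Qt) : Prop where
  q1 : SQ (fun x => (f x).1)
  q2 : SQ (fun x => (f x).2)

lemma SQ.lift (ha : SQ a) (hb : SQ b) (ht : St t) (hh : SQ h) :
    S2 (fun x => lift (a x) (b x) (t x) (h x)) := by
  have hd := ((St.const 2).mul (SQ.dd (ha.hpT hb) (ha.hpH hb) ht hh)).sqrt.inv
  have hn := SQ.nn ht hh
  exact ⟨SQ.rsmul hd ((SQ.rsmul (hn.add ht) ha).add (hb.mul hh.star)),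
    SQ.rsmul hd ((SQ.rsmul (hn.sub ht) hb).add (ha.mul hh))⟩

structure STS (f : (ι → ℝ) → TS) : Prop where
  z : SC (fun x => (f x).1)
  x : St (fun x => (f x).2.1)
  ab : S2 (fun x => (f x).2.2)

structure SOS (f : (ι → ℝ) → OS) : Prop where
  V : SV (fun x => (f x).1)
  c : SC (fun x => (f x).2.1)
  ab : S2 (fun x => (f x).2.2)

lemma STS.TT (e : ℝ) {p : (ι → ℝ) → TS} (hp : STS p) : STS (fun x => TT e (p x)) := by
  have hT := hp.ab.q1.hpT hp.ab.q2
  have hH := hp.ab.q1.hpH hp.ab.q2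
  have hm := hp.z.add ((SC.const (e : ℂ)).mul (SC.mk2 hT hH.re))
  exact ⟨hm, hp.x.sub ((St.const e).mul hH.imI),
    hp.ab.q1.lift hp.ab.q2 hT (hH.add (SV.vec (SV.mk2 (hp.z.sqc.sub hm.sqc) (St.const 0))))⟩

lemma SV.b0 (hV : SV V) (hf : SC f) : SV (fun x => b0 (V x) (f x)) := SV.mk2 (hV.p1.sqc.add hf) hV.p2
lemma SV.rot (ha : SQ a) (hV : SV V) : SV (fun x => rot (a x) (V x)) :=
  ((ha.mul hV.vec).mul ha.star).unv
lemma SV.eps (hf : SC f) (hV : SV V) : St (fun x => eps (f x) (V x)) :=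
  ((hf.re.mul hV.p1.sqc.re).add (hf.im.mul hV.p1.sqc.im)).mul hV.vec.nrm.inv
lemma St.rho (hr : St r) (hs : St s) (ht : St t) : St (fun x => rho (r x) (s x) (t x)) :=
  ht.neg.add ((ht.pow2.add hr.pow2).sub hs.pow2).sqrt
lemma SV.KK (ha : SQ a) (hr : St r) (hs : St s) (hf : SC f) (hV : SV V) :
    SV (fun x => KK (a x) (r x) (s x) (f x) (V x)) := by
  have hR := SV.rot ha hV
  exact SV.ite (((St.const 3).mul hs).sub hr) hR
    (SV.rsmul ((St.rho hr hs (SV.eps hf hR)).mul hR.vec.nrm.inv) hR)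
lemma SQ.qp (hf : SC f) (hg : SC g) : SQ (fun x => qp (f x) (g x)) := SQ.mk4 hf.re hf.im hg.re hg.im
lemma SC.aa (hf : SC f) (hr : St r) : SC (fun x => aa (f x) (r x)) :=
  SC.rsmul ((hf.nrm.maxx (hr.div (St.const 3))).inv) hf
lemma SC.bb (hf : SC f) (hr : St r) : St (fun x => bb (f x) (r x)) :=
  ((St.const 1).sub (hf.aa hr).nrm.pow2).sqrt
lemma SC.gg (hf : SC f) (hr : St r) : SQ (fun x => gg (f x) (r x)) :=
  SQ.qp (hf.aa hr) (SC.of (hf.bb hr))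
lemma SV.Fm (hV : SV V) (hf : SC f) : SQ (fun x => Fm (V x) (f x)) := (hV.b0 hf.star).vec
lemma SV.nF (hV : SV V) (hf : SC f) : St (fun x => nF (V x) (f x)) := (hV.b0 hf.star).vec.nrm
lemma SV.Kf (hV : SV V) (hf : SC f) : SV (fun x => Kf (V x) (f x)) :=
  SV.KK (hf.gg (hV.nF hf)) (hV.nF hf) hf.nrm hf.kap hV
lemma SV.Ki (hV : SV V) (hf : SC f) : SV (fun x => Ki (V x) (f x)) :=
  SV.KK (hf.gg (hV.b0 hf.kap).vec.nrm).star (hV.b0 hf.kap).vec.nrm hf.nrm hf.star hV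
lemma SV.Fp (hV : SV V) (hf : SC f) : SQ (fun x => Fp (V x) (f x)) := ((hV.Kf hf).b0 hf.kap).vec
lemma SV.Sp (hf : SC f) (hr : St r) (hs : St s) (hV : SV V) :
    SQ (fun x => Sp (f x) (r x) (s x) (V x)) := by
  have hb := SC.of hr
  have h1 := SC.of (hs.add hV.p2)
  have h2 := SC.of (hs.sub hV.p2)
  exact SQ.qp (((hf.mul h1).sub (hb.mul hV.p1.star)).sqc.add ((hf.mul h2).add (hb.mul hV.p1.star)).sqc)
    (((hf.mul hV.p1).add (hb.mul h1)).sqc.sub ((hf.mul hV.p1).sub (hb.mul h2)).sqc)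
lemma SV.Ss (hV : SV V) (hf : SC f) : SQ (fun x => Ss (V x) (f x)) :=
  SV.Sp (hf.aa (hV.nF hf)) (hf.bb (hV.nF hf)) (hV.vec.nrm.maxx hf.nrm) hV
lemma SV.Wp (hV : SV V) (hf : SC f) : SQ (fun x => Wp (V x) (f x)) :=
  (SQ.rsmul ((hV.nF hf).pow2.add ((((St.const 3).mul hf.nrm).sub (hV.nF hf)).maxx (St.const 0)))
    (hV.Ss hf)).sub (((hV.Fp hf).mul (hV.Ss hf)).mul (hV.Fm hf))
lemma SQ.kq : SQ (fun _ : ι → ℝ => kq) := SQ.mk4 (St.const 0) (St.const 0) (St.const 0) (St.const 1)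
lemma SQ.nu (ha : SQ a) : SQ (fun x => nu (a x)) := SQ.ite ha.nrm (SQ.rsmul ha.nrm.inv ha) SQ.kq
lemma SV.Sg0 (hV : SV V) (hf : SC f) (hr : St r) : SQ (fun x => Sg0 (V x) (f x) (r x)) := by
  have hn := hV.nF hf
  have hM := hr.maxx hn
  have hp : St (fun x => phi (max (r x) (RealMilnor.nF (V x) (f x))) (RealMilnor.nF (V x) (f x))) :=
    ((St.const 2).sub (hM.mul hn.inv)).maxx (St.const 0)
  have hV2 : SV (fun x => V2 (phi (max (r x) (RealMilnor.nF (V x) (f x))) (RealMilnor.nF (V x) (f x))) (V x)) :=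
    SV.mk2 (SC.rsmul hp hV.p1) hV.p2
  have hc2 : SC (fun x => c2 (phi (max (r x) (RealMilnor.nF (V x) (f x))) (RealMilnor.nF (V x) (f x))) (V x) (f x)) :=
    hf.add (SC.rsmul ((St.const 1).sub hp) hV.p1.sqc.star)
  have hm := ((St.const 2).mul hn).minn hM
  exact (SQ.rsmul hm (hV2.Wp hc2).nu).add (SQ.rsmul (hM.sub hm) SQ.kq)
lemma SV.Sig (hV : SV V) (hf : SC f) (hr : St r) : SQ (fun x => Sig (V x) (f x) (r x)) :=
  (hV.Sg0 hf hr).nu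
lemma SQ.imq (ha : SQ a) : SQ (fun x => imq (a x)) := SQ.mk4 (St.const 0) ha.imI ha.imJ ha.imK
lemma SQ.req (ha : SQ a) : SQ (fun x => req (a x)) :=
  SQ.mk4 ha.re (St.const 0) (St.const 0) (St.const 0)
lemma SQ.qq (ht : St t) (ha : SQ a) : St (fun x => qq (t x) (a x)) := (ht.pow2.add ha.re.pow2).sqrt
lemma SV.Ph (hV : SV V) (hf : SC f) (ha : SQ a) : SQ (fun x => Ph (V x) (f x) (a x)) :=
  (hV.Fm hf).add ha.imq
lemma SV.hN (hV : SV V) (hf : SC f) (ha : SQ a) : SQ (fun x => hN (V x) (f x) (a x)) := by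
  have hP := hV.Ph hf ha
  have hS := hV.Sig hf hP.nrm
  exact ha.req.add (((hS.mul hP).mul hS.star).sub (hV.Fp hf))
lemma SOS.OO {p : (ι → ℝ) → OS} (hp : SOS p) : SOS (fun x => OO (p x)) := by
  have hT := hp.ab.q1.hpT hp.ab.q2
  have hH := hp.ab.q1.hpH hp.ab.q2
  have hS := (hp.V.Sig hp.c ((hp.V.Ph hp.c hH).nrm.add (SQ.qq hT hH))).star
  exact ⟨hp.V.Kf hp.c, hp.c, (hp.ab.q1.mul hS).lift (hp.ab.q2.mul hS) hT (hp.V.hN hp.c hH)⟩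
lemma SOS.OI {p : (ι → ℝ) → OS} (hp : SOS p) : SOS (fun x => OI (p x)) := by
  have hT := hp.ab.q1.hpT hp.ab.q2
  have hH := hp.ab.q1.hpH hp.ab.q2
  have hV := hp.V.Ki hp.c
  have hP := (hp.V.b0 hp.c.kap).vec.add hH.imq
  have hs := hV.Sig hp.c (hP.nrm.add (SQ.qq hT hH))
  have h1 := hV.Sig hp.c hP.nrm
  have hI := hH.req.add (((h1.star.mul hP).mul h1).sub (hV.Fm hp.c))
  have hL := hp.ab.q1.lift hp.ab.q2 hT ((hs.mul hI).mul hs.star)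
  exact ⟨hV, hp.c, hL.q1.mul hs, hL.q2.mul hs⟩

end SAlg

section Charts

def m13 (x0 x1 x2 x3 x4 x5 x6 x7 x8 x9 x10 x11 x12 : ℝ) : Fin 13 → ℝ :=
  ![x0, x1, x2, x3, x4, x5, x6, x7, x8, x9, x10, x11, x12]

lemma m13_forall {P : Fin 13 → Prop} (h0 : P 0) (h1 : P 1) (h2 : P 2) (h3 : P 3) (h4 : P 4)
    (h5 : P 5) (h6 : P 6) (h7 : P 7) (h8 : P 8) (h9 : P 9) (h10 : P 10) (h11 : P 11)
    (h12 : P 12) : ∀ k, P k := by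
  intro k
  fin_cases k <;> assumption

/-- first chart -/
def cf (y : Fin 13 → ℝ) : OS :=
  ((⟨y 2, y 3⟩, y 12), star (⟨y 0, y 1⟩ - sqc ⟨y 2, y 3⟩ -
    h12 (hpH (qmk (y 4) (y 5) (y 6) (y 7)) (qmk (y 8) (y 9) (y 10) (y 11)))),
    qmk (y 4) (y 5) (y 6) (y 7), qmk (y 8) (y 9) (y 10) (y 11))

def cfw (p : OS) : ℂ := sqc p.1.1 + h12 (hpH p.2.2.1 p.2.2.2) + star p.2.1

def cfi (p : OS) : Fin 13 → ℝ :=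
  m13 (cfw p).re (cfw p).im p.1.1.re p.1.1.im p.2.2.1.re p.2.2.1.imI p.2.2.1.imJ p.2.2.1.imK
    p.2.2.2.re p.2.2.2.imI p.2.2.2.imJ p.2.2.2.imK p.1.2

lemma cf_cfi (p : OS) : cf (cfi p) = p := by
  obtain ⟨⟨z, x⟩, c, a, b⟩ := p
  have ha : qmk a.re a.imI a.imJ a.imK = a := rfl
  have hb : qmk b.re b.imI b.imJ b.imK = b := rfl
  change ((z, x), star (cfw ((z, x), c, a, b) - sqc z - h12 (hpH a b)), a, b) = _
  have : cfw ((z, x), c, a, b) - sqc z - h12 (hpH a b) = star c := by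
    simp only [cfw]; ring
  rw [this, star_star]

lemma cfw_cf (y : Fin 13 → ℝ) : cfw (cf y) = ⟨y 0, y 1⟩ := by
  simp only [cfw, cf, star_star]; ring

lemma cfi_cf (y : Fin 13 → ℝ) : cfi (cf y) = y := by
  rw [cfi, cfw_cf]
  funext k
  revert k
  exact m13_forall rfl rfl rfl rfl rfl rfl rfl rfl rfl rfl rfl rfl rfl

def sr (z : ℂ) : ℂ := (√‖z‖)⁻¹ • z
def sri (z : ℂ) : ℂ := ‖z‖ • z
def cr (z : ℂ) : ℂ := (cbr ‖z‖ ^ 2)⁻¹ • z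
def cri (z : ℂ) : ℂ := ‖z‖ ^ 2 • z

lemma sr_sq (z : ℂ) : sr z ^ 2 = sqc z := by
  have : √‖z‖ ^ 2 = ‖z‖ := Real.sq_sqrt (norm_nonneg _)
  rw [sr, sqc, smul_pow, inv_pow, this, Complex.real_smul, Complex.ofReal_inv]
  field_simp

lemma cr_cube (z : ℂ) : cr z ^ 3 = kap z := by
  have : (cbr ‖z‖ ^ 2) ^ 3 = ‖z‖ ^ 2 := by
    rw [← pow_mul, mul_comm, pow_mul, cbr_pow (norm_nonneg _)]
  rw [cr, kap, smul_pow, inv_pow, this, Complex.real_smul, Complex.ofReal_inv, Complex.ofReal_pow]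
  rw [div_eq_mul_inv, mul_comm]

lemma sr_norm (z : ℂ) : ‖sr z‖ = √‖z‖ := by
  have : √‖z‖ ^ 2 = ‖z‖ := Real.sq_sqrt (norm_nonneg _)
  rw [sr, norm_smul, norm_inv, Real.norm_eq_abs, abs_of_nonneg (Real.sqrt_nonneg _)]
  nth_rewrite 2 [← this]
  rcases eq_or_ne (√‖z‖) 0 with h | h
  · simp [h]
  · field_simp

lemma cr_norm (z : ℂ) : ‖cr z‖ = cbr ‖z‖ := by
  have : cbr ‖z‖ ^ 3 = ‖z‖ := cbr_pow (norm_nonneg _)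
  have h0 := cbr_nonneg ‖z‖
  rw [cr, norm_smul, norm_inv, Real.norm_eq_abs, abs_of_nonneg (by positivity)]
  nth_rewrite 2 [← this]
  rcases eq_or_ne (cbr ‖z‖) 0 with h | h
  · simp [h]
  · field_simp

lemma sri_sr (z : ℂ) : sri (sr z) = z := by
  rw [sri, sr_norm, sr, smul_smul]
  rcases eq_or_ne z 0 with rfl | h
  · simp
  · rw [mul_inv_cancel₀ (by positivity), one_smul]

lemma cri_cr (z : ℂ) : cri (cr z) = z := by
  rw [cri, cr_norm, cr, smul_smul]
  rcases eq_or_ne z 0 with rfl | h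
  · simp
  · have h1 : cbr ‖z‖ ≠ 0 := by
      intro h2
      have := cbr_pow (norm_nonneg z)
      rw [h2] at this
      simp at this
      exact h (norm_eq_zero.mp this.symm)
    rw [mul_inv_cancel₀ (by positivity), one_smul]

lemma sr_sri (z : ℂ) : sr (sri z) = z := by
  have : ‖sri z‖ = ‖z‖ ^ 2 := by rw [sri, norm_smul, norm_norm, sq]
  rw [sr, this, Real.sqrt_sq (norm_nonneg _), sri, smul_smul]
  rcases eq_or_ne z 0 with rfl | h
  · simp
  · rw [inv_mul_cancel₀ (by positivity), one_smul]

lemma cr_cri (z : ℂ) : cr (cri z) = z := by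
  have h1 : ‖cri z‖ = ‖z‖ ^ 3 := by rw [cri, norm_smul, norm_pow, norm_norm]; ring
  have h2 : cbr (‖z‖ ^ 3) = ‖z‖ :=
    (pow_left_inj₀ (cbr_nonneg _) (norm_nonneg _) three_ne_zero).mp (cbr_pow (by positivity))
  rw [cr, h1, h2, cri, smul_smul]
  rcases eq_or_ne z 0 with rfl | h
  · simp
  · rw [inv_mul_cancel₀ (by positivity), one_smul]

lemma sri_continuous : Continuous sri := by unfold sri; fun_prop
lemma cri_continuous : Continuous cri := by unfold cri; fun_prop
lemma sr_continuous : Continuous sr := by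
  refine cont_inv (h := sri) sr_sri sri_sr sri_continuous (fun R => ⟨√R, fun y hy => ?_⟩)
  rw [sr_norm]; exact Real.sqrt_le_sqrt hy
lemma cr_continuous : Continuous cr := by
  refine cont_inv (h := cri) cr_cri cri_cr cri_continuous (fun R => ⟨R + 1, fun y hy => ?_⟩)
  rw [cr_norm]
  have h1 := cbr_pow (norm_nonneg y)
  have h2 := cbr_nonneg ‖y‖
  generalize cbr ‖y‖ = u at *
  by_contra! h
  have : 0 ≤ R := (norm_nonneg y).trans hy
  nlinarith [mul_nonneg h2 h2, mul_nonneg (mul_nonneg h2 h2) h2, sq_nonneg (u - 1)]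

/-- second chart -/
def cg (p : OS) : Fin 13 → ℝ :=
  let a := p.2.2.1
  let b := p.2.2.2
  m13 (sr p.1.1).re (sr p.1.1).im ((a.imI + 2 * b.imJ) / 2) ((a.re + 2 * b.imK) / 2)
    ((a.re - 2 * b.imK) / 2) (-(a.imI - 2 * b.imJ) / 2) ((a.imK + 2 * b.re) / 2)
    ((-a.imJ - 2 * b.imI) / 2) ((-a.imJ + 2 * b.imI) / 2) (-(a.imK - 2 * b.re) / 2)
    (cr p.2.1).re (cr p.2.1).im p.1.2

def cgi (y : Fin 13 → ℝ) : OS :=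
  ((sri ⟨y 0, y 1⟩, y 12), cri ⟨y 10, y 11⟩,
    qmk (y 3 + y 4) (y 2 - y 5) (-(y 7 + y 8)) (y 6 - y 9),
    qmk ((y 6 + y 9) / 2) (-(y 7 - y 8) / 2) ((y 2 + y 5) / 2) ((y 3 - y 4) / 2))

lemma cgi_cg (p : OS) : cgi (cg p) = p := by
  obtain ⟨⟨z, x⟩, c, a, b⟩ := p
  have h1 : sri ⟨cg ((z, x), c, a, b) 0, cg ((z, x), c, a, b) 1⟩ = z := sri_sr z
  have h2 : cri ⟨cg ((z, x), c, a, b) 10, cg ((z, x), c, a, b) 11⟩ = c := cri_cr c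
  rw [cgi, h1, h2]
  refine congrArg₂ Prod.mk rfl (congrArg₂ Prod.mk rfl (congrArg₂ Prod.mk ?_ ?_))
  · ext
    · change (a.re + 2 * b.imK) / 2 + (a.re - 2 * b.imK) / 2 = a.re; ring
    · change (a.imI + 2 * b.imJ) / 2 - (-(a.imI - 2 * b.imJ) / 2) = a.imI; ring
    · change -((-a.imJ - 2 * b.imI) / 2 + (-a.imJ + 2 * b.imI) / 2) = a.imJ; ring
    · change (a.imK + 2 * b.re) / 2 - (-(a.imK - 2 * b.re) / 2) = a.imK; ring
  · ext
    · change ((a.imK + 2 * b.re) / 2 + (-(a.imK - 2 * b.re) / 2)) / 2 = b.re; ring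
    · change -((-a.imJ - 2 * b.imI) / 2 - (-a.imJ + 2 * b.imI) / 2) / 2 = b.imI; ring
    · change ((a.imI + 2 * b.imJ) / 2 + (-(a.imI - 2 * b.imJ) / 2)) / 2 = b.imJ; ring
    · change ((a.re + 2 * b.imK) / 2 - (a.re - 2 * b.imK) / 2) / 2 = b.imK; ring

lemma cg_cgi (y : Fin 13 → ℝ) : cg (cgi y) = y := by
  have h1 : sr (cgi y).1.1 = ⟨y 0, y 1⟩ := sr_sri _
  have h2 : cr (cgi y).2.1 = ⟨y 10, y 11⟩ := cr_cri _
  rw [cg, h1, h2]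
  funext k
  revert k
  refine m13_forall rfl rfl ?_ ?_ ?_ ?_ ?_ ?_ ?_ ?_ rfl rfl rfl
  · change ((y 2 - y 5) + 2 * ((y 2 + y 5) / 2)) / 2 = y 2; ring
  · change ((y 3 + y 4) + 2 * ((y 3 - y 4) / 2)) / 2 = y 3; ring
  · change ((y 3 + y 4) - 2 * ((y 3 - y 4) / 2)) / 2 = y 4; ring
  · change -((y 2 - y 5) - 2 * ((y 2 + y 5) / 2)) / 2 = y 5; ring
  · change ((y 6 - y 9) + 2 * ((y 6 + y 9) / 2)) / 2 = y 6; ring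
  · change (-(-(y 7 + y 8)) - 2 * (-(y 7 - y 8) / 2)) / 2 = y 7; ring
  · change (-(-(y 7 + y 8)) + 2 * (-(y 7 - y 8) / 2)) / 2 = y 8; ring
  · change -((y 6 - y 9) - 2 * ((y 6 + y 9) / 2)) / 2 = y 9; ring

lemma zc_eq (x : Fin 13 → ℝ) (j : Fin 6) (k l : Fin 13) (hk : k.1 = 2 * j.1) (hl : l.1 = 2 * j.1 + 1) :
    zc x j = ⟨x k, x l⟩ := by
  have h1 : k = ⟨2 * j.1, by have := j.isLt; omega⟩ := Fin.ext hk
  have h2 : l = ⟨2 * j.1 + 1, by have := j.isLt; omega⟩ := Fin.ext hl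
  rw [zc, Complex.mk_eq_add_mul_I, ← h1, ← h2]

lemma fKer_cf (y : Fin 13 → ℝ) : fKer y = ‖vec (cfw (cf y), (cf y).1.2)‖ ^ 2 := by
  rw [norm_vec_sq, cfw_cf, fKer, zc_eq y 0 0 1 rfl rfl, Complex.normSq_eq_norm_sq]
  rfl

lemma gKer_cg (p : OS) : gKer (cg p) =
    ‖vec (sqc p.1.1 + h12 (hpH p.2.2.1 p.2.2.2) + kap p.2.1, p.1.2)‖ ^ 2 := by
  obtain ⟨⟨z, x⟩, c, a, b⟩ := p
  rw [norm_vec_sq, gKer, zc_eq _ 0 0 1 rfl rfl, zc_eq _ 1 2 3 rfl rfl, zc_eq _ 2 4 5 rfl rfl,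
    zc_eq _ 3 6 7 rfl rfl, zc_eq _ 4 8 9 rfl rfl, zc_eq _ 5 10 11 rfl rfl,
    Complex.normSq_eq_norm_sq]
  congr 2
  change ‖(sr z) ^ 2 + (⟨(a.imI + 2 * b.imJ) / 2, (a.re + 2 * b.imK) / 2⟩ : ℂ) ^ 2 +
    (⟨(a.re - 2 * b.imK) / 2, -(a.imI - 2 * b.imJ) / 2⟩ : ℂ) ^ 2 +
    (⟨(a.imK + 2 * b.re) / 2, (-a.imJ - 2 * b.imI) / 2⟩ : ℂ) ^ 2 +
    (⟨(-a.imJ + 2 * b.imI) / 2, -(a.imK - 2 * b.re) / 2⟩ : ℂ) ^ 2 + (cr c) ^ 3‖ =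
    ‖sqc z + h12 (hpH a b) + kap c‖
  rw [sr_sq, cr_cube]
  congr 2
  rw [add_assoc, add_assoc, add_assoc]
  congr 1
  apply Complex.ext <;> simp [h12, hpH, sq] <;> ring

/-- the shear in the coordinates of `OS` -/
def TO (e : ℝ) (p : OS) : OS :=
  let q := TT e (p.1.1, p.1.2, p.2.2.1, p.2.2.2)
  ((q.1, q.2.1), p.2.1, q.2.2)

lemma TO_inv (e : ℝ) (p : OS) : TO (-e) (TO e p) = p := by
  have h := TT_inv e (p.1.1, p.1.2, p.2.2.1, p.2.2.2)
  change (((TT (-e) (TT e (p.1.1, p.1.2, p.2.2.1, p.2.2.2))).1,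
    (TT (-e) (TT e (p.1.1, p.1.2, p.2.2.1, p.2.2.2))).2.1), p.2.1,
    (TT (-e) (TT e (p.1.1, p.1.2, p.2.2.1, p.2.2.2))).2.2) = p
  rw [h]

lemma TO_continuous (e : ℝ) : Continuous (TO e) := by
  have h : Continuous (fun p : OS => TT e (p.1.1, p.1.2, p.2.2.1, p.2.2.2)) :=
    (TT_continuous e).comp ((continuous_fst.comp continuous_fst).prodMk
      ((continuous_snd.comp continuous_fst).prodMk (continuous_snd.comp continuous_snd)))
  exact (h.fst.prodMk h.snd.fst).prodMk ((continuous_fst.comp continuous_snd).prodMk h.snd.snd)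

/-- level vector -/
def lv (p : OS) (k : ℂ) : Qt := vec (sqc p.1.1 + h12 (hpH p.2.2.1 p.2.2.2) + k, p.1.2)

lemma lv_TO (p : OS) (k : ℂ) :
    vec (b0 (TO 1 p).1 k) + imq (hpH (TO 1 p).2.2.1 (TO 1 p).2.2.2) = lv p k := by
  have h1 := TT_level 1 (p.1.1, p.1.2, p.2.2.1, p.2.2.2)
  have h2 := TT_imI 1 (p.1.1, p.1.2, p.2.2.1, p.2.2.2)
  change vec (sqc (TT 1 (p.1.1, p.1.2, p.2.2.1, p.2.2.2)).1 + k,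
    (TT 1 (p.1.1, p.1.2, p.2.2.1, p.2.2.2)).2.1) +
    imq (hpH (TT 1 (p.1.1, p.1.2, p.2.2.1, p.2.2.2)).2.2.1
      (TT 1 (p.1.1, p.1.2, p.2.2.1, p.2.2.2)).2.2.2) = _
  rw [TT_snd]
  simp only at h1 h2 ⊢
  have hr := congrArg Complex.re h1
  have hi := congrArg Complex.im h1
  simp only [h12, Complex.add_re, Complex.add_im] at hr hi
  ext
  · simp [lv, imq]
  · simp [lv, imq, h2]
  · simp [lv, imq, h12]; linarith
  · simp [lv, imq, h12]; linarith

lemma fg (y : Fin 13 → ℝ) : fKer y = gKer (cg (TO (-1) (OO (TO 1 (cf y))))) := by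
  rw [fKer_cf, gKer_cg]
  have h1 := lv_TO (cf y) (star (cf y).2.1)
  have h2 := lv_TO (TO (-1) (OO (TO 1 (cf y)))) (kap (cf y).2.1)
  have h3 : TO 1 (TO (-1) (OO (TO 1 (cf y)))) = OO (TO 1 (cf y)) := by
    have := TO_inv (-1) (OO (TO 1 (cf y)))
    rwa [neg_neg] at this
  rw [h3] at h2
  have h4 := OO_level (TO 1 (cf y))
  change ‖lv (cf y) (star (cf y).2.1)‖ ^ 2 = ‖lv (TO (-1) (OO (TO 1 (cf y)))) (kap (cf y).2.1)‖ ^ 2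
  rw [← h1, ← h2]
  exact congrArg (· ^ 2) h4.symm

end Charts

section Final

lemma cont_m13 {X : Type*} [TopologicalSpace X] {f : X → Fin 13 → ℝ}
    (h : ∀ k, Continuous (fun x => f x k)) : Continuous f := continuous_pi h

lemma cf_continuous : Continuous cf := by
  have c (k : Fin 13) : Continuous (fun y : Fin 13 → ℝ => y k) := continuous_apply k
  have ha := qmk_continuous (c 4) (c 5) (c 6) (c 7)
  have hb := qmk_continuous (c 8) (c 9) (c 10) (c 11)
  have hz := cmk_continuous (c 2) (c 3)
  have hH : Continuous (fun y : Fin 13 → ℝ =>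
      hpH (qmk (y 4) (y 5) (y 6) (y 7)) (qmk (y 8) (y 9) (y 10) (y 11))) :=
    (ha.star.mul hb).const_smul (2 : ℝ)
  exact (hz.prodMk (c 12)).prodMk ((((cmk_continuous (c 0) (c 1)).sub (continuous_sqc.comp hz)).sub
    (continuous_h12.comp hH)).star.prodMk (ha.prodMk hb))

lemma oz : Continuous (fun p : OS => p.1.1) := continuous_fst.comp continuous_fst
lemma ox : Continuous (fun p : OS => p.1.2) := continuous_snd.comp continuous_fst
lemma oc : Continuous (fun p : OS => p.2.1) := continuous_fst.comp continuous_snd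
lemma oa : Continuous (fun p : OS => p.2.2.1) :=
  continuous_fst.comp (continuous_snd.comp continuous_snd)
lemma ob : Continuous (fun p : OS => p.2.2.2) :=
  continuous_snd.comp (continuous_snd.comp continuous_snd)

lemma cfi_continuous : Continuous cfi := by
  have hH : Continuous (fun p : OS => hpH p.2.2.1 p.2.2.2) := (oa.star.mul ob).const_smul (2 : ℝ)
  have hw : Continuous cfw :=
    ((continuous_sqc.comp oz).add (continuous_h12.comp hH)).add oc.star
  exact cont_m13 (m13_forall (Complex.continuous_re.comp hw) (Complex.continuous_im.comp hw)
    (Complex.continuous_re.comp oz) (Complex.continuous_im.comp oz)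
    (Quaternion.continuous_re.comp oa) (Quaternion.continuous_imI.comp oa)
    (Quaternion.continuous_imJ.comp oa) (Quaternion.continuous_imK.comp oa)
    (Quaternion.continuous_re.comp ob) (Quaternion.continuous_imI.comp ob)
    (Quaternion.continuous_imJ.comp ob) (Quaternion.continuous_imK.comp ob) ox)

lemma cg_continuous : Continuous cg := by
  have hz := sr_continuous.comp oz
  have hc := cr_continuous.comp oc
  have a0 := Quaternion.continuous_re.comp oa
  have a1 := Quaternion.continuous_imI.comp oa
  have a2 := Quaternion.continuous_imJ.comp oa
  have a3 := Quaternion.continuous_imK.comp oa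
  have b0 := continuous_const (y := (2 : ℝ)) |>.mul (Quaternion.continuous_re.comp ob)
  have b1 := continuous_const (y := (2 : ℝ)) |>.mul (Quaternion.continuous_imI.comp ob)
  have b2 := continuous_const (y := (2 : ℝ)) |>.mul (Quaternion.continuous_imJ.comp ob)
  have b3 := continuous_const (y := (2 : ℝ)) |>.mul (Quaternion.continuous_imK.comp ob)
  exact cont_m13 (m13_forall (Complex.continuous_re.comp hz) (Complex.continuous_im.comp hz)
    ((a1.add b2).div_const 2) ((a0.add b3).div_const 2) ((a0.sub b3).div_const 2)
    ((a1.sub b2).neg.div_const 2) ((a3.add b0).div_const 2) ((a2.neg.sub b1).div_const 2)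
    ((a2.neg.add b1).div_const 2) ((a3.sub b0).neg.div_const 2)
    (Complex.continuous_re.comp hc) (Complex.continuous_im.comp hc) ox)

lemma cgi_continuous : Continuous cgi := by
  have c (k : Fin 13) : Continuous (fun y : Fin 13 → ℝ => y k) := continuous_apply k
  exact ((sri_continuous.comp (cmk_continuous (c 0) (c 1))).prodMk (c 12)).prodMk
    ((cri_continuous.comp (cmk_continuous (c 10) (c 11))).prodMk
    ((qmk_continuous ((c 3).add (c 4)) ((c 2).sub (c 5)) ((c 7).add (c 8)).neg
      ((c 6).sub (c 9))).prodMk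
    (qmk_continuous (((c 6).add (c 9)).div_const 2) (((c 7).sub (c 8)).neg.div_const 2)
      (((c 2).add (c 5)).div_const 2) (((c 3).sub (c 4)).div_const 2))))

lemma S_cf : SOS cf := by
  have c (k : Fin 13) : St (fun y : Fin 13 → ℝ => y k) := St.coord k
  have ha := SQ.mk4 (c 4) (c 5) (c 6) (c 7)
  have hb := SQ.mk4 (c 8) (c 9) (c 10) (c 11)
  have hz := SC.mk2 (c 2) (c 3)
  exact ⟨SV.mk2 hz (c 12), (((SC.mk2 (c 0) (c 1)).sub hz.sqc).sub (ha.hpH hb).h12).star, ha, hb⟩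

lemma S_cfi {p : (Fin 13 → ℝ) → OS} (hp : SOS p) : ∀ k, St (fun y => cfi (p y) k) := by
  have hw : SC (fun y => cfw (p y)) :=
    (hp.V.p1.sqc.add (hp.ab.q1.hpH hp.ab.q2).h12).add hp.c.star
  exact m13_forall hw.re hw.im hp.V.p1.re hp.V.p1.im hp.ab.q1.re hp.ab.q1.imI hp.ab.q1.imJ
    hp.ab.q1.imK hp.ab.q2.re hp.ab.q2.imI hp.ab.q2.imJ hp.ab.q2.imK hp.V.p2

lemma S_cg {p : (Fin 13 → ℝ) → OS} (hp : SOS p) : ∀ k, St (fun y => cg (p y) k) := by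
  have hz : SC (fun y => sr (p y).1.1) := SC.rsmul hp.V.p1.nrm.sqrt.inv hp.V.p1
  have hc : SC (fun y => cr (p y).2.1) := SC.rsmul (hp.c.nrm.un un_cbr).pow2.inv hp.c
  have two : St (fun _ : Fin 13 → ℝ => (2 : ℝ)) := St.const 2
  have a0 := hp.ab.q1.re
  have a1 := hp.ab.q1.imI
  have a2 := hp.ab.q1.imJ
  have a3 := hp.ab.q1.imK
  have b0 := two.mul hp.ab.q2.re
  have b1 := two.mul hp.ab.q2.imI
  have b2 := two.mul hp.ab.q2.imJ
  have b3 := two.mul hp.ab.q2.imK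
  exact m13_forall hz.re hz.im ((a1.add b2).div two) ((a0.add b3).div two) ((a0.sub b3).div two)
    ((a1.sub b2).neg.div two) ((a3.add b0).div two) ((a2.neg.sub b1).div two)
    ((a2.neg.add b1).div two) ((a3.sub b0).neg.div two) hc.re hc.im hp.V.p2

lemma S_cgi : SOS cgi := by
  have c (k : Fin 13) : St (fun y : Fin 13 → ℝ => y k) := St.coord k
  have two : St (fun _ : Fin 13 → ℝ => (2 : ℝ)) := St.const 2
  have h0 := SC.mk2 (c 0) (c 1)
  have h5 := SC.mk2 (c 10) (c 11)
  exact ⟨SV.mk2 (SC.rsmul h0.nrm h0) (c 12), SC.rsmul h5.nrm.pow2 h5,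
    SQ.mk4 ((c 3).add (c 4)) ((c 2).sub (c 5)) ((c 7).add (c 8)).neg ((c 6).sub (c 9)),
    SQ.mk4 (((c 6).add (c 9)).div two) (((c 7).sub (c 8)).neg.div two)
      (((c 2).add (c 5)).div two) (((c 3).sub (c 4)).div two)⟩

lemma SOS.TO (e : ℝ) {p : (Fin 13 → ℝ) → OS} (hp : SOS p) : SOS (fun y => TO e (p y)) := by
  have h := STS.TT e (p := fun y => ((p y).1.1, (p y).1.2, (p y).2.2.1, (p y).2.2.2))
    ⟨hp.V.p1, hp.V.p2, hp.ab⟩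
  exact ⟨⟨h.z, h.x⟩, hp.c, h.ab⟩

lemma hN_zero : hN 0 0 0 = 0 := by
  have h := OO_good 0 0 0 0
  rw [mul_zero, zero_mul] at h
  rcases h with ⟨_, _, _, h⟩ | h
  · exact h
  · exfalso
    have h0 : nn 0 0 = 0 := nn_zero_iff.mpr ⟨rfl, rfl⟩
    rw [dd, h0] at h
    have h1 (q : Qt) : ip 0 q = 0 := by
      change (0 : ℝ) * _ + 0 * _ + 0 * _ + 0 * _ = 0
      ring
    rw [h1] at h
    simp at h

lemma hp0 : hpT 0 0 = 0 ∧ hpH 0 0 = 0 := by simp [hpT, hpH]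

lemma cf_zero : cf 0 = 0 := by
  have h : qmk 0 0 0 0 = 0 := rfl
  have h' : (⟨0, 0⟩ : ℂ) = 0 := rfl
  have h3 : h12 0 = 0 := by apply Complex.ext <;> simp [h12] <;> rfl
  simp only [cf, Pi.zero_apply, h, h', hp0.2, h3, sqc_zero, sub_zero, star_zero]
  rfl

lemma TO_zero (e : ℝ) : TO e 0 = 0 := by
  have h' : (⟨0, (0 : Qt).re⟩ : ℂ) = 0 := rfl
  have h2 : vec ((0 : ℂ), (0 : ℝ)) = 0 := vec_zero
  have : TT e ((0 : ℂ), (0 : ℝ), (0 : Qt), (0 : Qt)) = 0 := by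
    simp only [TT, hp0.1, hp0.2, h', mul_zero, add_zero, sqc_zero, sub_zero, h2, lift_zero]
    exact Prod.ext rfl (Prod.ext (by change (0 : ℝ) - e * 0 = 0; ring) rfl)
  change ((((TT e ((0 : ℂ), (0 : ℝ), (0 : Qt), (0 : Qt))).1,
    (TT e ((0 : ℂ), (0 : ℝ), (0 : Qt), (0 : Qt))).2.1), (0 : ℂ),
    (TT e ((0 : ℂ), (0 : ℝ), (0 : Qt), (0 : Qt))).2.2) : OS) = 0
  rw [this]
  rfl

lemma OO_zero : OO 0 = 0 := by
  have e : OO 0 = (Kf 0 0, 0, lift (0 * star (Sg2 0 0 (hpT 0 0) (hpH 0 0)))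
    (0 * star (Sg2 0 0 (hpT 0 0) (hpH 0 0))) (hpT 0 0) (hN 0 0 (hpH 0 0))) := rfl
  rw [e, hp0.1, hp0.2, hN_zero, lift_zero, Kf_zero]
  rfl

lemma cg_zero : cg 0 = 0 := by
  have h : cgi 0 = 0 := by
    have h1 : sri ⟨0, 0⟩ = 0 := by simp [sri]; rfl
    have h2 : cri ⟨0, 0⟩ = 0 := by simp [cri]; rfl
    simp only [cgi, Pi.zero_apply, h1, h2, add_zero, sub_zero, neg_zero, zero_div]
    rfl
  rw [← h, cg_cgi]

def hh (y : Fin 13 → ℝ) : Fin 13 → ℝ := cg (TO (-1) (OO (TO 1 (cf y))))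
def hi (y : Fin 13 → ℝ) : Fin 13 → ℝ := cfi (TO (-1) (OI (TO 1 (cgi y))))

lemma TO_inv2 (p : OS) : TO 1 (TO (-1) p) = p := by
  have := TO_inv (-1) p
  rwa [neg_neg] at this

lemma main_result : ∃ h h' : (Fin 13 → ℝ) → (Fin 13 → ℝ),
      Function.LeftInverse h' h ∧ Function.RightInverse h' h ∧
      Continuous h ∧ Continuous h' ∧
      IsRSA (Fin 13 ⊕ Fin 13) (graphMapOn h Set.univ) ∧
      IsRSA (Fin 13 ⊕ Fin 13) (graphMapOn h' Set.univ) ∧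
      h 0 = 0 ∧
      (fun γ : ℝ → (Fin 13 → ℝ) => h ∘ γ) '' ArcFib fKer = ArcFib gKer ∧
      fKer = gKer ∘ h := by
  refine assemble hh hi ?_ ?_ ?_ ?_ ?_ ?_ ?_ ?_
  · intro y
    rw [hh, hi, cgi_cg, TO_inv2, OI_OO, TO_inv, cfi_cf]
  · intro y
    rw [hh, hi, cf_cfi, TO_inv2, OO_OI, TO_inv, cg_cgi]
  · exact cg_continuous.comp ((TO_continuous (-1)).comp (OO_continuous.comp
      ((TO_continuous 1).comp cf_continuous)))
  · exact cfi_continuous.comp ((TO_continuous (-1)).comp (OI_continuous.comp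
      ((TO_continuous 1).comp cgi_continuous)))
  · exact S_cg ((S_cf.TO 1).OO.TO (-1))
  · exact S_cfi ((S_cgi.TO 1).OI.TO (-1))
  · rw [hh, cf_zero, TO_zero, OO_zero, TO_zero, cg_zero]
  · funext y
    exact fg y

end Final
/-- Proposition `prop-cex`.(1). There is a semialgebraic
homeomorphism `h` of `ℂ⁶ × ℝ ≅ ℝ¹³` with `h(0) = 0` and `h̃(𝒻_f) = 𝒻_g`; indeed one
may take `h` with `f = g ∘ h`. -/
theorem statement18 :
    ∃ h h' : (Fin 13 → ℝ) → (Fin 13 → ℝ),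
      Function.LeftInverse h' h ∧ Function.RightInverse h' h ∧
      Continuous h ∧ Continuous h' ∧
      IsRSA (Fin 13 ⊕ Fin 13) (graphMapOn h Set.univ) ∧
      IsRSA (Fin 13 ⊕ Fin 13) (graphMapOn h' Set.univ) ∧
      h 0 = 0 ∧
      (fun γ : ℝ → (Fin 13 → ℝ) => h ∘ γ) '' ArcFib fKer = ArcFib gKer ∧
      fKer = gKer ∘ h := by
  exact main_result

end RealMilnor
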